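/- Let G ⊂ ℝ² be a Jordan domain bounded by the Jordan curve Γ, let σ be a 2×2 matrix field satisfying the ellipticity conditions σ(x)ξ·ξ ≥ K⁻¹|ξ|² and σ⁻¹(x)ξ·ξ ≥ K⁻¹|ξ|² for all ξ ∈ ℝ², x ∈ G, with K ≥ 1, and assume additionally that the entries σᵢⱼ belong to C^α_loc(G) for some α ∈ (0,1). Let g be a continuous unimodal function on Γ and let u ∈ W^{1,2}_loc(G) ∩ C(cl G) be the weak solution of div(σ∇u) = 0 in G with boundary datum g. Then |∇u(x)| > 0 for every x ∈ G; more precisely, on every compact subset Q ⊂ G there is a constant C > 0 with |∇u| ≥ C⁻¹ on Q. -/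

import Mathlib

open MeasureTheory Set
open scoped Topology NNReal

noncomputable section

/-- The plane `ℝ²`. -/
abbrev E2 : Type := EuclideanSpace ℝ (Fin 2)

/-- The standard basis vectors of `ℝ²`. -/
def e2 (i : Fin 2) : E2 := EuclideanSpace.single i (1 : ℝ)

/-- A smooth test function compactly supported inside `Ω`. -/
def IsTestOn (Ω : Set E2) (φ : E2 → ℝ) : Prop :=
  ContDiff ℝ (⊤ : ℕ∞) φ ∧ HasCompactSupport φ ∧ tsupport φ ⊆ Ω

/-- A Jordan curve in the plane: the image of a continuous map `φ : ℝ → ℝ²` of period `1`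
which is injective on a period. -/
def IsJordanCurve (Γ : Set E2) : Prop :=
  ∃ φ : ℝ → E2, Continuous φ ∧ Function.Periodic φ 1 ∧
    Set.InjOn φ (Set.Ico 0 1) ∧ φ '' Set.Icc 0 1 = Γ

/-- A Jordan domain: a bounded, connected, open planar set whose boundary is a Jordan
curve. -/
def IsJordanDomain (G : Set E2) : Prop :=
  IsOpen G ∧ IsConnected G ∧ Bornology.IsBounded G ∧ IsJordanCurve (frontier G)

/-- A non-constant continuous function `g` on a Jordan curve `Γ` is unimodal if `Γ` splits
into two simple arcs (with the orientation inherited from `Γ`, here given by a periodic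
parametrization) on which `g` is respectively nondecreasing and nonincreasing. -/
def UnimodalOn (g : E2 → ℝ) (Γ : Set E2) : Prop :=
  ContinuousOn g Γ ∧ (¬ ∃ c : ℝ, ∀ x ∈ Γ, g x = c) ∧
  ∃ φ : ℝ → E2, ∃ c ∈ Set.Icc (0 : ℝ) 1,
    Continuous φ ∧ Function.Periodic φ 1 ∧ Set.InjOn φ (Set.Ico 0 1) ∧
    φ '' Set.Icc 0 1 = Γ ∧
    MonotoneOn (g ∘ φ) (Set.Icc 0 c) ∧ AntitoneOn (g ∘ φ) (Set.Icc c 1)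

section
open MeasureTheory Set
open scoped Topology NNReal
noncomputable section

lemma topo_log_exists {X Y : Set ℂ} (hX : IsCompact X) (hY : IsPreconnected Y) (hd : Disjoint X Y)
    {p q : ℂ} (hp : p ∈ Y) (hq : q ∈ Y) :
    ∃ l : ℂ → ℂ, ContinuousOn l X ∧ ∀ z ∈ X, Complex.exp (l z) = (z - p) / (z - q) := by
  have hne : ∀ z ∈ X, ∀ y ∈ Y, z - y ≠ 0 := by
    intro z hz y hy h
    rw [sub_eq_zero] at h
    exact (Set.disjoint_left.1 hd hz) (h ▸ hy)
  refine hY.induction₂ (fun p q => ∃ l : ℂ → ℂ, ContinuousOn l X ∧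
    ∀ z ∈ X, Complex.exp (l z) = (z - p) / (z - q)) ?_ ?_ ?_ hp hq
  · intro p hp
    have hpX : p ∈ Xᶜ := fun h => Set.disjoint_left.1 hd h hp
    obtain ⟨δ, hδ, hball⟩ := Metric.isOpen_iff.1 hX.isClosed.isOpen_compl p hpX
    have h1 : ∀ᶠ q in 𝓝[Y] p, dist q p < δ / 2 :=
      nhdsWithin_le_nhds (Metric.ball_mem_nhds p (half_pos hδ))
    filter_upwards [h1, self_mem_nhdsWithin] with q hq hqY
    have hs : ∀ z ∈ X, (z - p) / (z - q) ∈ Complex.slitPlane := by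
      intro z hz
      have hzp : δ ≤ dist z p := by
        by_contra h
        exact hball (Metric.mem_ball.2 (not_le.1 h)) hz
      have hzq : ‖z - q‖ > δ / 2 := by
        rw [← dist_eq_norm]
        have := dist_triangle z q p
        linarith
      have : (z - p) / (z - q) = 1 + (q - p) / (z - q) := by
        field_simp [hne z hz q hqY]
        ring
      rw [this]
      apply Complex.mem_slitPlane_of_norm_lt_one
      rw [norm_div, div_lt_one (by linarith)]
      rw [dist_eq_norm] at hq
      linarith
    refine ⟨fun z => Complex.log ((z - p) / (z - q)), ?_, ?_⟩
    · apply ContinuousOn.clog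
      · apply ContinuousOn.div (by fun_prop) (by fun_prop)
        intro z hz
        exact hne z hz q hqY
      · exact hs
    · intro z hz
      exact Complex.exp_log (Complex.slitPlane_ne_zero (hs z hz))
  · rintro x y z hx hy hz ⟨l, hl, hl'⟩ ⟨m, hm, hm'⟩
    refine ⟨fun z => l z + m z, hl.add hm, ?_⟩
    intro w hw
    rw [Complex.exp_add, hl' w hw, hm' w hw]
    field_simp [hne w hw y hy, hne w hw z hz]
  · rintro x y hx hy ⟨l, hl, hl'⟩
    refine ⟨fun z => - l z, hl.neg, ?_⟩
    intro w hw
    rw [Complex.exp_neg, hl' w hw, inv_div]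

/-- two continuous logarithms differ by a constant on a preconnected set -/
lemma topo_log_unique {X : Set ℂ} (hX : IsPreconnected X) {l m : ℂ → ℂ} (hl : ContinuousOn l X)
    (hm : ContinuousOn m X) (h : ∀ z ∈ X, Complex.exp (l z) = Complex.exp (m z)) {x y : ℂ}
    (hx : x ∈ X) (hy : y ∈ X) : (l x - l y).im = (m x - m y).im := by
  have h2 : ∀ z ∈ X, ∃ n : ℤ, (l z - m z).im / (2 * Real.pi) = n := by
    intro z hz
    obtain ⟨n, hn⟩ := Complex.exp_eq_exp_iff_exists_int.1 (h z hz)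
    refine ⟨n, ?_⟩
    rw [hn]
    have := Real.pi_pos
    simp
  have hc : ContinuousOn (fun z => (l z - m z).im / (2 * Real.pi)) X :=
    (Complex.continuous_im.comp_continuousOn (hl.sub hm)).div_const _
  have key := hX.image _ hc
  have hsub : ((fun z => (l z - m z).im / (2 * Real.pi)) '' X).Subsingleton := by
    apply Set.Subsingleton.anti (t := (fun z => (l z - m z).im / (2 * Real.pi)) '' X) ?_ le_rfl
    intro a ha b hb
    by_contra hab
    wlog hlt : a < b generalizing a b
    · exact this hb ha (Ne.symm hab) (lt_of_le_of_ne (not_lt.1 hlt) (Ne.symm hab))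
    have hoc := key.ordConnected.out ha hb
    obtain ⟨z, hz, rfl⟩ := ha
    obtain ⟨n, hn⟩ := h2 z hz
    simp only [hn] at hlt hoc
    set c := min ((n : ℝ) + 1 / 2) b
    have hc1 : c ∈ Icc (n : ℝ) b := ⟨le_min (by linarith) hlt.le, min_le_right _ _⟩
    obtain ⟨w, hw, hwc⟩ := hoc hc1
    obtain ⟨k, hk⟩ := h2 w hw
    simp only [hk] at hwc
    have e1 : (n : ℝ) < k := by rw [hwc]; exact lt_min (by linarith) hlt
    have e2 : (k : ℝ) < n + 1 := by rw [hwc]; exact lt_of_le_of_lt (min_le_left _ _) (by linarith)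
    have e1' : n < k := by exact_mod_cast e1
    have e2' : k < n + 1 := by exact_mod_cast e2
    omega
  have := hsub (mem_image_of_mem _ hx) (mem_image_of_mem _ hy)
  have hpi := Real.pi_pos
  simp only [Complex.sub_im] at this ⊢
  field_simp at this
  linarith


lemma topo_slit {β t ρ : ℝ} (h0 : 0 < β) (h1 : β < 2 * Real.pi) (ht : 0 ≤ t) (hρ : 0 < ρ) :
    (t : ℂ) - ρ * Complex.exp (β * Complex.I) ∈ Complex.slitPlane := by
  rw [Complex.mem_slitPlane_iff]
  simp only [Complex.sub_re, Complex.ofReal_re, Complex.re_ofReal_mul, Complex.exp_ofReal_mul_I_re,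
    Complex.sub_im, Complex.ofReal_im, Complex.im_ofReal_mul, Complex.exp_ofReal_mul_I_im]
  by_cases hs : Real.sin β = 0
  · left
    obtain ⟨n, hn⟩ := Real.sin_eq_zero_iff.1 hs
    have hpi := Real.pi_pos
    have hn1 : (0 : ℝ) < n := by
      by_contra h
      push Not at h
      nlinarith
    have hn2 : (n : ℝ) < 2 := by
      by_contra h
      push Not at h
      nlinarith
    have : n = 1 := by
      have a1 : (0 : ℤ) < n := by exact_mod_cast hn1
      have a2 : n < (2 : ℤ) := by exact_mod_cast hn2
      omega
    subst this
    have : β = Real.pi := by rw [← hn]; simp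
    rw [this, Real.cos_pi]
    linarith
  · right
    intro h
    have : ρ * Real.sin β = 0 := by linarith
    rcases mul_eq_zero.1 this with h | h
    · exact hρ.ne' h
    · exact hs h

lemma topo_arg_zero {β ρ : ℝ} (h0 : 0 < β) (h1 : β < 2 * Real.pi) (hρ : 0 < ρ) :
    (Complex.log (((0 : ℝ) : ℂ) - ρ * Complex.exp (β * Complex.I))).im = β - Real.pi := by
  have : ((0 : ℝ) : ℂ) - ρ * Complex.exp (β * Complex.I)
      = Complex.exp (Real.log ρ + ((β - Real.pi : ℝ) : ℂ) * Complex.I) := by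
    rw [Complex.exp_add, ← Complex.ofReal_exp, Real.exp_log hρ]
    push_cast
    rw [sub_mul, Complex.exp_sub, Complex.exp_pi_mul_I]
    simp
    ring
  rw [this, Complex.log_exp]
  · simp
  · simp; linarith
  · simp; linarith

lemma topo_arg_small {β ρ r : ℝ} (hρ : 0 < ρ) (hr : 4 * ρ ≤ r) :
    |(Complex.log ((r : ℂ) - ρ * Complex.exp (β * Complex.I))).im| ≤ Real.pi / 6 := by
  rw [Complex.log_im]
  set w := (r : ℂ) - ρ * Complex.exp (β * Complex.I) with hw
  have hn : ‖(ρ : ℂ) * Complex.exp (β * Complex.I)‖ = ρ := by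
    rw [norm_mul, Complex.norm_exp_ofReal_mul_I]; simp [abs_of_pos hρ]
  have h1 : 3 * ρ ≤ ‖w‖ := by
    have := norm_sub_norm_le (r : ℂ) (ρ * Complex.exp (β * Complex.I))
    rw [hn] at this
    have h2 : ‖(r : ℂ)‖ = r := by simp [abs_of_pos (by linarith : 0 < r)]
    rw [h2] at this
    linarith
  have him : |w.im| ≤ ρ := by
    have : w.im = -(((ρ : ℂ) * Complex.exp (β * Complex.I)).im) := by simp [hw]
    rw [this, abs_neg]
    exact (Complex.abs_im_le_norm _).trans hn.le
  have hre : 0 ≤ w.re := by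
    have : w.re = r - (((ρ : ℂ) * Complex.exp (β * Complex.I)).re) := by simp [hw]
    have h3 := (Complex.abs_re_le_norm ((ρ : ℂ) * Complex.exp (β * Complex.I)))
    rw [hn] at h3
    have := (abs_le.1 h3).2
    linarith
  rw [Complex.arg_of_re_nonneg hre]
  have hq : |w.im / ‖w‖| ≤ 1 / 2 := by
    rw [abs_div, abs_norm, div_le_iff₀ (by linarith)]
    linarith
  have hpi := Real.pi_pos
  have hb := abs_le.1 hq
  rw [abs_le]
  constructor
  · rw [Real.le_arcsin_iff_sin_le' ⟨by linarith, by linarith⟩, Real.sin_neg, Real.sin_pi_div_six]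
    linarith
  · rw [Real.arcsin_le_iff_le_sin' ⟨by linarith, by linarith⟩, Real.sin_pi_div_six]
    linarith

lemma topo_leg {a b2 b4 r ρ : ℝ} {l : ℂ → ℂ} (hρ : 0 < ρ) (hr : 4 * ρ ≤ r)
    (h2 : 0 < b2 - a) (h2' : b2 - a < 2 * Real.pi) (h4 : 0 < b4 - a) (h4' : b4 - a < 2 * Real.pi)
    (hl : ContinuousOn l ((fun t : ℝ => (t : ℂ) * Complex.exp (a * Complex.I)) '' Icc 0 r))
    (hle : ∀ z ∈ ((fun t : ℝ => (t : ℂ) * Complex.exp (a * Complex.I)) '' Icc 0 r),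
      Complex.exp (l z) = (z - ρ * Complex.exp (b2 * Complex.I)) /
        (z - ρ * Complex.exp (b4 * Complex.I))) :
    |(l (r * Complex.exp (a * Complex.I)) - l 0).im - (b4 - b2)| ≤ Real.pi / 3 := by
  set m : ℂ → ℂ := fun z =>
    Complex.log (z * Complex.exp (-(a * Complex.I)) - ρ * Complex.exp (((b2 - a : ℝ) : ℂ) * Complex.I))
    - Complex.log (z * Complex.exp (-(a * Complex.I)) - ρ * Complex.exp (((b4 - a : ℝ) : ℂ) * Complex.I))
    with hm
  set S := ((fun t : ℝ => (t : ℂ) * Complex.exp (a * Complex.I)) '' Icc 0 r) with hS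
  have hred : ∀ t : ℝ, ((t : ℂ) * Complex.exp (a * Complex.I)) * Complex.exp (-(a * Complex.I)) = t := by
    intro t
    rw [mul_assoc, ← Complex.exp_add]; simp
  have hconn : IsPreconnected S := isPreconnected_Icc.image _ (by fun_prop)
  have hmc : ContinuousOn m S := by
    apply ContinuousOn.sub
    · apply ContinuousOn.clog (by fun_prop)
      rintro _ ⟨t, ht, rfl⟩
      simp only [hred]
      exact topo_slit h2 h2' ht.1 hρ
    · apply ContinuousOn.clog (by fun_prop)
      rintro _ ⟨t, ht, rfl⟩
      simp only [hred]
      exact topo_slit h4 h4' ht.1 hρ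
  have hrot : ∀ (t b : ℝ), (t : ℂ) * Complex.exp (a * Complex.I) - ρ * Complex.exp (b * Complex.I)
      = Complex.exp (a * Complex.I) * ((t : ℂ) - ρ * Complex.exp (((b - a : ℝ) : ℂ) * Complex.I)) := by
    intro t b
    have : Complex.exp (b * Complex.I) = Complex.exp (a * Complex.I) *
        Complex.exp (((b - a : ℝ) : ℂ) * Complex.I) := by
      rw [← Complex.exp_add]; congr 1; push_cast; ring
    rw [this]; ring
  have hee : ∀ z ∈ S, Complex.exp (l z) = Complex.exp (m z) := by
    rintro _ ⟨t, ht, rfl⟩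
    rw [hle _ ⟨t, ht, rfl⟩, hm]
    simp only [hred]
    rw [Complex.exp_sub, Complex.exp_log (Complex.slitPlane_ne_zero (topo_slit h2 h2' ht.1 hρ)),
      Complex.exp_log (Complex.slitPlane_ne_zero (topo_slit h4 h4' ht.1 hρ)), hrot, hrot]
    rw [mul_div_mul_left _ _ (Complex.exp_ne_zero _)]
  have hr0 : 0 ≤ r := by linarith
  have hx : (r : ℂ) * Complex.exp (a * Complex.I) ∈ S := ⟨r, ⟨hr0, le_rfl⟩, rfl⟩
  have hy : (0 : ℂ) ∈ S := ⟨0, ⟨le_rfl, hr0⟩, by simp⟩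
  rw [topo_log_unique hconn hl hmc hee hx hy, hm]
  simp only [hred]
  have e1 := topo_arg_zero h2 h2' hρ
  have e2 := topo_arg_zero h4 h4' hρ
  have e3 := topo_arg_small (β := b2 - a) hρ hr
  have e4 := topo_arg_small (β := b4 - a) hρ hr
  simp only [Complex.ofReal_zero, zero_sub] at e1 e2
  simp only [zero_mul, zero_sub, Complex.sub_im, e1, e2] at *
  rw [abs_le] at *
  constructor <;> linarith [e3.1, e3.2, e4.1, e4.2]

/-- the crossing lemma -/
theorem topo_crossing {A B : Set ℂ} (hA : IsCompact A)
    (hAc : IsPreconnected A) (hBc : IsPreconnected B) (hAB : Disjoint A B)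
    (hA0 : (0 : ℂ) ∉ A) (hB0 : (0 : ℂ) ∉ B) {a1 a2 a3 a4 r : ℝ} (h12 : a1 < a2) (h23 : a2 < a3)
    (h34 : a3 < a4) (h41 : a4 < a1 + 2 * Real.pi) (hr : 0 < r)
    (hp1 : (r : ℂ) * Complex.exp (a1 * Complex.I) ∈ A)
    (hp3 : (r : ℂ) * Complex.exp (a3 * Complex.I) ∈ A)
    (hp2 : (r : ℂ) * Complex.exp (a2 * Complex.I) ∈ B)
    (hp4 : (r : ℂ) * Complex.exp (a4 * Complex.I) ∈ B)
    (hs1 : ∀ t ∈ Ioc 0 r, (t : ℂ) * Complex.exp (a1 * Complex.I) ∉ B)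
    (hs3 : ∀ t ∈ Ioc 0 r, (t : ℂ) * Complex.exp (a3 * Complex.I) ∉ B)
    (hs2 : ∀ t ∈ Ioc 0 r, (t : ℂ) * Complex.exp (a2 * Complex.I) ∉ A)
    (hs4 : ∀ t ∈ Ioc 0 r, (t : ℂ) * Complex.exp (a4 * Complex.I) ∉ A) : False := by
  have hpi := Real.pi_pos
  set S1 := ((fun t : ℝ => (t : ℂ) * Complex.exp (a1 * Complex.I)) '' Icc 0 r) with hS1
  set S3 := ((fun t : ℝ => (t : ℂ) * Complex.exp (a3 * Complex.I)) '' Icc 0 r) with hS3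
  set S2 := ((fun t : ℝ => (t : ℂ) * Complex.exp (a2 * Complex.I)) '' Ioc 0 r) with hS2
  set S4 := ((fun t : ℝ => (t : ℂ) * Complex.exp (a4 * Complex.I)) '' Ioc 0 r) with hS4
  have hX : IsCompact (A ∪ S1 ∪ S3) :=
    (hA.union (isCompact_Icc.image (by fun_prop))).union (isCompact_Icc.image (by fun_prop))
  have hY : IsPreconnected (B ∪ S2 ∪ S4) := by
    have m2 : (r : ℂ) * Complex.exp (a2 * Complex.I) ∈ S2 := ⟨r, ⟨hr, le_rfl⟩, rfl⟩
    have m4 : (r : ℂ) * Complex.exp (a4 * Complex.I) ∈ S4 := ⟨r, ⟨hr, le_rfl⟩, rfl⟩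
    have c2 : IsPreconnected S2 := isPreconnected_Ioc.image _ (by fun_prop)
    have c4 : IsPreconnected S4 := isPreconnected_Ioc.image _ (by fun_prop)
    exact IsPreconnected.union _ (Or.inl hp4) m4 (IsPreconnected.union _ hp2 m2 hBc c2) c4
  have hrays : ∀ (a b : ℝ), 0 < b - a → b - a < 2 * Real.pi → ∀ t ∈ Icc 0 r, ∀ s ∈ Ioc 0 r,
      (t : ℂ) * Complex.exp (a * Complex.I) ≠ (s : ℂ) * Complex.exp (b * Complex.I) := by
    intro a b h1 h2 t ht s hs h
    have h3 := Complex.slitPlane_ne_zero (topo_slit h1 h2 ht.1 hs.1)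
    apply h3
    have : Complex.exp (b * Complex.I) = Complex.exp (a * Complex.I) *
        Complex.exp (((b - a : ℝ) : ℂ) * Complex.I) := by
      rw [← Complex.exp_add]; congr 1; push_cast; ring
    rw [this] at h
    have h4 : Complex.exp (a * Complex.I) *
      ((t : ℂ) - s * Complex.exp (((b - a : ℝ) : ℂ) * Complex.I)) = 0 := by linear_combination h
    exact (mul_eq_zero.1 h4).resolve_left (Complex.exp_ne_zero _)
  have hper : ∀ b : ℝ, Complex.exp (((b + 2 * Real.pi : ℝ) : ℂ) * Complex.I)
      = Complex.exp (b * Complex.I) := by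
    intro b
    push_cast
    rw [add_mul, Complex.exp_add, Complex.exp_two_pi_mul_I, mul_one]
  have hd : Disjoint (A ∪ S1 ∪ S3) (B ∪ S2 ∪ S4) := by
    rw [Set.disjoint_left]
    rintro z ((hz | ⟨t, ht, rfl⟩) | ⟨t, ht, rfl⟩) ((hz' | ⟨s, hs, hsz⟩) | ⟨s, hs, hsz⟩)
    · exact Set.disjoint_left.1 hAB hz hz'
    · exact hs2 s hs (by simp only at hsz; rwa [hsz])
    · exact hs4 s hs (by simp only at hsz; rwa [hsz])
    · rcases ht.1.eq_or_lt with h | h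
      · subst h; simp at hz'; exact hB0 hz'
      · exact hs1 t ⟨h, ht.2⟩ hz'
    · exact hrays a1 a2 (by linarith) (by linarith) t ht s hs hsz.symm
    · exact hrays a1 a4 (by linarith) (by linarith) t ht s hs hsz.symm
    · rcases ht.1.eq_or_lt with h | h
      · subst h; simp at hz'; exact hB0 hz'
      · exact hs3 t ⟨h, ht.2⟩ hz'
    · refine hrays a3 (a2 + 2 * Real.pi) (by linarith) (by linarith) t ht s hs ?_
      rw [hper]; exact hsz.symm
    · exact hrays a3 a4 (by linarith) (by linarith) t ht s hs hsz.symm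
  obtain ⟨δ, hδ, hball⟩ := Metric.isOpen_iff.1 hA.isClosed.isOpen_compl 0 hA0
  obtain ⟨ρ, hρ, hρr, hρδ⟩ : ∃ ρ > 0, 4 * ρ ≤ r ∧ 4 * ρ ≤ δ :=
    ⟨min r δ / 4, by positivity, by linarith [min_le_left r δ], by linarith [min_le_right r δ]⟩
  set q2 : ℂ := ρ * Complex.exp (a2 * Complex.I) with hq2
  set q4 : ℂ := ρ * Complex.exp (a4 * Complex.I) with hq4
  have hn2 : ‖q2‖ = ρ := by
    rw [hq2, norm_mul, Complex.norm_exp_ofReal_mul_I]; simp [abs_of_pos hρ]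
  have hn4 : ‖q4‖ = ρ := by
    rw [hq4, norm_mul, Complex.norm_exp_ofReal_mul_I]; simp [abs_of_pos hρ]
  obtain ⟨l, hl, hle⟩ := topo_log_exists hX hY hd (p := q2) (q := q4)
    (Or.inl (Or.inr ⟨ρ, ⟨hρ, by linarith⟩, rfl⟩)) (Or.inr ⟨ρ, ⟨hρ, by linarith⟩, rfl⟩)
  have L1 := topo_leg (a := a1) (b2 := a2) (b4 := a4) (l := l) hρ hρr (by linarith) (by linarith)
    (by linarith) (by linarith) (hl.mono fun z hz => Or.inl (Or.inr hz))
    (fun z hz => hle z (Or.inl (Or.inr hz)))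
  have L3 := topo_leg (a := a3) (b2 := a2 + 2 * Real.pi) (b4 := a4) (l := l) hρ hρr
    (by linarith) (by linarith)
    (by linarith) (by linarith) (hl.mono fun z hz => Or.inr hz)
    (fun z hz => by rw [hle z (Or.inr hz), hper])
  have hnear : ∀ z ∈ A, 0 < ((z - q2) / (z - q4)).re := by
    intro z hz
    have hzp : δ ≤ ‖z‖ := by
      by_contra h
      exact hball (by simpa using h) hz
    have hzq : ‖z - q4‖ ≥ 3 * ρ := by
      have := norm_sub_norm_le z q4
      linarith
    have hne : z - q4 ≠ 0 := by
      intro h; rw [h, norm_zero] at hzq; linarith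
    have e : (z - q2) / (z - q4) = 1 + (q4 - q2) / (z - q4) := by
      field_simp
      ring
    have : ‖(q4 - q2) / (z - q4)‖ < 1 := by
      rw [norm_div, div_lt_one (by linarith)]
      have := norm_sub_le q4 q2
      linarith
    rw [e, Complex.add_re, Complex.one_re]
    have := (abs_le.1 (Complex.abs_re_le_norm ((q4 - q2) / (z - q4)))).1
    linarith
  have hA' := topo_log_unique hAc (l := l) (m := fun z => Complex.log ((z - q2) / (z - q4)))
    (hl.mono fun z hz => Or.inl (Or.inl hz)) (by
      apply ContinuousOn.clog
      · apply ContinuousOn.div (by fun_prop) (by fun_prop)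
        intro z hz h
        have := hnear z hz
        rw [h] at this
        simp at this
      · intro z hz
        exact Or.inl (hnear z hz)) (by
      intro z hz
      rw [hle z (Or.inl (Or.inl hz)), Complex.exp_log]
      intro h
      have := hnear z hz
      rw [h] at this
      simp at this) hp1 hp3
  have b1 := (Complex.abs_arg_lt_pi_div_two_iff).2 (Or.inl (hnear _ hp1))
  have b3 := (Complex.abs_arg_lt_pi_div_two_iff).2 (Or.inl (hnear _ hp3))
  simp only [Complex.sub_im, Complex.log_im] at hA' L1 L3
  rw [abs_lt] at b1 b3
  rw [abs_le] at L1 L3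
  linarith [b1.1, b1.2, b3.1, b3.2, L1.1, L1.2, L3.1, L3.2]

end
end

section
open MeasureTheory Set
open scoped Topology NNReal

noncomputable section

/-- C¹ functions on the cylinder, with their partial derivatives. -/
structure Cyl {E : Type} [NormedAddCommGroup E] [NormedSpace ℝ E] (F A B : ℝ → ℝ → E) : Prop where
  ds : ∀ s x, HasDerivAt (fun s => F s x) (A s x) s
  dx : ∀ s x, HasDerivAt (F s) (B s x) x
  cF : Continuous fun p : ℝ × ℝ => F p.1 p.2
  cA : Continuous fun p : ℝ × ℝ => A p.1 p.2
  cB : Continuous fun p : ℝ × ℝ => B p.1 p.2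
  per : ∀ s x, F s (x + 2 * Real.pi) = F s x

lemma cyl_cont_circ {E : Type} [NormedAddCommGroup E] [NormedSpace ℝ E] {F : ℝ → ℝ → E}
    (h : Continuous fun p : ℝ × ℝ => F p.1 p.2) (s : ℝ) : Continuous (F s) :=
  h.comp (by fun_prop : Continuous fun x : ℝ => (s, x))

lemma cyl_cont_int {E : Type} [NormedAddCommGroup E] [NormedSpace ℝ E] {F : ℝ → ℝ → E}
    (h : Continuous fun p : ℝ × ℝ => F p.1 p.2) (a b : ℝ) :
    Continuous fun s => ∫ x in a..b, F s x :=
  intervalIntegral.continuous_parametric_intervalIntegral_of_continuous' h a b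

lemma cyl_slope {U Us Ut : ℝ → ℝ → ℝ} (hU : Cyl U Us Ut) (s : ℝ) :
    ∃ D : ℝ → ℝ → ℝ, (Continuous fun p : ℝ × ℝ => D p.1 p.2) ∧
      (∀ s' x, U s' x - U s x = (s' - s) * D s' x) ∧ ∀ x, D s x = Us s x := by
  refine ⟨fun s' x => ∫ τ in (0 : ℝ)..1, Us (s + τ * (s' - s)) x, ?_, ?_, ?_⟩
  · have : Continuous fun q : (ℝ × ℝ) × ℝ => Us (s + q.2 * (q.1.1 - s)) q.1.2 :=
      hU.cA.comp (by fun_prop : Continuous fun q : (ℝ × ℝ) × ℝ =>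
        (s + q.2 * (q.1.1 - s), q.1.2))
    exact intervalIntegral.continuous_parametric_intervalIntegral_of_continuous'
      (f := fun (p : ℝ × ℝ) τ => Us (s + τ * (p.1 - s)) p.2) this 0 1
  · intro s' x
    have h1 : ∀ τ ∈ uIcc (0 : ℝ) 1, HasDerivAt (fun τ => U (s + τ * (s' - s)) x)
        (Us (s + τ * (s' - s)) x * (s' - s)) τ := by
      intro τ _
      have h2 : HasDerivAt (fun τ : ℝ => s + τ * (s' - s)) (s' - s) τ := by
        simpa using ((hasDerivAt_id τ).mul_const (s' - s)).const_add s
      exact (hU.ds (s + τ * (s' - s)) x).comp τ h2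
    have h3 : Continuous fun τ => Us (s + τ * (s' - s)) x :=
      hU.cA.comp (by fun_prop : Continuous fun τ : ℝ => (s + τ * (s' - s), x))
    have h4 := intervalIntegral.integral_eq_sub_of_hasDerivAt h1
      ((h3.mul continuous_const).intervalIntegrable _ _)
    simp only [intervalIntegral.integral_mul_const] at h4
    simp only [one_mul, add_sub_cancel, zero_mul, add_zero] at h4
    rw [← h4]; ring
  · intro x; simp

lemma cyl_perB {E : Type} [NormedAddCommGroup E] [NormedSpace ℝ E] {F A B : ℝ → ℝ → E}
    (h : Cyl F A B) (s x : ℝ) : B s (x + 2 * Real.pi) = B s x := by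
  have h1 := (h.dx s (x + 2 * Real.pi)).comp_add_const x (2 * Real.pi)
  have h2 : (fun y => F s (y + 2 * Real.pi)) = F s := by ext y; exact h.per s y
  rw [h2] at h1
  exact h1.unique (h.dx s x)

lemma hasDerivAt_sub_mul {Γ : ℝ → ℝ} {s : ℝ} (h : ContinuousAt Γ s) :
    HasDerivAt (fun s' => (s' - s) * Γ s') (Γ s) s := by
  rw [hasDerivAt_iff_tendsto_slope]
  refine (h.tendsto.mono_left nhdsWithin_le_nhds).congr' ?_
  filter_upwards [self_mem_nhdsWithin] with y hy
  have : y - s ≠ 0 := sub_ne_zero.2 hy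
  simp [slope_def_field]
  field_simp

lemma cyl_bracket {U Us Ut V Vs Vt : ℝ → ℝ → ℝ} (hU : Cyl U Us Ut) (hV : Cyl V Vs Vt) (s : ℝ) :
    HasDerivAt (fun s => ∫ x in (0 : ℝ)..(2 * Real.pi), U s x * Vt s x)
      (∫ x in (0 : ℝ)..(2 * Real.pi), (Us s x * Vt s x - Ut s x * Vs s x)) s := by
  obtain ⟨D, hDc, hD, hDs⟩ := cyl_slope hU s
  obtain ⟨H, hHc, hH, hHs⟩ := cyl_slope hV s
  have cUt := cyl_cont_circ hU.cB s
  have cU := cyl_cont_circ hU.cF s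
  have c1 : Continuous fun p : ℝ × ℝ => D p.1 p.2 * Vt p.1 p.2 := hDc.mul hV.cB
  have c2 : Continuous fun p : ℝ × ℝ => Ut s p.2 * H p.1 p.2 :=
    (cUt.comp continuous_snd).mul hHc
  have key : ∀ s', (∫ x in (0 : ℝ)..(2 * Real.pi), U s' x * Vt s' x) =
      (∫ x in (0 : ℝ)..(2 * Real.pi), U s x * Vt s x) +
      (s' - s) * ((∫ x in (0 : ℝ)..(2 * Real.pi), D s' x * Vt s' x) -
        ∫ x in (0 : ℝ)..(2 * Real.pi), Ut s x * H s' x) := by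
    intro s'
    have cVt := cyl_cont_circ hV.cB s
    have cVt' := cyl_cont_circ hV.cB s'
    have cD := cyl_cont_circ hDc s'
    have cH := cyl_cont_circ hHc s'
    have parts := intervalIntegral.integral_mul_deriv_eq_deriv_mul
      (u := U s) (v := fun x => V s' x - V s x) (u' := Ut s) (v' := fun x => Vt s' x - Vt s x)
      (a := 0) (b := 2 * Real.pi)
      (fun x _ => hU.dx s x) (fun x _ => (hV.dx s' x).sub (hV.dx s x))
      (cUt.intervalIntegrable _ _) ((cVt'.sub cVt).intervalIntegrable _ _)
    have p1 := hU.per s 0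
    have p2 := hV.per s 0
    have p3 := hV.per s' 0
    rw [zero_add] at p1 p2 p3
    rw [p1, p2, p3, sub_self, zero_sub] at parts
    have e1 : ∀ x, U s' x * Vt s' x = U s x * Vt s x + (s' - s) * (D s' x * Vt s' x)
        + U s x * (Vt s' x - Vt s x) := by
      intro x
      have := hD s' x
      linear_combination Vt s' x * this
    have e2 : ∀ x, Ut s x * (V s' x - V s x) = (s' - s) * (Ut s x * H s' x) := by
      intro x
      rw [hH s' x]; ring
    simp only [e1]
    rw [intervalIntegral.integral_add, intervalIntegral.integral_add, parts]
    · simp only [e2, intervalIntegral.integral_const_mul]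
      ring
    · exact (cU.mul cVt).intervalIntegrable _ _
    · exact (continuous_const.mul (cD.mul cVt')).intervalIntegrable _ _
    · exact ((cU.mul cVt).add (continuous_const.mul (cD.mul cVt'))).intervalIntegrable _ _
    · exact (cU.mul (cVt'.sub cVt)).intervalIntegrable _ _
  have hΓ : Continuous fun s' => ((∫ x in (0 : ℝ)..(2 * Real.pi), D s' x * Vt s' x) -
        ∫ x in (0 : ℝ)..(2 * Real.pi), Ut s x * H s' x) :=
    (cyl_cont_int (F := fun s' x => D s' x * Vt s' x) c1 _ _).sub
      (cyl_cont_int (F := fun s' x => Ut s x * H s' x) c2 _ _)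
  have h5 := (hasDerivAt_sub_mul (s := s) hΓ.continuousAt).const_add
    (∫ x in (0 : ℝ)..(2 * Real.pi), U s x * Vt s x)
  have h6 : (fun s => ∫ x in (0 : ℝ)..(2 * Real.pi), U s x * Vt s x) = fun s' =>
      (∫ x in (0 : ℝ)..(2 * Real.pi), U s x * Vt s x) +
      (s' - s) * ((∫ x in (0 : ℝ)..(2 * Real.pi), D s' x * Vt s' x) -
        ∫ x in (0 : ℝ)..(2 * Real.pi), Ut s x * H s' x) := funext key
  rw [h6]
  refine h5.congr_deriv ?_
  simp only [hDs, hHs]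
  rw [intervalIntegral.integral_sub]
  · exact ((cyl_cont_circ hU.cA s).mul (cyl_cont_circ hV.cB s)).intervalIntegrable _ _
  · exact (cUt.mul (cyl_cont_circ hV.cA s)).intervalIntegrable _ _

end
end

section
open MeasureTheory Set
open scoped Topology NNReal

noncomputable section

section
variable {E : Type} [NormedAddCommGroup E] [NormedSpace ℝ E] {F A B : ℝ → ℝ → E}

lemma Cyl.kF (h : Cyl F A B) (s : ℝ) : Continuous (F s) := cyl_cont_circ h.cF s
lemma Cyl.kA (h : Cyl F A B) (s : ℝ) : Continuous (A s) := cyl_cont_circ h.cA s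
lemma Cyl.kB (h : Cyl F A B) (s : ℝ) : Continuous (B s) := cyl_cont_circ h.cB s

end

def cJ (a b : ℂ) : ℝ := a.re * b.im - a.im * b.re

def cPhi (h : ℝ → ℝ) (F B : ℝ → ℝ → ℂ) (s : ℝ) : ℝ :=
  ∫ x in (0 : ℝ)..(2 * Real.pi), h (Complex.normSq (F s x)) * cJ (F s x) (B s x)

lemma cyl_re {F A B : ℝ → ℝ → ℂ} (h : Cyl F A B) :
    Cyl (fun s x => (F s x).re) (fun s x => (A s x).re) (fun s x => (B s x).re) where
  ds s x := (Complex.reCLM.hasFDerivAt.comp_hasDerivAt s (h.ds s x))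
  dx s x := (Complex.reCLM.hasFDerivAt.comp_hasDerivAt x (h.dx s x))
  cF := Complex.continuous_re.comp h.cF
  cA := Complex.continuous_re.comp h.cA
  cB := Complex.continuous_re.comp h.cB
  per s x := by simp only [h.per s x]

lemma cyl_im {F A B : ℝ → ℝ → ℂ} (h : Cyl F A B) :
    Cyl (fun s x => (F s x).im) (fun s x => (A s x).im) (fun s x => (B s x).im) where
  ds s x := (Complex.imCLM.hasFDerivAt.comp_hasDerivAt s (h.ds s x))
  dx s x := (Complex.imCLM.hasFDerivAt.comp_hasDerivAt x (h.dx s x))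
  cF := Complex.continuous_im.comp h.cF
  cA := Complex.continuous_im.comp h.cA
  cB := Complex.continuous_im.comp h.cB
  per s x := by simp only [h.per s x]

lemma cyl_mul {F A B F' A' B' : ℝ → ℝ → ℝ} (h : Cyl F A B) (h' : Cyl F' A' B') :
    Cyl (fun s x => F s x * F' s x) (fun s x => A s x * F' s x + F s x * A' s x)
      (fun s x => B s x * F' s x + F s x * B' s x) where
  ds s x := (h.ds s x).mul (h'.ds s x)
  dx s x := (h.dx s x).mul (h'.dx s x)
  cF := h.cF.mul h'.cF
  cA := (h.cA.mul h'.cF).add (h.cF.mul h'.cA)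
  cB := (h.cB.mul h'.cF).add (h.cF.mul h'.cB)
  per s x := by simp only [h.per s x, h'.per s x]

lemma cyl_add {F A B F' A' B' : ℝ → ℝ → ℝ} (h : Cyl F A B) (h' : Cyl F' A' B') :
    Cyl (fun s x => F s x + F' s x) (fun s x => A s x + A' s x)
      (fun s x => B s x + B' s x) where
  ds s x := (h.ds s x).add (h'.ds s x)
  dx s x := (h.dx s x).add (h'.dx s x)
  cF := h.cF.add h'.cF
  cA := h.cA.add h'.cA
  cB := h.cB.add h'.cB
  per s x := by simp only [h.per s x, h'.per s x]

lemma cyl_comp {F A B : ℝ → ℝ → ℝ} (h : Cyl F A B) {T : Set ℝ} {φ φ' : ℝ → ℝ}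
    (hT : ∀ s x, F s x ∈ T) (hφ : ∀ y ∈ T, HasDerivAt φ (φ' y) y) (hc : ContinuousOn φ' T) :
    Cyl (fun s x => φ (F s x)) (fun s x => φ' (F s x) * A s x)
      (fun s x => φ' (F s x) * B s x) where
  ds s x := (hφ _ (hT s x)).comp s (h.ds s x)
  dx s x := (hφ _ (hT s x)).comp x (h.dx s x)
  cF := ContinuousOn.comp_continuous (fun y hy => (hφ y hy).continuousAt.continuousWithinAt)
    h.cF (fun p => hT p.1 p.2)
  cA := (hc.comp_continuous h.cF (fun p => hT p.1 p.2)).mul h.cA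
  cB := (hc.comp_continuous h.cF (fun p => hT p.1 p.2)).mul h.cB
  per s x := by simp only [h.per s x]

/-- the squared modulus as a cylinder function -/
lemma cyl_normSq {F A B : ℝ → ℝ → ℂ} (h : Cyl F A B) :
    Cyl (fun s x => Complex.normSq (F s x))
      (fun s x => 2 * ((F s x).re * (A s x).re + (F s x).im * (A s x).im))
      (fun s x => 2 * ((F s x).re * (B s x).re + (F s x).im * (B s x).im)) := by
  have h1 := cyl_add (cyl_mul (cyl_re h) (cyl_re h)) (cyl_mul (cyl_im h) (cyl_im h))
  convert h1 using 3 <;> (try simp only [Complex.normSq_apply]) <;> ring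

lemma cPhi_deriv {F A B : ℝ → ℝ → ℂ} (hF : Cyl F A B) {T : Set ℝ} {h h' : ℝ → ℝ}
    (hT : ∀ s x, Complex.normSq (F s x) ∈ T) (hh : ∀ y ∈ T, HasDerivAt h (h' y) y)
    (hc : ContinuousOn h' T) (s : ℝ) :
    HasDerivAt (cPhi h F B)
      (∫ x in (0 : ℝ)..(2 * Real.pi), 2 * (h (Complex.normSq (F s x)) +
        Complex.normSq (F s x) * h' (Complex.normSq (F s x))) * cJ (A s x) (B s x)) s := by
  have c0 := cyl_comp (cyl_normSq hF) hT hh hc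
  have cu := cyl_mul c0 (cyl_re hF)
  have cv := cyl_mul c0 (cyl_im hF)
  have b1 := cyl_bracket cu (cyl_im hF) s
  have b2 := cyl_bracket cv (cyl_re hF) s
  have e : cPhi h F B = fun s =>
      (∫ x in (0 : ℝ)..(2 * Real.pi), h (Complex.normSq (F s x)) * (F s x).re * (B s x).im) -
      ∫ x in (0 : ℝ)..(2 * Real.pi), h (Complex.normSq (F s x)) * (F s x).im * (B s x).re := by
    ext s
    rw [← intervalIntegral.integral_sub]
    · simp only [cPhi, cJ]
      congr 1; ext x; ring
    · exact ((Cyl.kF cu s).mul (Cyl.kB (cyl_im hF) s)).intervalIntegrable _ _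
    · exact ((Cyl.kF cv s).mul (Cyl.kB (cyl_re hF) s)).intervalIntegrable _ _
  rw [e]
  refine (b1.sub b2).congr_deriv ?_
  rw [← intervalIntegral.integral_sub]
  · congr 1; ext x
    simp only [cJ, Complex.normSq_apply]
    ring
  · exact (((Cyl.kA cu s).mul (Cyl.kB (cyl_im hF) s)).sub
      ((Cyl.kB cu s).mul (Cyl.kA (cyl_im hF) s))).intervalIntegrable _ _
  · exact (((Cyl.kA cv s).mul (Cyl.kB (cyl_re hF) s)).sub
      ((Cyl.kB cv s).mul (Cyl.kA (cyl_re hF) s))).intervalIntegrable _ _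

/-- Cauchy-Schwarz on a circle. -/
lemma circ_cs {φ : ℝ → ℝ} (hφ : Continuous φ) :
    (∫ x in (0 : ℝ)..(2 * Real.pi), φ x) ^ 2 ≤
      2 * Real.pi * ∫ x in (0 : ℝ)..(2 * Real.pi), φ x ^ 2 := by
  have hpi := Real.pi_pos
  set m := ∫ x in (0 : ℝ)..(2 * Real.pi), φ x with hm
  set q := ∫ x in (0 : ℝ)..(2 * Real.pi), φ x ^ 2 with hq
  have h0 : 0 ≤ ∫ x in (0 : ℝ)..(2 * Real.pi), (2 * Real.pi * φ x - m) ^ 2 :=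
    intervalIntegral.integral_nonneg (by positivity) (fun x _ => sq_nonneg _)
  have h1 : ∫ x in (0 : ℝ)..(2 * Real.pi), (2 * Real.pi * φ x - m) ^ 2 =
      (2 * Real.pi) ^ 2 * q - 2 * (2 * Real.pi) * m * m + 2 * Real.pi * m ^ 2 := by
    have e : ∀ x, (2 * Real.pi * φ x - m) ^ 2 =
      ((2 * Real.pi) ^ 2 * φ x ^ 2 - 2 * (2 * Real.pi) * m * φ x) + m ^ 2 := by intro x; ring
    simp only [e]
    rw [intervalIntegral.integral_add, intervalIntegral.integral_sub,
      intervalIntegral.integral_const_mul, intervalIntegral.integral_const_mul]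
    · simp; ring
    all_goals apply Continuous.intervalIntegrable; fun_prop
  rw [h1] at h0
  have h2 : 0 ≤ 2 * Real.pi * (2 * Real.pi * q - m ^ 2) := by nlinarith
  have := nonneg_of_mul_nonneg_right h2 (by positivity)
  linarith

/-- Oscillation on a circle. -/
lemma circ_osc {E : Type} [NormedAddCommGroup E] [NormedSpace ℝ E] [CompleteSpace E]
    {g g' : ℝ → E} (hg : ∀ x, HasDerivAt g (g' x) x)
    (hc : Continuous g') {x y : ℝ} (hx : x ∈ Icc 0 (2 * Real.pi)) (hy : y ∈ Icc 0 (2 * Real.pi)) :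
    ‖g x - g y‖ ≤ ∫ x in (0 : ℝ)..(2 * Real.pi), ‖g' x‖ := by
  have hpi := Real.pi_pos
  wlog hxy : y ≤ x generalizing x y
  · rw [norm_sub_rev]; exact this hy hx (le_of_not_ge hxy)
  have h1 := intervalIntegral.integral_eq_sub_of_hasDerivAt (a := y) (b := x)
    (fun z _ => hg z) (hc.intervalIntegrable _ _)
  rw [← h1]
  refine (intervalIntegral.norm_integral_le_integral_norm hxy).trans ?_
  exact intervalIntegral.integral_mono_interval hy.1 hxy hx.2
    (Filter.Eventually.of_forall fun z => norm_nonneg _) (hc.norm.intervalIntegrable _ _)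

end
end

section
open MeasureTheory Set
open scoped Topology NNReal

noncomputable section

structure QR (F A B : ℝ → ℝ → ℂ) : Prop where
  cyl : Cyl F A B
  small : ∀ s x, Complex.normSq (F s x) ≤ 1 / 4
  hA : ∀ s ≤ 0, ∀ x, ‖A s x‖ ^ 2 ≤ 2 * cJ (A s x) (B s x)
  hB : ∀ s ≤ 0, ∀ x, ‖B s x‖ ^ 2 ≤ 2 * cJ (A s x) (B s x)
  limB : ∀ ε > 0, ∃ S, ∀ s ≤ S, ∀ x, ‖B s x‖ ≤ ε

lemma cJ_abs (a b : ℂ) : |cJ a b| ≤ ‖a‖ * ‖b‖ := by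
  have : cJ a b = ((starRingEnd ℂ) a * b).im := by simp [cJ]; ring
  rw [this]
  refine (Complex.abs_im_le_norm _).trans ?_
  simp

lemma cRe_abs (a b : ℂ) : |a.re * b.re + a.im * b.im| ≤ ‖a‖ * ‖b‖ := by
  have : a.re * b.re + a.im * b.im = ((starRingEnd ℂ) a * b).re := by simp
  rw [this]
  refine (Complex.abs_re_le_norm _).trans ?_
  simp

variable {F A B : ℝ → ℝ → ℂ}

lemma QR.mem (hF : QR F A B) (s x : ℝ) : Complex.normSq (F s x) ∈ Icc (0 : ℝ) (1 / 4) :=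
  ⟨Complex.normSq_nonneg _, hF.small s x⟩

lemma QR.J_nonneg (hF : QR F A B) {s : ℝ} (hs : s ≤ 0) (x : ℝ) : 0 ≤ cJ (A s x) (B s x) := by
  have := hF.hA s hs x
  nlinarith [sq_nonneg ‖A s x‖]

lemma QR.normF (hF : QR F A B) (s x : ℝ) : ‖F s x‖ ≤ 1 := by
  have h1 := hF.small s x
  rw [Complex.normSq_eq_norm_sq] at h1
  nlinarith [norm_nonneg (F s x)]

lemma QR.phi_mono (hF : QR F A B) {h h' : ℝ → ℝ}
    (hh : ∀ y ∈ Icc (0 : ℝ) (1 / 4), HasDerivAt h (h' y) y)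
    (hc : ContinuousOn h' (Icc (0 : ℝ) (1 / 4)))
    (hp : ∀ y ∈ Icc (0 : ℝ) (1 / 4), 0 ≤ h y + y * h' y) : MonotoneOn (cPhi h F B) (Iic 0) := by
  have hpi := Real.pi_pos
  have hd := cPhi_deriv hF.cyl hF.mem hh hc
  refine monotoneOn_of_deriv_nonneg (convex_Iic 0)
    (fun s _ => (hd s).continuousAt.continuousWithinAt)
    (fun s _ => (hd s).differentiableAt.differentiableWithinAt) ?_
  intro s hs
  rw [interior_Iic] at hs
  rw [(hd s).deriv]
  refine intervalIntegral.integral_nonneg (by positivity) (fun x _ => ?_)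
  exact mul_nonneg (mul_nonneg zero_le_two (hp _ (hF.mem s x))) (hF.J_nonneg (le_of_lt hs) x)

lemma QR.phi_lim (hF : QR F A B) {h : ℝ → ℝ} (hh : ContinuousOn h (Icc (0 : ℝ) (1 / 4))) :
    Filter.Tendsto (cPhi h F B) Filter.atBot (𝓝 0) := by
  have hpi := Real.pi_pos
  obtain ⟨M, hM⟩ := isCompact_Icc.exists_bound_of_continuousOn hh
  have hM0 : 0 ≤ M := (norm_nonneg _).trans (hM 0 (by norm_num))
  rw [Metric.tendsto_nhds]
  intro ε hε
  obtain ⟨S, hS⟩ := hF.limB (ε / ((M + 1) * (2 * Real.pi) * 2)) (by positivity)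
  filter_upwards [Filter.eventually_le_atBot S] with s hs
  rw [dist_zero_right, cPhi]
  refine lt_of_le_of_lt (intervalIntegral.norm_integral_le_of_norm_le_const
    (C := (M + 1) * (ε / ((M + 1) * (2 * Real.pi) * 2))) ?_) ?_
  · intro x _
    rw [norm_mul]
    refine mul_le_mul ((hM _ (hF.mem s x)).trans (by linarith)) ?_ (norm_nonneg _) (by linarith)
    refine (cJ_abs _ _).trans ?_
    calc ‖F s x‖ * ‖B s x‖ ≤ 1 * ‖B s x‖ := by gcongr; exact hF.normF s x
      _ ≤ _ := by rw [one_mul]; exact hS s hs x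
  · rw [sub_zero, abs_of_pos (by positivity)]
    field_simp
    linarith

lemma QR.phi_nonneg (hF : QR F A B) {h h' : ℝ → ℝ}
    (hh : ∀ y ∈ Icc (0 : ℝ) (1 / 4), HasDerivAt h (h' y) y)
    (hc : ContinuousOn h' (Icc (0 : ℝ) (1 / 4)))
    (hp : ∀ y ∈ Icc (0 : ℝ) (1 / 4), 0 ≤ h y + y * h' y) {s : ℝ} (hs : s ≤ 0) :
    0 ≤ cPhi h F B s := by
  have hl := hF.phi_lim (h := h) (fun y hy => (hh y hy).continuousAt.continuousWithinAt)
  refine le_of_tendsto hl ?_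
  filter_upwards [Filter.eventually_le_atBot s] with t ht
  exact hF.phi_mono hh hc hp (ht.trans hs) hs ht

lemma loglem {y δ : ℝ} (hy : y ∈ Icc (0 : ℝ) (1 / 4)) (hδ : 0 < δ) (hδ1 : δ ≤ 1 / 16) :
    1 ≤ - Real.log (y + δ) := by
  have h1 : y + δ ≤ Real.exp (-1) := by
    rw [Real.exp_neg]
    have h2 := Real.exp_one_lt_d9
    have h3 := Real.exp_pos 1
    have : (1:ℝ) / 3 ≤ (Real.exp 1)⁻¹ := by
      rw [one_div]; exact inv_anti₀ h3 (by linarith)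
    linarith [hy.2]
  have := Real.log_le_log (by linarith [hy.1]) h1
  rw [Real.log_exp] at this
  linarith

/-- Riccati inequality forces an a priori bound. -/
lemma riccati {φ φ' : ℝ → ℝ} (hd : ∀ s, HasDerivAt φ (φ' s) s) {c : ℝ} (hc : 0 < c)
    (h : ∀ s ≤ 0, φ s ^ 2 ≤ c * φ' s) (_h0 : 0 ≤ φ (-1)) : φ (-1) ≤ c := by
  by_contra hcon
  push Not at hcon
  have hmono : MonotoneOn φ (Iic 0) := by
    refine monotoneOn_of_deriv_nonneg (convex_Iic 0)
      (fun s _ => (hd s).continuousAt.continuousWithinAt)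
      (fun s _ => (hd s).differentiableAt.differentiableWithinAt) ?_
    intro s hs
    rw [interior_Iic] at hs
    rw [(hd s).deriv]
    have := h s (le_of_lt hs)
    exact nonneg_of_mul_nonneg_right ((sq_nonneg _).trans this) hc
  have hpos : ∀ s ∈ Icc (-1 : ℝ) 0, c < φ s := fun s hs =>
    hcon.trans_le (hmono (by norm_num) hs.2 hs.1)
  obtain ⟨ξ, hξ, he⟩ := exists_hasDerivAt_eq_slope (fun s => - (φ s)⁻¹)
    (fun s => φ' s / φ s ^ 2) (a := -1) (b := 0) (by norm_num)
    (fun s hs => ((hd s).continuousAt.inv₀ (by have := hpos s hs; linarith)).neg.continuousWithinAt)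
    (fun s hs => by
      have := ((hd s).inv (by have := hpos s (Ioo_subset_Icc_self hs); linarith)).neg
      refine this.congr_deriv ?_
      ring)
  have hξ' := hpos ξ (Ioo_subset_Icc_self hξ)
  have h1 : c⁻¹ ≤ φ' ξ / φ ξ ^ 2 := by
    rw [le_div_iff₀ (by have : 0 < φ ξ := by linarith
                        positivity), inv_mul_le_iff₀ hc]
    exact h ξ hξ.2.le
  have h2 : 0 < (φ 0)⁻¹ := inv_pos.2 (by linarith [hpos 0 (by norm_num)])
  have h3 : (φ (-1))⁻¹ < c⁻¹ := inv_strictAnti₀ hc hcon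
  norm_num at he
  rw [he] at h1
  linarith

lemma QR.small_circle (hF : QR F A B) {a b : ℝ} (hab : a < b) (hb : b ≤ -1)
    (hz : ∀ s ∈ Icc a b, ∃ x ∈ Icc 0 (2 * Real.pi), F s x = 0)
    {δ : ℝ} (hδ : 0 < δ) (hδ1 : δ ≤ 1 / 16) :
    ∃ s ∈ Icc a b, ∀ x ∈ Icc 0 (2 * Real.pi),
      Complex.normSq (F s x) ≤ δ ^ Real.exp (-(4 * Real.pi / √(b - a))) := by
  have hpi := Real.pi_pos
  set h : ℝ → ℝ := fun y => 1 / ((y + δ) * (-Real.log (y + δ))) with hh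
  set h' : ℝ → ℝ := fun y => (1 - (-Real.log (y + δ))) / ((y + δ) * (-Real.log (y + δ))) ^ 2 with hh'
  have hL : ∀ y ∈ Icc (0 : ℝ) (1 / 4), 1 ≤ - Real.log (y + δ) := fun y hy => loglem hy hδ hδ1
  have hyd : ∀ y ∈ Icc (0 : ℝ) (1 / 4), 0 < y + δ := fun y hy => by linarith [hy.1]
  have hlogd : ∀ y ∈ Icc (0 : ℝ) (1 / 4), HasDerivAt (fun y => -Real.log (y + δ)) (-(y + δ)⁻¹) y := by
    intro y hy
    have h2 : HasDerivAt (fun y => y + δ) 1 y := (hasDerivAt_id y).add_const δ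
    have := (h2.log (hyd y hy).ne').neg
    exact this.congr_deriv (by simp)
  have hder : ∀ y ∈ Icc (0 : ℝ) (1 / 4), HasDerivAt h (h' y) y := by
    intro y hy
    have h2 : HasDerivAt (fun y => y + δ) 1 y := (hasDerivAt_id y).add_const δ
    have h3 := h2.mul (hlogd y hy)
    have h4 := hL y hy
    have h5 := hyd y hy
    have h6 := h3.inv (mul_pos h5 (by linarith)).ne'
    have e : h = (fun y => ((y + δ) * (-Real.log (y + δ)))⁻¹) := by
      ext y; rw [hh]; simp only [one_div]
    rw [e]
    refine h6.congr_deriv ?_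
    rw [hh']
    congr 1
    field_simp
    ring
  have hcont : ContinuousOn h' (Icc (0 : ℝ) (1 / 4)) := by
    have c1 : ContinuousOn (fun y => -Real.log (y + δ)) (Icc (0 : ℝ) (1 / 4)) :=
      fun y hy => (hlogd y hy).continuousAt.continuousWithinAt
    refine (continuousOn_const.sub c1).div (((by fun_prop : ContinuousOn (fun y : ℝ => y + δ)
      (Icc (0 : ℝ) (1 / 4))).mul c1).pow 2) ?_
    intro y hy
    have := hL y hy
    have := hyd y hy
    positivity
  have hlow : ∀ y ∈ Icc (0 : ℝ) (1 / 4),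
      1 / ((y + δ) * (-Real.log (y + δ)) ^ 2) ≤ h y + y * h' y := by
    intro y hy
    have h4 := hL y hy
    have h5 := hyd y hy
    have e : h y + y * h' y = (δ * (-Real.log (y + δ)) + y) / ((y + δ) ^ 2 * (-Real.log (y + δ)) ^ 2) := by
      simp only [hh, hh']
      generalize -Real.log (y + δ) = l at h4
      have : l ≠ 0 := by positivity
      field_simp
      ring
    rw [e]
    generalize -Real.log (y + δ) = l at h4
    rw [div_le_div_iff₀ (by positivity) (by positivity)]
    have : (y + δ) ≤ δ * l + y := by nlinarith
    calc 1 * ((y + δ) ^ 2 * l ^ 2) = (y + δ) * ((y + δ) * l ^ 2) := by ring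
      _ ≤ _ := by gcongr
  have hp : ∀ y ∈ Icc (0 : ℝ) (1 / 4), 0 ≤ h y + y * h' y := fun y hy =>
    le_trans (by have := hL y hy; have := hyd y hy; positivity) (hlow y hy)
  set T : ℝ → ℝ → ℝ := fun s x => Complex.normSq (F s x) with hT
  have hTm : ∀ s x, T s x ∈ Icc (0 : ℝ) (1 / 4) := hF.mem
  have hTc : Continuous fun p : ℝ × ℝ => T p.1 p.2 := (cyl_normSq hF.cyl).cF
  set L : ℝ → ℝ → ℝ := fun s x => -Real.log (T s x + δ) with hLd
  have hL1 : ∀ s x, 1 ≤ L s x := fun s x => hL _ (hTm s x)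
  have hTp : ∀ s x, 0 < T s x + δ := fun s x => hyd _ (hTm s x)
  set q : ℝ → ℝ → ℝ := fun s x => ‖B s x‖ / (√(T s x + δ) * L s x) with hq
  have hqc : ∀ s, Continuous (q s) := by
    intro s
    have c1 := (cyl_normSq hF.cyl).kF s
    have c2 : Continuous (L s) := ((c1.add continuous_const).log (fun x => (hTp s x).ne')).neg
    refine (hF.cyl.kB s).norm.div ((c1.add continuous_const).sqrt.mul c2) ?_
    intro x
    have := hL1 s x
    have := Real.sqrt_pos.2 (hTp s x)
    positivity
  have hq2 : ∀ s x, q s x ^ 2 = ‖B s x‖ ^ 2 * (1 / ((T s x + δ) * L s x ^ 2)) := by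
    intro s x
    rw [hq]; simp only [div_pow, mul_pow, Real.sq_sqrt (hTp s x).le]
    ring
  set Y : ℝ → ℝ := fun s => ∫ x in (0 : ℝ)..(2 * Real.pi), q s x ^ 2 with hY
  have hd := cPhi_deriv hF.cyl hF.mem hder hcont
  set D : ℝ → ℝ := fun s => ∫ x in (0 : ℝ)..(2 * Real.pi), 2 * (h (Complex.normSq (F s x)) +
        Complex.normSq (F s x) * h' (Complex.normSq (F s x))) * cJ (A s x) (B s x) with hD
  have hcD : ∀ s, Continuous fun x => 2 * (h (Complex.normSq (F s x)) +
        Complex.normSq (F s x) * h' (Complex.normSq (F s x))) * cJ (A s x) (B s x) := by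
    intro s
    have c1 := (cyl_normSq hF.cyl).kF s
    have c0 : ContinuousOn h (Icc (0 : ℝ) (1 / 4)) :=
      fun y hy => (hder y hy).continuousAt.continuousWithinAt
    have c2 : Continuous fun x => h (Complex.normSq (F s x)) := c0.comp_continuous c1 (hF.mem s)
    have c3 : Continuous fun x => h' (Complex.normSq (F s x)) := hcont.comp_continuous c1 (hF.mem s)
    have c4 : Continuous fun x => cJ (A s x) (B s x) :=
      (((cyl_re hF.cyl).kA s).mul ((cyl_im hF.cyl).kB s)).sub
        (((cyl_im hF.cyl).kA s).mul ((cyl_re hF.cyl).kB s))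
    exact (continuous_const.mul (c2.add (c1.mul c3))).mul c4
  have hYD : ∀ s ≤ 0, Y s ≤ D s := by
    intro s hs
    refine intervalIntegral.integral_mono_on (by positivity)
      (((hqc s).pow 2).intervalIntegrable _ _) ((hcD s).intervalIntegrable _ _) ?_
    intro x _
    rw [hq2]
    have := hF.hB s hs x
    calc ‖B s x‖ ^ 2 * (1 / ((T s x + δ) * L s x ^ 2))
        ≤ (2 * cJ (A s x) (B s x)) * (h (T s x) + T s x * h' (T s x)) := by
          refine mul_le_mul this (hlow _ (hTm s x)) ?_ ((sq_nonneg _).trans this)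
          have := hL1 s x
          have := hTp s x
          positivity
      _ = _ := by ring
  have hPhi : ∀ s, cPhi h F B s ^ 2 ≤ 2 * Real.pi * Y s := by
    intro s
    refine le_trans ?_ (circ_cs (hqc s))
    refine sq_le_sq' ?_ ?_ <;> [skip; skip]
    all_goals
      have hb : |cPhi h F B s| ≤ ∫ x in (0 : ℝ)..(2 * Real.pi), q s x := by
        rw [cPhi, ← Real.norm_eq_abs]
        refine intervalIntegral.norm_integral_le_of_norm_le (by positivity)
          (Filter.Eventually.of_forall fun x _ => ?_) ((hqc s).intervalIntegrable _ _)
        have l1 := hL1 s x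
        have l2 := hTp s x
        have l3 : ‖F s x‖ ≤ √(T s x + δ) := by
          apply Real.le_sqrt_of_sq_le
          rw [← Complex.normSq_eq_norm_sq]
          linarith
        have l4 := Real.sq_sqrt l2.le
        have l5 := Real.sqrt_pos.2 l2
        rw [norm_mul, Real.norm_eq_abs, Real.norm_eq_abs]
        calc |h (T s x)| * |cJ (F s x) (B s x)| ≤ (1 / ((T s x + δ) * L s x)) *
              (√(T s x + δ) * ‖B s x‖) := by
              gcongr
              · rw [abs_of_nonneg]
                simp only [hh]
                have : 0 < -Real.log (T s x + δ) := by
                  have : 0 < L s x := by linarith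
                  exact this
                positivity
              · exact (cJ_abs _ _).trans (by gcongr)
          _ = q s x := by
              simp only [hq]
              have : L s x ≠ 0 := by positivity
              field_simp
              rw [l4]
      have := abs_le.1 hb
      linarith
  have hbd : cPhi h F B (-1) ≤ 2 * Real.pi := by
    refine riccati hd (by positivity) ?_ (hF.phi_nonneg hder hcont hp (by norm_num))
    intro s hs
    refine (hPhi s).trans ?_
    have := hYD s hs
    exact mul_le_mul_of_nonneg_left this (by positivity)
  have hmono := hF.phi_mono hder hcont hp
  obtain ⟨s, hs, hse⟩ := exists_hasDerivAt_eq_slope (cPhi h F B) D hab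
    (fun s _ => (hd s).continuousAt.continuousWithinAt) (fun s _ => hd s)
  have hba : 0 < b - a := by linarith
  have hYs : Y s ≤ 2 * Real.pi / (b - a) := by
    refine (hYD s (by linarith [hs.2])).trans ?_
    rw [hse]
    have h1 := hmono (show b ∈ Iic 0 by simp; linarith) (show (-1:ℝ) ∈ Iic 0 by simp) hb
    have h2 := hF.phi_nonneg hder hcont hp (s := a) (by linarith)
    gcongr
    linarith
  refine ⟨s, Ioo_subset_Icc_self hs, ?_⟩
  obtain ⟨x0, hx0, hx0z⟩ := hz s (Ioo_subset_Icc_self hs)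
  intro x hx
  -- oscillation of log L
  have hTd := (cyl_normSq hF.cyl).dx s
  have hgd : ∀ x, HasDerivAt (fun x => Real.log (L s x))
      (-(T s x + δ)⁻¹ * (2 * ((F s x).re * (B s x).re + (F s x).im * (B s x).im)) / L s x) x := by
    intro x
    have h1 : HasDerivAt (fun x => L s x) _ x := (hlogd _ (hTm s x)).comp x (hTd x)
    exact h1.log (by have := hL1 s x; positivity)
  have c1 := (cyl_normSq hF.cyl).kF s
  have hgc : Continuous fun x =>
      (-(T s x + δ)⁻¹ * (2 * ((F s x).re * (B s x).re + (F s x).im * (B s x).im)) / L s x) := by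
    have c2 : Continuous (L s) := ((c1.add continuous_const).log (fun x => (hTp s x).ne')).neg
    have c3 := (cyl_normSq hF.cyl).kB s
    refine ((((c1.add continuous_const).inv₀ (fun x => (hTp s x).ne')).neg).mul c3).div c2 ?_
    intro x
    have := hL1 s x
    positivity
  have hosc := circ_osc hgd hgc hx hx0
  have hosc2 : ‖Real.log (L s x) - Real.log (L s x0)‖ ≤ 4 * Real.pi / √(b - a) := by
    refine hosc.trans ?_
    have : ∫ x in (0 : ℝ)..(2 * Real.pi), ‖-(T s x + δ)⁻¹ * (2 * ((F s x).re * (B s x).re + (F s x).im * (B s x).im)) / L s x‖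
        ≤ ∫ x in (0 : ℝ)..(2 * Real.pi), 2 * q s x := by
      refine intervalIntegral.integral_mono_on (by positivity)
        (hgc.norm.intervalIntegrable _ _) ((continuous_const.mul (hqc s)).intervalIntegrable _ _) ?_
      intro x _
      have l1 := hL1 s x
      have l2 := hTp s x
      have l3 : ‖F s x‖ ≤ √(T s x + δ) := by
        apply Real.le_sqrt_of_sq_le
        rw [← Complex.normSq_eq_norm_sq]
        linarith
      have l4 := Real.sq_sqrt l2.le
      have l5 := Real.sqrt_pos.2 l2
      rw [norm_div, norm_mul, norm_neg, norm_mul, norm_inv]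
      simp only [Real.norm_eq_abs]
      rw [abs_of_pos l2, abs_of_pos (show 0 < L s x by linarith), abs_of_pos (zero_lt_two' ℝ)]
      calc (T s x + δ)⁻¹ * (2 * |(F s x).re * (B s x).re + (F s x).im * (B s x).im|) / L s x
          ≤ (T s x + δ)⁻¹ * (2 * (√(T s x + δ) * ‖B s x‖)) / L s x := by
            gcongr
            exact (cRe_abs _ _).trans (by gcongr)
        _ = 2 * q s x := by
            simp only [hq]
            have : L s x ≠ 0 := by positivity
            field_simp
            rw [l4]
    refine this.trans ?_
    rw [intervalIntegral.integral_const_mul]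
    have h1 := circ_cs (hqc s)
    have h2 : (∫ x in (0 : ℝ)..(2 * Real.pi), q s x) ≤ 2 * Real.pi / √(b - a) := by
      refine (abs_le_of_sq_le_sq' ?_ (by positivity)).2
      rw [div_pow, Real.sq_sqrt hba.le]
      refine h1.trans ?_
      calc 2 * Real.pi * Y s ≤ 2 * Real.pi * (2 * Real.pi / (b - a)) := by gcongr
        _ = _ := by ring
    calc 2 * (∫ x in (0 : ℝ)..(2 * Real.pi), q s x) ≤ 2 * (2 * Real.pi / √(b - a)) := by gcongr
      _ = _ := by ring
  have hLx0 : L s x0 = -Real.log δ := by simp [hLd, hT, hx0z]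
  set c := 4 * Real.pi / √(b - a) with hcd
  have h1 := (abs_le.1 hosc2).1
  have hl0 : 0 < L s x0 := by have := hL1 s x0; linarith
  have hl : 0 < L s x := by have := hL1 s x; linarith
  have h2 : Real.exp (-c) * L s x0 ≤ L s x := by
    rw [← Real.exp_log hl0, ← Real.exp_add, ← Real.le_log_iff_exp_le hl]
    linarith
  have h3 : Real.log (T s x + δ) ≤ Real.exp (-c) * Real.log δ := by
    rw [hLx0] at h2
    have : L s x = -Real.log (T s x + δ) := rfl
    rw [this] at h2
    linarith
  have h4 : T s x + δ ≤ δ ^ Real.exp (-c) := by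
    rw [Real.rpow_def_of_pos hδ, ← Real.log_le_iff_le_exp (hTp s x)]
    linarith
  have : T s x ≤ T s x + δ := by linarith
  exact this.trans h4

end
end

section
open MeasureTheory Set
open scoped Topology NNReal

noncomputable section

variable {F A B : ℝ → ℝ → ℂ}

lemma circ_zero {φ : ℝ → ℝ} (hφ : Continuous φ) (h0 : ∀ x, 0 ≤ φ x)
    (hi : ∫ x in (0 : ℝ)..(2 * Real.pi), φ x ≤ 0) : ∀ x ∈ Icc 0 (2 * Real.pi), φ x = 0 := by
  intro x hx
  by_contra hne
  have := intervalIntegral.integral_pos (by positivity : (0:ℝ) < 2 * Real.pi) hφ.continuousOn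
    (fun y _ => h0 y) ⟨x, hx, lt_of_le_of_ne (h0 x) (Ne.symm hne)⟩
  linarith

lemma QR.zero_circle (hF : QR F A B) {a b : ℝ} (hab : a < b) (hb : b ≤ -1)
    (hz : ∀ s ∈ Icc a b, ∃ x ∈ Icc 0 (2 * Real.pi), F s x = 0) :
    ∃ s ∈ Icc a b, ∀ x ∈ Icc 0 (2 * Real.pi), F s x = 0 := by
  have hpi := Real.pi_pos
  have hTc : Continuous fun p : ℝ × ℝ => Complex.normSq (F p.1 p.2) := (cyl_normSq hF.cyl).cF
  have hIc : Continuous fun s => ∫ x in (0 : ℝ)..(2 * Real.pi), Complex.normSq (F s x) :=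
    cyl_cont_int (F := fun s x => Complex.normSq (F s x)) hTc _ _
  obtain ⟨s, hs, hmin⟩ := isCompact_Icc.exists_isMinOn (nonempty_Icc.2 hab.le) hIc.continuousOn
  refine ⟨s, hs, ?_⟩
  set κ := Real.exp (-(4 * Real.pi / √(b - a))) with hκ
  have hκ0 : 0 < κ := Real.exp_pos _
  have hle : ∀ δ : ℝ, 0 < δ → δ ≤ 1 / 16 →
      ∫ x in (0 : ℝ)..(2 * Real.pi), Complex.normSq (F s x) ≤ 2 * Real.pi * δ ^ κ := by
    intro δ h0 h1
    obtain ⟨s', hs', h'⟩ := hF.small_circle hab hb hz h0 h1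
    refine (isMinOn_iff.1 hmin s' hs').trans ?_
    have := intervalIntegral.integral_mono_on (by positivity : (0:ℝ) ≤ 2 * Real.pi)
      (((cyl_normSq hF.cyl).kF s').intervalIntegrable _ _)
      (continuous_const.intervalIntegrable _ _ : IntervalIntegrable (fun _ => δ ^ κ) volume _ _) h'
    simpa using this
  have hlim : Filter.Tendsto (fun δ : ℝ => 2 * Real.pi * δ ^ κ) (𝓝[>] 0) (𝓝 (2 * Real.pi * 0 ^ κ)) := by
    have : ContinuousAt (fun δ : ℝ => 2 * Real.pi * δ ^ κ) 0 :=
      continuousAt_const.mul (continuousAt_id.rpow_const (Or.inr hκ0.le))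
    exact this.tendsto.mono_left nhdsWithin_le_nhds
  rw [Real.zero_rpow hκ0.ne', mul_zero] at hlim
  have hI0 : ∫ x in (0 : ℝ)..(2 * Real.pi), Complex.normSq (F s x) ≤ 0 := by
    refine ge_of_tendsto hlim ?_
    filter_upwards [Ioc_mem_nhdsGT (show (0:ℝ) < 1 / 16 by norm_num)] with δ hδ
    exact hle δ hδ.1 hδ.2
  intro x hx
  exact Complex.normSq_eq_zero.1
    (circ_zero ((cyl_normSq hF.cyl).kF s) (fun x => Complex.normSq_nonneg _) hI0 x hx)

lemma Cyl.reduce (hF : Cyl F A B) (x : ℝ) : ∃ y ∈ Icc 0 (2 * Real.pi), ∀ s, F s x = F s y := by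
  have hp : Function.Periodic (fun x => fun s => F s x) (2 * Real.pi) := by
    intro x; ext s; exact hF.per s x
  obtain ⟨y, hy, h⟩ := hp.exists_mem_Ico₀ (by positivity) x
  exact ⟨y, Ico_subset_Icc_self hy, fun s => congrFun h s⟩

lemma QR.exists_zero_free (hF : QR F A B) (hne : ∀ S, ∃ s < S, ∃ x, F s x ≠ 0) (S : ℝ) :
    ∃ s < S, ∀ x, F s x ≠ 0 := by
  by_contra hcon
  push Not at hcon
  obtain ⟨s, hs, x, hx⟩ := hne (min S (-1))
  obtain ⟨y, hy, hxy⟩ := hF.cyl.reduce x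
  rw [hxy] at hx
  have hcs : Continuous fun s => F s y :=
    hF.cyl.cF.comp (by fun_prop : Continuous fun s : ℝ => (s, y))
  have hev := (hcs.continuousAt (x := s)).eventually_ne hx
  obtain ⟨η, hη, hηe⟩ := Metric.eventually_nhds_iff.1 hev
  obtain ⟨s', hs', h'⟩ := hF.zero_circle (a := s - η / 2) (b := s) (by linarith)
    (hs.le.trans (min_le_right _ _)) (by
      intro t ht
      obtain ⟨z, hz⟩ := hcon t (lt_of_le_of_lt ht.2 (hs.trans_le (min_le_left _ _)))
      obtain ⟨w, hw, hzw⟩ := hF.cyl.reduce z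
      exact ⟨w, hw, by rw [← hzw]; exact hz⟩)
  refine hηe ?_ (h' y hy)
  rw [Real.dist_eq, abs_lt]
  constructor <;> linarith [hs'.1, hs'.2]

lemma winding_int {γ γ' : ℝ → ℂ} (hd : ∀ x, HasDerivAt γ (γ' x) x) (hc : Continuous γ')
    (h0 : ∀ x, γ x ≠ 0) (hper : γ (2 * Real.pi) = γ 0) :
    ∃ k : ℤ, ∫ x in (0 : ℝ)..(2 * Real.pi), γ' x / γ x = k * (2 * Real.pi * Complex.I) := by
  have hγc : Continuous γ := continuous_iff_continuousAt.2 fun x => (hd x).continuousAt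
  have hq : Continuous fun x => γ' x / γ x := hc.div hγc h0
  have hI : ∀ x, HasDerivAt (fun y => ∫ z in (0 : ℝ)..y, γ' z / γ z) (γ' x / γ x) x := fun x =>
    intervalIntegral.integral_hasDerivAt_right (hq.intervalIntegrable _ _)
      (hq.stronglyMeasurableAtFilter _ _) hq.continuousAt
  have hG : ∀ x, HasDerivAt (fun y => γ y * Complex.exp (-∫ z in (0 : ℝ)..y, γ' z / γ z)) 0 x := by
    intro x
    have h1 := (hd x).mul ((hI x).neg.cexp)
    refine h1.congr_deriv ?_
    simp only [Pi.neg_apply]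
    field_simp [h0 x]
    ring
  have hconst := is_const_of_deriv_eq_zero (fun x => (hG x).differentiableAt)
    (fun x => (hG x).deriv) (2 * Real.pi) 0
  simp only [intervalIntegral.integral_same, neg_zero, Complex.exp_zero, mul_one, hper] at hconst
  have h1 : Complex.exp (-∫ z in (0 : ℝ)..(2 * Real.pi), γ' z / γ z) = 1 :=
    mul_left_cancel₀ (h0 0) (by rw [hconst, mul_one])
  rw [Complex.exp_neg, inv_eq_one, Complex.exp_eq_one_iff] at h1
  exact h1

def cN (F B : ℝ → ℝ → ℂ) (s : ℝ) : ℝ :=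
  ∫ x in (0 : ℝ)..(2 * Real.pi), cJ (F s x) (B s x) / Complex.normSq (F s x)

lemma div_im_cJ (a b : ℂ) : (b / a).im = cJ a b / Complex.normSq a := by
  rw [Complex.div_im, cJ]; ring

lemma Cyl.wind (hF : Cyl F A B) {s : ℝ} (h0 : ∀ x, F s x ≠ 0) :
    ∃ k : ℤ, (∫ x in (0 : ℝ)..(2 * Real.pi), B s x / F s x = k * (2 * Real.pi * Complex.I)) ∧
      cN F B s = k * (2 * Real.pi) := by
  have hp : F s (2 * Real.pi) = F s 0 := by simpa using hF.per s 0
  obtain ⟨k, hk⟩ := winding_int (hF.dx s) (hF.kB s) h0 hp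
  refine ⟨k, hk, ?_⟩
  have hq : Continuous fun x => B s x / F s x := (hF.kB s).div (hF.kF s) h0
  have h1 := Complex.imCLM.intervalIntegral_comp_comm (hq.intervalIntegrable (μ := volume) 0 (2 * Real.pi))
  rw [hk] at h1
  simp only [Complex.imCLM_apply, div_im_cJ] at h1
  rw [cN, h1]
  simp

/-- the truncated inverse -/
def cH (ε y : ℝ) : ℝ := ε⁻¹ + ∫ τ in ε..y, -((max τ ε) ^ 2)⁻¹

lemma cH_deriv {ε : ℝ} (hε : 0 < ε) (y : ℝ) : HasDerivAt (cH ε) (-((max y ε) ^ 2)⁻¹) y := by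
  have hc : Continuous fun τ : ℝ => -((max τ ε) ^ 2)⁻¹ := by
    refine Continuous.neg (Continuous.inv₀ (by fun_prop) (fun x => ?_))
    have : 0 < max x ε := lt_max_of_lt_right hε
    positivity
  exact (intervalIntegral.integral_hasDerivAt_right (hc.intervalIntegrable _ _)
      (hc.stronglyMeasurableAtFilter _ _) hc.continuousAt).const_add _

lemma cH_ge {ε y : ℝ} (hε : 0 < ε) (hy : ε ≤ y) : cH ε y = y⁻¹ := by
  have hp : ∀ τ ∈ uIcc ε y, 0 < τ := fun τ hτ => by
    rw [uIcc_of_le hy] at hτ; linarith [hτ.1]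
  have h1 : ∫ τ in ε..y, -((max τ ε) ^ 2)⁻¹ = ∫ τ in ε..y, -(τ ^ 2)⁻¹ := by
    apply intervalIntegral.integral_congr
    intro τ hτ
    rw [uIcc_of_le hy] at hτ
    simp only [max_eq_left hτ.1]
  have h2 : ∫ τ in ε..y, -(τ ^ 2)⁻¹ = y⁻¹ - ε⁻¹ := by
    refine intervalIntegral.integral_eq_sub_of_hasDerivAt
      (fun τ hτ => hasDerivAt_inv (hp τ hτ).ne') ?_
    apply ContinuousOn.intervalIntegrable
    intro τ hτ
    have := hp τ hτ
    exact (ContinuousAt.neg (ContinuousAt.inv₀ (by fun_prop) (by positivity))).continuousWithinAt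
  rw [cH, h1, h2]; ring

lemma cH_le {ε y : ℝ} (hε : 0 < ε) (hy : y ≤ ε) : cH ε y = 2 / ε - y / ε ^ 2 := by
  have h1 : ∫ τ in ε..y, -((max τ ε) ^ 2)⁻¹ = ∫ τ in ε..y, -(ε ^ 2)⁻¹ := by
    apply intervalIntegral.integral_congr
    intro τ hτ
    rw [uIcc_of_ge hy] at hτ
    simp only [max_eq_right hτ.2]
  rw [cH, h1, intervalIntegral.integral_const, smul_eq_mul]
  field_simp
  ring

lemma cH_g {ε y : ℝ} (hε : 0 < ε) (hy : 0 ≤ y) : 0 ≤ cH ε y + y * (-((max y ε) ^ 2)⁻¹) := by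
  rcases le_total ε y with h | h
  · rw [cH_ge hε h, max_eq_left h]
    have : 0 < y := by linarith
    apply le_of_eq
    field_simp
    ring
  · rw [cH_le hε h, max_eq_right h]
    have : 2 / ε - y / ε ^ 2 + y * -(ε ^ 2)⁻¹ = 2 * (ε - y) / ε ^ 2 := by field_simp; ring
    rw [this]
    have : 0 ≤ ε - y := by linarith
    positivity

lemma QR.box (hF : QR F A B) {a b : ℝ} (hab : a < b) (hb : b ≤ 0)
    (ha0 : ∀ x, F a x ≠ 0) (hb0 : ∀ x, F b x ≠ 0) :
    0 ≤ cN F B a ∧ cN F B a ≤ cN F B b ∧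
      (cN F B a = cN F B b → ∀ s ∈ Ioo a b, ∀ x, F s x ≠ 0) := by
  have hpi := Real.pi_pos
  have hex : ∀ s, (∀ x, F s x ≠ 0) → ∃ ε > 0, ∀ x, ε ≤ Complex.normSq (F s x) := by
    intro s hs
    obtain ⟨y, hy, hmin⟩ := isCompact_Icc.exists_isMinOn
      (nonempty_Icc.2 (by positivity : (0:ℝ) ≤ 2 * Real.pi))
      ((cyl_normSq hF.cyl).kF s).continuousOn
    refine ⟨Complex.normSq (F s y), Complex.normSq_pos.2 (hs y), fun x => ?_⟩
    obtain ⟨z, hz, hxz⟩ := hF.cyl.reduce x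
    rw [hxz]
    exact isMinOn_iff.1 hmin z hz
  obtain ⟨ε1, he1, h1⟩ := hex a ha0
  obtain ⟨ε2, he2, h2⟩ := hex b hb0
  set ε := min ε1 ε2 with hεd
  have hε : 0 < ε := lt_min he1 he2
  have h1' : ∀ x, ε ≤ Complex.normSq (F a x) := fun x => (min_le_left _ _).trans (h1 x)
  have h2' : ∀ x, ε ≤ Complex.normSq (F b x) := fun x => (min_le_right _ _).trans (h2 x)
  have hcH : Continuous fun τ : ℝ => -((max τ ε) ^ 2)⁻¹ := by
    refine Continuous.neg (Continuous.inv₀ (by fun_prop) (fun x => ?_))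
    have : 0 < max x ε := lt_max_of_lt_right hε
    positivity
  have hder : ∀ y ∈ Icc (0 : ℝ) (1 / 4), HasDerivAt (cH ε) (-((max y ε) ^ 2)⁻¹) y :=
    fun y _ => cH_deriv hε y
  have hp : ∀ y ∈ Icc (0 : ℝ) (1 / 4), 0 ≤ cH ε y + y * (-((max y ε) ^ 2)⁻¹) :=
    fun y hy => cH_g hε hy.1
  have hmono := hF.phi_mono hder hcH.continuousOn hp
  have ea : cPhi (cH ε) F B a = cN F B a := by
    simp only [cPhi, cN, cH_ge hε (h1' _)]
    congr 1; ext x; ring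
  have eb : cPhi (cH ε) F B b = cN F B b := by
    simp only [cPhi, cN, cH_ge hε (h2' _)]
    congr 1; ext x; ring
  refine ⟨?_, ?_, ?_⟩
  · rw [← ea]; exact hF.phi_nonneg hder hcH.continuousOn hp (by linarith)
  · rw [← ea, ← eb]; exact hmono (show a ∈ Iic 0 by simp; linarith) hb hab.le
  intro heq s hs x hx
  obtain ⟨y, hy, hxy⟩ := hF.cyl.reduce x
  rw [hxy] at hx
  rw [← ea, ← eb] at heq
  have hconst : ∀ t ∈ Icc a b, cPhi (cH ε) F B t = cPhi (cH ε) F B a := by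
    intro t ht
    apply le_antisymm
    · rw [heq]; exact hmono (ht.2.trans hb) hb ht.2
    · exact hmono (show a ∈ Iic 0 by simp; linarith) (ht.2.trans hb) ht.1
  have hd := cPhi_deriv hF.cyl hF.mem hder hcH.continuousOn
  have hgz : ∀ t ∈ Ioo a b, (cH ε (Complex.normSq (F t y)) + Complex.normSq (F t y) *
      (-((max (Complex.normSq (F t y)) ε) ^ 2)⁻¹)) * cJ (A t y) (B t y) = 0 := by
    intro t ht
    have h3 : HasDerivAt (cPhi (cH ε) F B) 0 t := by
      refine (hasDerivAt_const t (cPhi (cH ε) F B a)).congr_of_eventuallyEq ?_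
      filter_upwards [Icc_mem_nhds ht.1 ht.2] with r hr
      exact hconst r hr
    have h4 := (hd t).unique h3
    have c1 := (cyl_normSq hF.cyl).kF t
    have c0 : Continuous (cH ε) := continuous_iff_continuousAt.2 fun x => (cH_deriv hε x).continuousAt
    have c4 : Continuous fun x => cJ (A t x) (B t x) :=
      (((cyl_re hF.cyl).kA t).mul ((cyl_im hF.cyl).kB t)).sub
        (((cyl_im hF.cyl).kA t).mul ((cyl_re hF.cyl).kB t))
    have h5 := circ_zero ((continuous_const.mul ((c0.comp c1).add (c1.mul (hcH.comp c1)))).mul c4)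
      (fun x => mul_nonneg (mul_nonneg zero_le_two (hp _ (hF.mem t x)))
        (hF.J_nonneg (by linarith [ht.2]) x)) h4.le y hy
    simp only [Pi.mul_apply, Pi.add_apply, Function.comp_apply] at h5
    linarith
  have hTd := fun t => (cyl_normSq hF.cyl).ds t y
  have hgd : ∀ t, HasDerivAt (fun t => Complex.normSq (F t y) * cH ε (Complex.normSq (F t y))) _ t :=
    fun t => (hTd t).mul ((cH_deriv hε _).comp t (hTd t))
  obtain ⟨ξ, hξ, he⟩ := exists_hasDerivAt_eq_slope
    (fun t => Complex.normSq (F t y) * cH ε (Complex.normSq (F t y))) _ hs.1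
    (fun t _ => (hgd t).continuousAt.continuousWithinAt) (fun t _ => hgd t)
  have hξ' : ξ ∈ Ioo a b := ⟨hξ.1, hξ.2.trans hs.2⟩
  have h6 := hgz ξ hξ'
  have hz : (cH ε (Complex.normSq (F ξ y)) + Complex.normSq (F ξ y) *
      (-((max (Complex.normSq (F ξ y)) ε) ^ 2)⁻¹)) *
      (2 * ((F ξ y).re * (A ξ y).re + (F ξ y).im * (A ξ y).im)) = 0 := by
    rcases mul_eq_zero.1 h6 with h | h
    · rw [h, zero_mul]
    · have h7 := hF.hA ξ (by linarith [hξ'.2]) y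
      rw [h, mul_zero] at h7
      have : A ξ y = 0 := by
        rw [← norm_eq_zero]; exact pow_eq_zero_iff (two_ne_zero) |>.1 (le_antisymm h7 (sq_nonneg _))
      rw [this]; simp
  have hone : Complex.normSq (F a y) * cH ε (Complex.normSq (F a y)) = 1 := by
    rw [cH_ge hε (h1' y)]
    exact mul_inv_cancel₀ (by have := h1' y; linarith)
  rw [hx, map_zero, zero_mul, hone] at he
  have h8 : (0 - 1 : ℝ) / (s - a) = 0 := by
    rw [← he]; rw [← hz]; ring
  have : s - a ≠ 0 := by have := hs.1; linarith
  field_simp at h8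
  norm_num at h8

lemma QR.zero_free_end (hF : QR F A B) (hne : ∀ S, ∃ s < S, ∃ x, F s x ≠ 0) :
    ∃ S, ∀ s < S, ∀ x, F s x ≠ 0 := by
  classical
  have hpi := Real.pi_pos
  have key : ∀ s < 0, (∀ x, F s x ≠ 0) → ∃ k : ℕ, cN F B s = k * (2 * Real.pi) := by
    intro s hs h0
    obtain ⟨s', hs', h0'⟩ := hF.exists_zero_free hne s
    have hb := hF.box hs' hs.le h0' h0
    obtain ⟨k, -, hk⟩ := hF.cyl.wind h0
    have h1 : 0 ≤ cN F B s := hb.1.trans hb.2.1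
    rw [hk] at h1
    have h2 : (0:ℝ) ≤ k := nonneg_of_mul_nonneg_left h1 (by positivity)
    have h3 : 0 ≤ k := by exact_mod_cast h2
    refine ⟨k.toNat, ?_⟩
    rw [hk]
    congr 1
    exact_mod_cast (Int.toNat_of_nonneg h3).symm
  have hP : ∃ k : ℕ, ∃ s < 0, (∀ x, F s x ≠ 0) ∧ cN F B s = k * (2 * Real.pi) := by
    obtain ⟨s, hs, h0⟩ := hF.exists_zero_free hne 0
    obtain ⟨k, hk⟩ := key s hs h0
    exact ⟨k, s, hs, h0, hk⟩
  obtain ⟨S, hS, hS0, hSk⟩ := Nat.find_spec hP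
  refine ⟨S, fun s hs => ?_⟩
  obtain ⟨s', hs', h0'⟩ := hF.exists_zero_free hne s
  have hs'S : s' < S := hs'.trans hs
  have hb := hF.box hs'S hS.le h0' hS0
  obtain ⟨k, hk⟩ := key s' (hs'S.trans hS) h0'
  have hmin : Nat.find hP ≤ k := Nat.find_min' hP ⟨s', hs'S.trans hS, h0', hk⟩
  refine hb.2.2 (le_antisymm hb.2.1 ?_) s ⟨hs', hs⟩
  rw [hk, hSk]
  have : ((Nat.find hP : ℕ) : ℝ) ≤ k := by exact_mod_cast hmin
  gcongr

end
end

section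
open MeasureTheory Set
open scoped Topology NNReal

noncomputable section

variable {F A B : ℝ → ℝ → ℂ}

lemma cyl_perA (h : Cyl F A B) (s x : ℝ) : A s (x + 2 * Real.pi) = A s x := by
  have h1 := h.ds s (x + 2 * Real.pi)
  have h2 : (fun s => F s (x + 2 * Real.pi)) = fun s => F s x := by ext y; exact h.per y x
  rw [h2] at h1
  exact h1.unique (h.ds s x)

lemma deriv_of_exp {w g : ℝ → ℂ} {g' : ℂ} {x : ℝ} (hw : ContinuousAt w x)
    (he : ∀ y, Complex.exp (w y) = g y) (hg : HasDerivAt g g' x) :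
    HasDerivAt w (g' / g x) x := by
  have hgx : g x ≠ 0 := by rw [← he]; exact Complex.exp_ne_zero _
  have h1 : HasDerivAt (fun y => g y / g x) (g' / g x) x := hg.div_const _
  have h2 : HasDerivAt (fun y => Complex.log (g y / g x)) ((g' / g x) / (g x / g x)) x :=
    h1.clog_real (by rw [div_self hgx]; exact Complex.one_mem_slitPlane)
  rw [div_self hgx, div_one] at h2
  refine (h2.add_const (w x)).congr_of_eventuallyEq ?_
  have h3 : ∀ᶠ y in 𝓝 x, ‖w y - w x‖ < 1 := by
    have := Metric.continuousAt_iff'.1 hw 1 one_pos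
    simpa [dist_eq_norm] using this
  filter_upwards [h3] with y hy
  have h4 : |(w y - w x).im| < 1 := (Complex.abs_im_le_norm _).trans_lt hy
  rw [abs_lt] at h4
  have : g y / g x = Complex.exp (w y - w x) := by rw [Complex.exp_sub, he, he]
  simp only [this]
  rw [Complex.log_exp (by linarith [Real.pi_gt_three]) (by linarith [Real.pi_gt_three])]
  ring

lemma exp_unique {w w' g g' : ℝ → ℂ} (hw : ∀ x, HasDerivAt w (w' x) x)
    (hg : ∀ x, HasDerivAt g (g' x) x) (hr : ∀ x, g' x = w' x * g x)
    (h0 : Complex.exp (w 0) = g 0) (x : ℝ) : Complex.exp (w x) = g x := by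
  have h1 : ∀ x, HasDerivAt (fun y => g y * Complex.exp (-(w y))) 0 x := by
    intro x
    refine ((hg x).mul ((hw x).neg.cexp)).congr_deriv ?_
    rw [hr, Pi.neg_apply]; ring
  have h2 := is_const_of_deriv_eq_zero (fun x => (h1 x).differentiableAt) (fun x => (h1 x).deriv) x 0
  rw [← h0, ← Complex.exp_add, add_neg_cancel, Complex.exp_zero, Complex.exp_neg] at h2
  have h3 := Complex.exp_ne_zero (w x)
  field_simp at h2
  exact h2.symm

lemma Cyl.lift (hF : Cyl F A B) (h0 : ∀ s x, F s x ≠ 0) :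
    ∃ (n : ℤ) (W : ℝ → ℝ → ℂ),
      Cyl W (fun s x => A s x / F s x - n) (fun s x => B s x / F s x - n * Complex.I) ∧
      ∀ s x, F s x = Complex.exp (n * (s + x * Complex.I) + W s x) := by
  obtain ⟨n, hn, -⟩ := hF.wind (s := 0) (h0 0)
  set P : ℝ → ℝ → ℂ := fun s x => A s x / F s x - n with hP
  set Q : ℝ → ℝ → ℂ := fun s x => B s x / F s x - n * Complex.I with hQ
  have cP : Continuous fun p : ℝ × ℝ => P p.1 p.2 :=
    (hF.cA.div hF.cF (fun p => h0 _ _)).sub continuous_const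
  have cQ : Continuous fun p : ℝ × ℝ => Q p.1 p.2 :=
    (hF.cB.div hF.cF (fun p => h0 _ _)).sub continuous_const
  have cQ0 : Continuous (Q 0) := cyl_cont_circ cQ 0
  have cPx : ∀ x, Continuous fun s => P s x := fun x =>
    cP.comp (by fun_prop : Continuous fun s : ℝ => (s, x))
  set W : ℝ → ℝ → ℂ := fun s x => Complex.log (F 0 0) + (∫ y in (0 : ℝ)..x, Q 0 y) +
    ∫ r in (0 : ℝ)..s, P r x with hW
  have dW : ∀ s x, HasDerivAt (fun s => W s x) (P s x) s := fun s x =>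
    (intervalIntegral.integral_hasDerivAt_right ((cPx x).intervalIntegrable _ _)
      ((cPx x).stronglyMeasurableAtFilter _ _) (cPx x).continuousAt).const_add _
  have dW0 : ∀ x, HasDerivAt (fun x => W 0 x) (Q 0 x) x := by
    intro x
    simp only [hW, intervalIntegral.integral_same, add_zero]
    exact (intervalIntegral.integral_hasDerivAt_right (cQ0.intervalIntegrable _ _)
      (cQ0.stronglyMeasurableAtFilter _ _) cQ0.continuousAt).const_add _
  have cW : Continuous fun p : ℝ × ℝ => W p.1 p.2 := by
    have c1 : Continuous fun p : ℝ × ℝ => ∫ r in (0 : ℝ)..p.1, P r p.2 := by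
      refine intervalIntegral.continuous_parametric_intervalIntegral_of_continuous
        (f := fun (p : ℝ × ℝ) r => P r p.2) ?_ continuous_fst
      exact cP.comp (by fun_prop : Continuous fun q : (ℝ × ℝ) × ℝ => (q.2, q.1.2))
    have c2 : Continuous fun p : ℝ × ℝ => ∫ y in (0 : ℝ)..p.2, Q 0 y :=
      (intervalIntegral.continuous_primitive (fun a b => cQ0.intervalIntegrable a b) 0).comp
        continuous_snd
    exact (continuous_const.add c2).add c1
  set G : ℝ → ℝ → ℂ := fun s x => F s x * Complex.exp (-(n * (s + x * Complex.I))) with hG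
  have dGs : ∀ s x, HasDerivAt (fun s => G s x) (P s x * G s x) s := by
    intro s x
    have h1 : HasDerivAt (fun s : ℝ => -((n : ℂ) * (s + x * Complex.I))) (-(n : ℂ)) s := by
      have := ((Complex.ofRealCLM.hasDerivAt (x := s)).add_const (x * Complex.I)).const_mul (n : ℂ)
      exact this.neg.congr_deriv (by simp)
    refine ((hF.ds s x).mul h1.cexp).congr_deriv ?_
    have := h0 s x
    simp only [hP, hG]; field_simp; ring
  have dGx : ∀ s x, HasDerivAt (fun x => G s x) (Q s x * G s x) x := by
    intro s x
    have h1 : HasDerivAt (fun x : ℝ => -((n : ℂ) * (s + x * Complex.I))) (-(n * Complex.I : ℂ)) x := by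
      have := (((Complex.ofRealCLM.hasDerivAt (x := x)).mul_const Complex.I).const_add
        (s : ℂ)).const_mul (n : ℂ)
      exact this.neg.congr_deriv (by simp)
    refine ((hF.dx s x).mul h1.cexp).congr_deriv ?_
    have := h0 s x
    simp only [hQ, hG]; field_simp; ring
  have e0 : ∀ x, Complex.exp (W 0 x) = G 0 x := by
    refine exp_unique dW0 (dGx 0) (fun x => rfl) ?_
    simp [hW, hG, Complex.exp_log (h0 0 0)]
  have eW : ∀ s x, Complex.exp (W s x) = G s x := fun s x =>
    exp_unique (w := fun s => W s x) (fun s => dW s x) (fun s => dGs s x) (fun s => rfl) (e0 x) s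
  refine ⟨n, W, ⟨dW, ?_, cW, cP, cQ, ?_⟩, ?_⟩
  · intro s x
    have h1 := deriv_of_exp (w := W s) (cyl_cont_circ cW s).continuousAt (eW s) (dGx s x)
    refine h1.congr_deriv ?_
    have : G s x ≠ 0 := by rw [← eW]; exact Complex.exp_ne_zero _
    rw [mul_div_assoc, div_self this, mul_one]
  · intro s x
    have h1 : ∀ r, P r (x + 2 * Real.pi) = P r x := fun r => by
      simp only [hP, cyl_perA hF, hF.per]
    have hper : Function.Periodic (Q 0) (2 * Real.pi) := fun x => by
      simp only [hQ, cyl_perB hF, hF.per]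
    have h2 : ∫ y in x..x + 2 * Real.pi, Q 0 y = 0 := by
      rw [hper.intervalIntegral_add_eq x 0, zero_add]
      simp only [hQ]
      have hq : Continuous fun x => B 0 x / F 0 x := (hF.kB 0).div (hF.kF 0) (h0 0)
      rw [intervalIntegral.integral_sub (hq.intervalIntegrable _ _)
        (continuous_const.intervalIntegrable _ _), hn, intervalIntegral.integral_const]
      simp; ring
    have h3 := intervalIntegral.integral_add_adjacent_intervals
      (cQ0.intervalIntegrable (μ := volume) 0 x) (cQ0.intervalIntegrable x (x + 2 * Real.pi))
    simp only [hW, h1]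
    rw [← h3, h2, add_zero]
  · intro s x
    rw [Complex.exp_add, eW, hG]
    simp only
    rw [mul_comm (F s x), ← mul_assoc, ← Complex.exp_add, add_neg_cancel, Complex.exp_zero, one_mul]

lemma cyl_int_deriv {U Us Ut : ℝ → ℝ → ℝ} (hU : Cyl U Us Ut) (s : ℝ) :
    HasDerivAt (fun s => ∫ x in (0 : ℝ)..(2 * Real.pi), U s x)
      (∫ x in (0 : ℝ)..(2 * Real.pi), Us s x) s := by
  obtain ⟨D, hDc, hD, hDs⟩ := cyl_slope hU s
  have h1 := hasDerivAt_sub_mul (s := s) (cyl_cont_int hDc 0 (2 * Real.pi)).continuousAt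
  simp only [hDs] at h1
  refine (h1.add_const (∫ x in (0 : ℝ)..(2 * Real.pi), U s x)).congr_of_eventuallyEq ?_
  refine Filter.Eventually.of_forall fun s' => ?_
  simp only
  rw [← intervalIntegral.integral_const_mul, ← intervalIntegral.integral_add
    ((by exact continuous_const.mul (cyl_cont_circ hDc s') :
      Continuous fun x => (s' - s) * D s' x).intervalIntegrable _ _)
    ((hU.kF s).intervalIntegrable _ _)]
  refine intervalIntegral.integral_congr fun x _ => ?_
  rw [← hD]; ring

end
end

section
open MeasureTheory Set
open scoped Topology NNReal

noncomputable section

variable {F A B : ℝ → ℝ → ℂ}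

def cq (δ : ℝ) (F A : ℝ → ℝ → ℂ) (s x : ℝ) : ℝ := ‖F s x‖ * ‖A s x‖ / (Complex.normSq (F s x) + δ)

lemma cq_cont {δ : ℝ} (hδ : 0 < δ) {s : ℝ} (hF : Continuous (F s)) (hA : Continuous (A s)) :
    Continuous (cq δ F A s) := by
  refine (hF.norm.mul hA.norm).div ((Complex.continuous_normSq.comp hF).add continuous_const) ?_
  intro x
  have := Complex.normSq_nonneg (F s x)
  positivity

lemma QR.log_phi (hF : QR F A B) (h0 : ∀ s x, F s x ≠ 0) {δ : ℝ} (hδ : 0 < δ) (hδ1 : δ ≤ 1 / 4) :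
    ∃ Φ Φ' : ℝ → ℝ, (∀ s, HasDerivAt Φ (Φ' s) s) ∧ (∀ s ≤ 0, 0 ≤ Φ s) ∧
      MonotoneOn Φ (Iic 0) ∧
      (Φ 0 ≤ (∫ x in (0 : ℝ)..(2 * Real.pi), ‖B 0 x / F 0 x‖) * -Real.log δ) ∧
      (∀ s ≤ 0, (∫ x in (0 : ℝ)..(2 * Real.pi), cq δ F A s x ^ 2) ≤ Φ' s) ∧
      (∀ s ≤ 0, (∫ x in (0 : ℝ)..(2 * Real.pi), cq δ F B s x ^ 2) ≤ Φ' s) := by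
  have hpi := Real.pi_pos
  set h : ℝ → ℝ := fun y => (Real.log (y + δ) - Real.log δ) / (y + δ) with hh
  set h' : ℝ → ℝ := fun y => (1 - (Real.log (y + δ) - Real.log δ)) / (y + δ) ^ 2 with hh'
  have hyd : ∀ y ∈ Icc (0 : ℝ) (1 / 4), 0 < y + δ := fun y hy => by linarith [hy.1]
  have hl : ∀ y ∈ Icc (0 : ℝ) (1 / 4), 0 ≤ Real.log (y + δ) - Real.log δ := fun y hy =>
    sub_nonneg.2 (Real.log_le_log hδ (by linarith [hy.1]))
  have hlogd : ∀ y ∈ Icc (0 : ℝ) (1 / 4),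
      HasDerivAt (fun y => Real.log (y + δ) - Real.log δ) ((y + δ)⁻¹) y := by
    intro y hy
    have h2 : HasDerivAt (fun y => y + δ) 1 y := (hasDerivAt_id y).add_const δ
    have := (h2.log (hyd y hy).ne').sub_const (Real.log δ)
    exact this.congr_deriv (by simp)
  have hder : ∀ y ∈ Icc (0 : ℝ) (1 / 4), HasDerivAt h (h' y) y := by
    intro y hy
    have h2 : HasDerivAt (fun y => y + δ) 1 y := (hasDerivAt_id y).add_const δ
    have h5 := hyd y hy
    refine ((hlogd y hy).div h2 h5.ne').congr_deriv ?_
    simp only [hh']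
    congr 1
    field_simp
  have hcont : ContinuousOn h' (Icc (0 : ℝ) (1 / 4)) := by
    have c1 : ContinuousOn (fun y => Real.log (y + δ) - Real.log δ) (Icc (0 : ℝ) (1 / 4)) :=
      fun y hy => (hlogd y hy).continuousAt.continuousWithinAt
    refine (continuousOn_const.sub c1).div ((by fun_prop : ContinuousOn (fun y : ℝ => y + δ)
      (Icc (0 : ℝ) (1 / 4))).pow 2) ?_
    intro y hy
    have := hyd y hy
    positivity
  have hlow : ∀ y ∈ Icc (0 : ℝ) (1 / 4), y / (y + δ) ^ 2 ≤ h y + y * h' y := by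
    intro y hy
    have h4 := hl y hy
    have h5 := hyd y hy
    have e : h y + y * h' y = (δ * (Real.log (y + δ) - Real.log δ) + y) / (y + δ) ^ 2 := by
      simp only [hh, hh']
      field_simp
      ring
    rw [e]
    gcongr
    nlinarith
  have hp : ∀ y ∈ Icc (0 : ℝ) (1 / 4), 0 ≤ h y + y * h' y := fun y hy =>
    le_trans (by have := hyd y hy; have := hy.1; positivity) (hlow y hy)
  have hd := cPhi_deriv hF.cyl hF.mem hder hcont
  have hhc : ContinuousOn h (Icc (0 : ℝ) (1 / 4)) :=
    fun y hy => (hder y hy).continuousAt.continuousWithinAt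
  have cI : ∀ s, Continuous fun x => 2 * (h (Complex.normSq (F s x)) +
        Complex.normSq (F s x) * h' (Complex.normSq (F s x))) * cJ (A s x) (B s x) := by
    intro s
    have c1 := (cyl_normSq hF.cyl).kF s
    have c2 := hhc.comp_continuous c1 (hF.mem s)
    have c3 := hcont.comp_continuous c1 (hF.mem s)
    have c4 : Continuous fun x => cJ (A s x) (B s x) :=
      (((cyl_re hF.cyl).kA s).mul ((cyl_im hF.cyl).kB s)).sub
        (((cyl_im hF.cyl).kA s).mul ((cyl_re hF.cyl).kB s))
    exact (continuous_const.mul (c2.add (c1.mul c3))).mul c4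
  have hpt : ∀ s, ∀ X : ℂ, ∀ x, ‖X‖ ^ 2 ≤ 2 * cJ (A s x) (B s x) →
      (‖F s x‖ * ‖X‖ / (Complex.normSq (F s x) + δ)) ^ 2 ≤ 2 * (h (Complex.normSq (F s x)) +
        Complex.normSq (F s x) * h' (Complex.normSq (F s x))) * cJ (A s x) (B s x) := by
    intro s X x hX
    have h1 := hlow _ (hF.mem s x)
    have h2 := hp _ (hF.mem s x)
    have h3 := hyd _ (hF.mem s x)
    have h4 := (hF.mem s x).1
    rw [div_pow, mul_pow, ← Complex.normSq_eq_norm_sq]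
    calc Complex.normSq (F s x) * ‖X‖ ^ 2 / (Complex.normSq (F s x) + δ) ^ 2
        = (Complex.normSq (F s x) / (Complex.normSq (F s x) + δ) ^ 2) * ‖X‖ ^ 2 := by ring
      _ ≤ (h (Complex.normSq (F s x)) + Complex.normSq (F s x) * h' (Complex.normSq (F s x))) *
          (2 * cJ (A s x) (B s x)) := mul_le_mul h1 hX (sq_nonneg _) h2
      _ = _ := by ring
  refine ⟨cPhi h F B, _, hd, fun s hs => hF.phi_nonneg hder hcont hp hs,
    hF.phi_mono hder hcont hp, ?_, ?_, ?_⟩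
  · rw [← intervalIntegral.integral_mul_const]
    have c1 := (cyl_normSq hF.cyl).kF 0
    have c2 := hhc.comp_continuous c1 (hF.mem 0)
    have c4 : Continuous fun x => cJ (F 0 x) (B 0 x) :=
      (((cyl_re hF.cyl).kF 0).mul ((cyl_im hF.cyl).kB 0)).sub
        (((cyl_im hF.cyl).kF 0).mul ((cyl_re hF.cyl).kB 0))
    refine intervalIntegral.integral_mono_on (by positivity)
      ((c2.mul c4).intervalIntegrable _ _)
      (Continuous.intervalIntegrable (((hF.cyl.kB 0).div (hF.cyl.kF 0) (h0 0)).norm.mul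
        continuous_const) _ _) ?_
    intro x _
    have m := hF.mem 0 x
    set t := Complex.normSq (F 0 x) with ht
    have hF0 : 0 < ‖F 0 x‖ := norm_pos_iff.2 (h0 0 x)
    have ht2 : t = ‖F 0 x‖ ^ 2 := Complex.normSq_eq_norm_sq _
    have h1 := hl t m
    have h2 : Real.log (t + δ) ≤ 0 := Real.log_nonpos (hyd t m).le (by linarith [m.2])
    have h3 := hyd t m
    have hht : 0 ≤ h t := div_nonneg h1 h3.le
    calc h t * cJ (F 0 x) (B 0 x) ≤ h t * (‖F 0 x‖ * ‖B 0 x‖) :=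
          mul_le_mul_of_nonneg_left ((le_abs_self _).trans (cJ_abs _ _)) hht
      _ = (t / (t + δ)) * ((Real.log (t + δ) - Real.log δ) * (‖B 0 x‖ / ‖F 0 x‖)) := by
          simp only [hh]; rw [ht2]; field_simp
      _ ≤ 1 * ((-Real.log δ) * (‖B 0 x‖ / ‖F 0 x‖)) := by
          refine mul_le_mul ?_ ?_ (by positivity) (by norm_num)
          · rw [div_le_one h3]; linarith
          · exact mul_le_mul_of_nonneg_right (by linarith) (by positivity)
      _ = _ := by rw [norm_div]; ring
  · intro s hs
    refine intervalIntegral.integral_mono_on (by positivity)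
      (((cq_cont hδ (hF.cyl.kF s) (hF.cyl.kA s)).pow 2).intervalIntegrable _ _)
      ((cI s).intervalIntegrable _ _) ?_
    intro x _
    exact hpt s _ x (hF.hA s hs x)
  · intro s hs
    refine intervalIntegral.integral_mono_on (by positivity)
      (((cq_cont hδ (hF.cyl.kF s) (hF.cyl.kB s)).pow 2).intervalIntegrable _ _)
      ((cI s).intervalIntegrable _ _) ?_
    intro x _
    exact hpt s _ x (hF.hB s hs x)

end
end

section
open MeasureTheory Set
open scoped Topology NNReal

noncomputable section

variable {F A B : ℝ → ℝ → ℂ}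

lemma cyl_logT (hF : Cyl F A B) {δ : ℝ} (hδ : 0 < δ) :
    Cyl (fun s x => Real.log (Complex.normSq (F s x) + δ))
      (fun s x => (Complex.normSq (F s x) + δ)⁻¹ *
        (2 * ((F s x).re * (A s x).re + (F s x).im * (A s x).im)))
      (fun s x => (Complex.normSq (F s x) + δ)⁻¹ *
        (2 * ((F s x).re * (B s x).re + (F s x).im * (B s x).im))) := by
  refine cyl_comp (cyl_normSq hF) (T := Ici 0) (φ := fun y => Real.log (y + δ))
    (φ' := fun y => (y + δ)⁻¹) (fun s x => Complex.normSq_nonneg _) ?_ ?_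
  · intro y hy
    have hy0 : 0 ≤ y := hy
    have h2 : HasDerivAt (fun y => y + δ) 1 y := (hasDerivAt_id y).add_const δ
    exact (h2.log (by positivity)).congr_deriv (by simp)
  · refine ContinuousOn.inv₀ (by fun_prop) ?_
    intro y hy
    have hy0 : 0 ≤ y := hy
    positivity

lemma cq_bd {δ : ℝ} (hδ : 0 < δ) (s x : ℝ) : |(Complex.normSq (F s x) + δ)⁻¹ *
        (2 * ((F s x).re * (A s x).re + (F s x).im * (A s x).im))| ≤ 2 * cq δ F A s x := by
  have h1 := cRe_abs (F s x) (A s x)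
  have h2 := Complex.normSq_nonneg (F s x)
  rw [abs_mul, abs_mul, abs_of_pos (by positivity : 0 < (Complex.normSq (F s x) + δ)⁻¹), cq]
  calc _ ≤ (Complex.normSq (F s x) + δ)⁻¹ * (|2| * (‖F s x‖ * ‖A s x‖)) := by gcongr
    _ = _ := by rw [abs_two]; field_simp

lemma QR.good (hF : QR F A B) (h0 : ∀ s x, F s x ≠ 0) :
    ∃ K, ∀ R ≥ 1, ∃ s ∈ Icc (-(2 * R)) (-R),
      (∫ x in (0 : ℝ)..(2 * Real.pi), ‖A s x / F s x‖ ^ 2) ≤ K ∧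
      (∫ x in (0 : ℝ)..(2 * Real.pi), ‖B s x / F s x‖ ^ 2) ≤ K := by
  have hpi := Real.pi_pos
  set C0 := ∫ x in (0 : ℝ)..(2 * Real.pi), ‖B 0 x / F 0 x‖ with hC0
  have hC0n : 0 ≤ C0 := intervalIntegral.integral_nonneg (by positivity) (fun x _ => norm_nonneg _)
  set M0 := ∫ x in (0 : ℝ)..(2 * Real.pi), Real.log (Complex.normSq (F 0 x)) with hM0
  set c := (|M0| + 4 * Real.pi + C0) / (2 * Real.pi) + 2 * √(2 * Real.pi * C0) with hc
  have hcn : 0 ≤ c := by positivity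
  set μ := c + 2 with hμ
  have hμ2 : 2 ≤ μ := by linarith
  refine ⟨4 * (C0 * μ ^ 2), fun R hR => ?_⟩
  set δ := Real.exp (-(μ ^ 2 * R)) with hδd
  have hδ : 0 < δ := Real.exp_pos _
  have hμR : 4 ≤ μ ^ 2 * R := by nlinarith
  have hδ1 : δ ≤ 1 / 4 := by
    have h1 := Real.add_one_le_exp (μ ^ 2 * R)
    rw [hδd, Real.exp_neg, one_div]
    exact inv_anti₀ (by norm_num) (by linarith)
  have hlδ : Real.log δ = -(μ ^ 2 * R) := Real.log_exp _
  obtain ⟨Φ, Φ', hd, hn, hm, hΦ0, hYA, hYB⟩ := hF.log_phi h0 hδ hδ1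
  rw [← hC0, hlδ, neg_neg] at hΦ0
  obtain ⟨s, hs, he⟩ := exists_hasDerivAt_eq_slope Φ Φ' (a := -(2 * R)) (b := -R) (by linarith)
    (fun s _ => (hd s).continuousAt.continuousWithinAt) (fun s _ => hd s)
  have hs0 : s ≤ 0 := by linarith [hs.2]
  have hΦ's : Φ' s ≤ C0 * μ ^ 2 := by
    rw [he, div_le_iff₀ (by linarith)]
    have h1 := hn (-(2 * R)) (by linarith)
    have h2 := hm (show -R ∈ Iic (0:ℝ) by simp; linarith) (show (0:ℝ) ∈ Iic (0:ℝ) by simp) (by linarith)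
    nlinarith
  have hL := cyl_logT hF.cyl hδ
  have hqc := fun s => cq_cont hδ (hF.cyl.kF s) (hF.cyl.kA s)
  have hqcB := fun s => cq_cont hδ (hF.cyl.kF s) (hF.cyl.kB s)
  set M := fun s => ∫ x in (0 : ℝ)..(2 * Real.pi), Real.log (Complex.normSq (F s x) + δ) with hM
  have hMd := cyl_int_deriv hL
  have hM' : ∀ s ≤ 0, (∫ x in (0 : ℝ)..(2 * Real.pi), (Complex.normSq (F s x) + δ)⁻¹ *
        (2 * ((F s x).re * (A s x).re + (F s x).im * (A s x).im))) ≤ 2 * Real.pi * μ + Φ' s / μ := by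
    intro s hs
    have h1 := hYA s hs
    calc _ ≤ ∫ x in (0 : ℝ)..(2 * Real.pi), (μ + cq δ F A s x ^ 2 / μ) := by
          refine intervalIntegral.integral_mono_on (by positivity)
            ((hL.kA s).intervalIntegrable _ _)
            (Continuous.intervalIntegrable (continuous_const.add (((hqc s).pow 2).div_const _)) _ _) ?_
          intro x _
          refine (le_abs_self _).trans ((cq_bd hδ s x).trans ?_)
          have : 0 ≤ (μ - cq δ F A s x) ^ 2 / μ := by positivity
          have e : (μ - cq δ F A s x) ^ 2 / μ = μ + cq δ F A s x ^ 2 / μ - 2 * cq δ F A s x := by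
            field_simp; ring
          linarith
      _ = 2 * Real.pi * μ + (∫ x in (0 : ℝ)..(2 * Real.pi), cq δ F A s x ^ 2) / μ := by
          rw [intervalIntegral.integral_add (continuous_const.intervalIntegrable _ _)
            ((by exact ((hqc s).pow 2).div_const _ :
              Continuous fun x => cq δ F A s x ^ 2 / μ).intervalIntegrable _ _),
            intervalIntegral.integral_const, intervalIntegral.integral_div]
          simp
      _ ≤ _ := by gcongr
  have hanti : AntitoneOn (fun s => M s - 2 * Real.pi * μ * s - Φ s / μ) (Iic 0) := by
    have hdd : ∀ s, HasDerivAt (fun s => M s - 2 * Real.pi * μ * s - Φ s / μ) _ s := fun s =>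
      ((hMd s).sub ((hasDerivAt_id s).const_mul (2 * Real.pi * μ))).sub ((hd s).div_const μ)
    refine antitoneOn_of_deriv_nonpos (convex_Iic 0)
      (fun s _ => (hdd s).continuousAt.continuousWithinAt)
      (fun s _ => (hdd s).differentiableAt.differentiableWithinAt) ?_
    intro s hs
    rw [interior_Iic] at hs
    rw [(hdd s).deriv]
    have := hM' s (le_of_lt hs)
    linarith
  have hMs : -(|M0| + 4 * Real.pi + C0) * (μ * R) ≤ M s := by
    have h1 := hanti (show s ∈ Iic (0:ℝ) from hs0) (show (0:ℝ) ∈ Iic (0:ℝ) by simp) hs0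
    simp only at h1
    have h2 : M0 ≤ M 0 := by
      refine intervalIntegral.integral_mono_on (by positivity) ?_ ((hL.kF 0).intervalIntegrable _ _) ?_
      · refine Continuous.intervalIntegrable (Continuous.log ((cyl_normSq hF.cyl).kF 0) ?_) _ _
        intro x
        exact (Complex.normSq_pos.2 (h0 0 x)).ne'
      · intro x _
        exact Real.log_le_log (Complex.normSq_pos.2 (h0 0 x)) (by linarith)
    have h3 : 0 ≤ Φ s / μ := div_nonneg (hn s hs0) (by linarith)
    have h4 : Φ 0 / μ ≤ C0 * (μ * R) := by
      rw [div_le_iff₀ (by linarith)]; linarith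
    have h5 := neg_abs_le M0
    have h6 : 1 ≤ μ * R := by nlinarith
    have h7 : |M0| ≤ |M0| * (μ * R) := le_mul_of_one_le_right (abs_nonneg _) h6
    have h8 : -(4 * Real.pi * (μ * R)) ≤ 2 * Real.pi * μ * s := by
      have := mul_le_mul_of_nonneg_left hs.1.le (by positivity : 0 ≤ 2 * Real.pi * μ)
      linarith
    linarith
  have hosc : (∫ x in (0 : ℝ)..(2 * Real.pi), 2 * cq δ F B s x) ≤ 2 * √(2 * Real.pi * C0) * μ := by
    rw [intervalIntegral.integral_const_mul]
    have h1 := circ_cs (hqcB s)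
    have h2 := hYB s hs0
    have h3 : (∫ x in (0 : ℝ)..(2 * Real.pi), cq δ F B s x) ^ 2 ≤ (√(2 * Real.pi * C0) * μ) ^ 2 := by
      rw [mul_pow, Real.sq_sqrt (by positivity)]
      refine h1.trans ?_
      rw [mul_assoc (2 * Real.pi)]
      exact mul_le_mul_of_nonneg_left (h2.trans hΦ's) (by positivity)
    have h4 := (abs_le_of_sq_le_sq' h3 (by positivity)).2
    linarith
  have hpt : ∀ x ∈ Icc 0 (2 * Real.pi), δ ≤ Complex.normSq (F s x) := by
    intro x hx
    set Lx := Real.log (Complex.normSq (F s x) + δ) with hLx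
    have h1 : ∀ y ∈ Icc 0 (2 * Real.pi), Real.log (Complex.normSq (F s y) + δ) ≤
        Lx + 2 * √(2 * Real.pi * C0) * μ := by
      intro y hy
      have h2 := circ_osc (hL.dx s) (hL.kB s) hy hx
      have h3 : (∫ x in (0 : ℝ)..(2 * Real.pi), ‖(Complex.normSq (F s x) + δ)⁻¹ *
        (2 * ((F s x).re * (B s x).re + (F s x).im * (B s x).im))‖) ≤
          ∫ x in (0 : ℝ)..(2 * Real.pi), 2 * cq δ F B s x := by
        refine intervalIntegral.integral_mono_on (by positivity)
          ((hL.kB s).norm.intervalIntegrable _ _)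
          (Continuous.intervalIntegrable (continuous_const.mul (hqcB s)) _ _) ?_
        intro x _
        exact cq_bd hδ s x
      have h4 := le_abs_self (Real.log (Complex.normSq (F s y) + δ) - Lx)
      rw [Real.norm_eq_abs] at h2
      linarith
    have h2 : M s ≤ ∫ x in (0 : ℝ)..(2 * Real.pi), (Lx + 2 * √(2 * Real.pi * C0) * μ) :=
      intervalIntegral.integral_mono_on (by positivity) ((hL.kF s).intervalIntegrable _ _)
        (continuous_const.intervalIntegrable _ _) h1
    rw [intervalIntegral.integral_const, smul_eq_mul, sub_zero] at h2
    have h3 : -(c * (μ * R)) ≤ Lx := by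
      have h4 : (|M0| + 4 * Real.pi + C0) = 2 * Real.pi * (c - 2 * √(2 * Real.pi * C0)) := by
        rw [hc]; field_simp; ring
      rw [h4] at hMs
      have h5 := hMs.trans h2
      have h6 : -((c - 2 * √(2 * Real.pi * C0)) * (μ * R)) ≤ Lx + 2 * √(2 * Real.pi * C0) * μ := by
        refine le_of_mul_le_mul_left ?_ (by positivity : 0 < 2 * Real.pi)
        linarith
      have h7 : 2 * √(2 * Real.pi * C0) * μ ≤ 2 * √(2 * Real.pi * C0) * (μ * R) := by
        gcongr
        nlinarith
      linarith
    have h4 : Real.log (2 * δ) ≤ Lx := by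
      rw [Real.log_mul (by norm_num) hδ.ne', hlδ]
      have h5 : Real.log 2 ≤ 1 := by have := Real.log_two_lt_d9; linarith
      have h6 : 1 ≤ μ * R := by nlinarith
      have : μ ^ 2 * R = c * (μ * R) + 2 * (μ * R) := by rw [hμ]; ring
      linarith
    have h5 := Complex.normSq_nonneg (F s x)
    have := (Real.log_le_log_iff (by positivity) (by positivity)).1 h4
    linarith
  have hfin : ∀ X : ℝ → ℝ → ℂ, Continuous (X s) →
      (∫ x in (0 : ℝ)..(2 * Real.pi), cq δ F X s x ^ 2) ≤ Φ' s →
      (∫ x in (0 : ℝ)..(2 * Real.pi), ‖X s x / F s x‖ ^ 2) ≤ 4 * (C0 * μ ^ 2) := by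
    intro X hX hY
    calc _ ≤ ∫ x in (0 : ℝ)..(2 * Real.pi), 4 * cq δ F X s x ^ 2 := by
          refine intervalIntegral.integral_mono_on (by positivity)
            (Continuous.intervalIntegrable ((hX.div (hF.cyl.kF s) (h0 s)).norm.pow 2) _ _)
            (Continuous.intervalIntegrable
              (continuous_const.mul ((cq_cont hδ (hF.cyl.kF s) hX).pow 2)) _ _) ?_
          intro x hx
          have h1 := hpt x hx
          have hF0 : 0 < ‖F s x‖ := norm_pos_iff.2 (h0 s x)
          simp only [cq]
          rw [norm_div, div_pow, div_pow, mul_pow, ← Complex.normSq_eq_norm_sq (F s x)]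
          have ht : 0 < Complex.normSq (F s x) := Complex.normSq_pos.2 (h0 s x)
          generalize Complex.normSq (F s x) = t at *
          rw [div_le_iff₀ ht]
          have : (t + δ) ^ 2 ≤ 4 * t ^ 2 := by nlinarith
          have e : 4 * (t * ‖X s x‖ ^ 2 / (t + δ) ^ 2) * t = ‖X s x‖ ^ 2 * (4 * t ^ 2 / (t + δ) ^ 2) := by
            field_simp
          rw [e]
          refine le_mul_of_one_le_right (sq_nonneg _) ?_
          rwa [one_le_div (by positivity)]
      _ = 4 * ∫ x in (0 : ℝ)..(2 * Real.pi), cq δ F X s x ^ 2 :=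
          intervalIntegral.integral_const_mul _ _
      _ ≤ _ := by linarith
  exact ⟨s, ⟨hs.1.le, hs.2.le⟩, hfin A (hF.cyl.kA s) (hYA s hs0), hfin B (hF.cyl.kB s) (hYB s hs0)⟩

end
end

section
open MeasureTheory Set
open scoped Topology NNReal

noncomputable section

lemma exp_deriv (b s : ℝ) : HasDerivAt (fun s => Real.exp (b * s)) (b * Real.exp (b * s)) s := by
  have := ((hasDerivAt_id s).const_mul b).exp
  exact this.congr_deriv (by simp [mul_comm])

lemma monoOn_of {X X' : ℝ → ℝ} (hd : ∀ s, HasDerivAt X (X' s) s) (h : ∀ s ≤ 0, 0 ≤ X' s) :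
    MonotoneOn X (Iic 0) := by
  refine monotoneOn_of_deriv_nonneg (convex_Iic 0)
    (fun s _ => (hd s).continuousAt.continuousWithinAt)
    (fun s _ => (hd s).differentiableAt.differentiableWithinAt) ?_
  intro s hs
  rw [interior_Iic] at hs
  rw [(hd s).deriv]
  exact h s (le_of_lt hs)

lemma decay {X X' : ℝ → ℝ} (hd : ∀ s, HasDerivAt X (X' s) s) (h0 : ∀ s ≤ 0, 0 ≤ X' s)
    {C c1 a m : ℝ} (hC : 0 ≤ C) (hc1 : 0 ≤ c1) (ha : 0 < a)
    (hX : ∀ s ≤ 0, |X s| ≤ C * X' s + c1 * Real.exp (a * s))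
    (hb : ∀ S, ∃ s ≤ S, m ≤ X s) :
    (∀ ε > 0, ∀ S, ∃ s ≤ S, X' s ≤ ε) ∧
    ∃ γ > 0, ∃ Z Z' : ℝ → ℝ, (∀ s, HasDerivAt Z (Z' s) s) ∧ (∀ s ≤ 0, 0 ≤ Z s) ∧
      ∀ s ≤ 0, Real.exp (-γ * s) * X' s ≤ Z' s := by
  have hmono := monoOn_of hd h0
  have hbd : ∀ s ≤ 0, m ≤ X s := by
    intro s hs
    obtain ⟨s', hs', h⟩ := hb s
    exact h.trans (hmono (hs'.trans hs) hs hs')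
  have hsm : ∀ ε > 0, ∀ S, ∃ s ≤ S, X' s ≤ ε := by
    intro ε hε S
    set b := min S 0 with hb'
    have hb0 : b ≤ 0 := min_le_right _ _
    set D := (X 0 - m) / ε + 1 with hD
    have hX0 : 0 ≤ X 0 - m := by linarith [hbd 0 le_rfl]
    have hD0 : 0 < D := by positivity
    obtain ⟨s, hs, he⟩ := exists_hasDerivAt_eq_slope X X' (a := b - D) (b := b) (by linarith)
      (fun s _ => (hd s).continuousAt.continuousWithinAt) (fun s _ => hd s)
    refine ⟨s, hs.2.le.trans (min_le_left _ _), ?_⟩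
    rw [he, div_le_iff₀ (by linarith)]
    have h1 := hbd (b - D) (by linarith)
    have h2 := hmono (show b ∈ Iic (0:ℝ) from hb0) (show (0:ℝ) ∈ Iic (0:ℝ) by simp) hb0
    have e : ε * (b - (b - D)) = X 0 - m + ε := by rw [hD]; field_simp; ring
    linarith
  have hpos : ∀ s ≤ 0, 0 ≤ X s := by
    intro s hs
    refine le_of_forall_pos_le_add fun ε hε => ?_
    have h1 : Filter.Tendsto (fun s => c1 * Real.exp (a * s)) Filter.atBot (𝓝 0) := by
      have : Filter.Tendsto (fun s : ℝ => a * s) Filter.atBot Filter.atBot :=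
        Filter.tendsto_id.const_mul_atBot ha
      simpa using (Real.tendsto_exp_atBot.comp this).const_mul c1
    have h2 := h1.eventually (gt_mem_nhds (half_pos hε))
    obtain ⟨S, hS⟩ := Filter.eventually_atBot.1 h2
    obtain ⟨s', hs', h3⟩ := hsm (ε / (2 * (C + 1))) (by positivity) (min S s)
    have h4 := hS s' (hs'.trans (min_le_left _ _))
    have h5 := hs'.trans (min_le_right _ _)
    have h6 := hX s' (h5.trans hs)
    have h7 := neg_abs_le (X s')
    have h8 := hmono (h5.trans hs) hs h5
    have h9 : C * X' s' ≤ ε / 2 := by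
      calc C * X' s' ≤ (C + 1) * (ε / (2 * (C + 1))) := by
            gcongr
            · exact h0 s' (h5.trans hs)
            · linarith
        _ = ε / 2 := by field_simp
    linarith
  refine ⟨hsm, ?_⟩
  set C2 := C + 2 / a with hC2
  have hC2p : 0 < C2 := by positivity
  set β := 1 / C2 with hβ
  have hβp : 0 < β := by positivity
  have hβa : β < a := by
    rw [hβ, div_lt_iff₀ hC2p, hC2, mul_add]
    have : a * (2 / a) = 2 := by field_simp
    nlinarith [mul_nonneg ha.le hC]
  set c2 := c1 * β / (a - β) with hc2
  have hc2n : 0 ≤ c2 := div_nonneg (by positivity) (by linarith)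
  have hd2 : ∀ s, HasDerivAt (fun s => X s * Real.exp (-β * s) + c2 * Real.exp ((a - β) * s))
      (X' s * Real.exp (-β * s) + X s * (-β * Real.exp (-β * s)) +
        c2 * ((a - β) * Real.exp ((a - β) * s))) s := fun s =>
    ((hd s).mul (exp_deriv (-β) s)).add ((exp_deriv (a - β) s).const_mul c2)
  have hmono2 := monoOn_of hd2 (by
    intro s hs
    have h1 := hX s hs
    have h2 := le_abs_self (X s)
    have h3 := h0 s hs
    have e1 : c2 * ((a - β) * Real.exp ((a - β) * s)) =
        c1 * β * (Real.exp (a * s) * Real.exp (-β * s)) := by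
      rw [hc2, ← Real.exp_add]
      have : a - β ≠ 0 := by linarith
      field_simp
      congr 2; ring_nf
    rw [e1]
    have h4 : X s ≤ C2 * X' s + c1 * Real.exp (a * s) := by
      have : 0 ≤ 2 / a * X' s := by positivity
      rw [hC2]; linarith
    have h5 : β * X s ≤ X' s + c1 * β * Real.exp (a * s) := by
      have := mul_le_mul_of_nonneg_left h4 hβp.le
      have e : β * C2 = 1 := by rw [hβ]; field_simp
      calc _ ≤ _ := this
        _ = (β * C2) * X' s + c1 * β * Real.exp (a * s) := by ring
        _ = _ := by rw [e, one_mul]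
    have h6 := mul_le_mul_of_nonneg_right h5 (Real.exp_pos (-β * s)).le
    linarith)
  set C' := X 0 + c2 with hC'
  have hC'n : 0 ≤ C' := add_nonneg (hpos 0 le_rfl) hc2n
  have hup : ∀ s ≤ 0, X s * Real.exp (-β * s) ≤ C' := by
    intro s hs
    have h1 := hmono2 (show s ∈ Iic (0:ℝ) from hs) (show (0:ℝ) ∈ Iic (0:ℝ) by simp) hs
    simp only [mul_zero, Real.exp_zero, mul_one] at h1
    have : 0 ≤ c2 * Real.exp ((a - β) * s) := by positivity
    linarith
  refine ⟨β / 2, by positivity, fun s => X s * Real.exp (-(β / 2) * s) + C' * Real.exp (β / 2 * s), _,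
    fun s => ((hd s).mul (exp_deriv (-(β / 2)) s)).add ((exp_deriv (β / 2) s).const_mul C'), ?_, ?_⟩
  · intro s hs
    have := hpos s hs
    positivity
  · intro s hs
    have h1 := hup s hs
    have e : Real.exp (-β * s) * Real.exp (β / 2 * s) = Real.exp (-(β / 2) * s) := by
      rw [← Real.exp_add]; congr 1; ring
    have h2 := mul_le_mul_of_nonneg_right h1 (Real.exp_pos (β / 2 * s)).le
    rw [mul_assoc, e] at h2
    have h3 := mul_le_mul_of_nonneg_left h2 (half_pos hβp).le
    linarith

variable {W P Q : ℝ → ℝ → ℂ}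

def cE (P Q : ℝ → ℝ → ℂ) (s : ℝ) : ℝ := ∫ x in (0 : ℝ)..(2 * Real.pi), (‖P s x‖ ^ 2 + ‖Q s x‖ ^ 2)

lemma circ_Q (hW : Cyl W P Q) (s : ℝ) :
    (∫ x in (0 : ℝ)..(2 * Real.pi), ‖Q s x‖) ^ 2 ≤ 2 * Real.pi * cE P Q s := by
  have hpi := Real.pi_pos
  refine (circ_cs (hW.kB s).norm).trans (mul_le_mul_of_nonneg_left ?_ (by positivity))
  refine intervalIntegral.integral_mono_on (by positivity)
    (Continuous.intervalIntegrable ((hW.kB s).norm.pow 2) _ _)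
    (Continuous.intervalIntegrable (((hW.kA s).norm.pow 2).add ((hW.kB s).norm.pow 2)) _ _) ?_
  intro x _
  linarith [sq_nonneg ‖P s x‖]

lemma phi_one_deriv (hW : Cyl W P Q) (s : ℝ) : HasDerivAt (cPhi (fun _ => 1) W Q)
    (2 * ∫ x in (0 : ℝ)..(2 * Real.pi), cJ (P s x) (Q s x)) s := by
  have h := cPhi_deriv hW (T := univ) (h := fun _ => 1) (h' := fun _ => 0) (fun _ _ => trivial)
    (fun y _ => hasDerivAt_const y 1) continuousOn_const s
  refine h.congr_deriv ?_
  rw [← intervalIntegral.integral_const_mul]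
  simp

lemma phi_one_bd (hW : Cyl W P Q) (s : ℝ) : |cPhi (fun _ => 1) W Q s| ≤ 2 * Real.pi * cE P Q s := by
  have hpi := Real.pi_pos
  have hQ0 : ∫ x in (0 : ℝ)..(2 * Real.pi), Q s x = 0 := by
    rw [intervalIntegral.integral_eq_sub_of_hasDerivAt (fun x _ => hW.dx s x)
      ((hW.kB s).intervalIntegrable _ _)]
    have := hW.per s 0
    rw [zero_add] at this
    rw [this, sub_self]
  have hre : ∫ x in (0 : ℝ)..(2 * Real.pi), (Q s x).re = 0 := by
    have := Complex.reCLM.intervalIntegral_comp_comm ((hW.kB s).intervalIntegrable (μ := volume) 0 (2 * Real.pi))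
    rw [hQ0] at this
    simpa using this
  have him : ∫ x in (0 : ℝ)..(2 * Real.pi), (Q s x).im = 0 := by
    have := Complex.imCLM.intervalIntegral_comp_comm ((hW.kB s).intervalIntegrable (μ := volume) 0 (2 * Real.pi))
    rw [hQ0] at this
    simpa using this
  set w0 := W s 0 with hw0
  set I := ∫ x in (0 : ℝ)..(2 * Real.pi), ‖Q s x‖ with hI
  have c1 : Continuous fun x => (Q s x).re := (cyl_re hW).kB s
  have c2 : Continuous fun x => (Q s x).im := (cyl_im hW).kB s
  have c3 : Continuous fun x => (W s x).re := (cyl_re hW).kF s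
  have c4 : Continuous fun x => (W s x).im := (cyl_im hW).kF s
  have e : cPhi (fun _ => 1) W Q s = ∫ x in (0 : ℝ)..(2 * Real.pi), cJ (W s x - w0) (Q s x) := by
    have e1 : ∀ x, cJ (W s x - w0) (Q s x) = 1 * cJ (W s x) (Q s x) -
        (w0.re * (Q s x).im - w0.im * (Q s x).re) := by
      intro x; simp only [cJ, Complex.sub_re, Complex.sub_im]; ring
    simp only [e1]
    rw [intervalIntegral.integral_sub, intervalIntegral.integral_sub,
      intervalIntegral.integral_const_mul w0.re, intervalIntegral.integral_const_mul w0.im, hre, him, cPhi]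
    · simp
    · exact (continuous_const.mul c2).intervalIntegrable _ _
    · exact (continuous_const.mul c1).intervalIntegrable _ _
    · exact Continuous.intervalIntegrable (by simp only [cJ]; fun_prop) _ _
    · exact Continuous.intervalIntegrable (by fun_prop) _ _
  rw [e]
  refine le_trans ?_ (circ_Q hW s)
  rw [← hI, ← Real.norm_eq_abs]
  refine (intervalIntegral.norm_integral_le_integral_norm (by positivity)).trans ?_
  rw [sq]
  calc _ ≤ ∫ x in (0 : ℝ)..(2 * Real.pi), I * ‖Q s x‖ := by
        refine intervalIntegral.integral_mono_on (by positivity)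
          (Continuous.intervalIntegrable (by simp only [cJ, Complex.sub_re, Complex.sub_im]; fun_prop) _ _)
          (Continuous.intervalIntegrable (continuous_const.mul (hW.kB s).norm) _ _) ?_
        intro x hx
        refine (cJ_abs _ _).trans (mul_le_mul_of_nonneg_right ?_ (norm_nonneg _))
        exact circ_osc (hW.dx s) (hW.kB s) hx ⟨le_rfl, by positivity⟩
    _ = _ := by rw [intervalIntegral.integral_const_mul]

end
end

section
open MeasureTheory Set
open scoped Topology NNReal

noncomputable section

variable {W P Q : ℝ → ℝ → ℂ}

lemma Cyl.energy (hW : Cyl W P Q) {a c K : ℝ} (ha : 0 < a) (hc : 0 ≤ c)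
    (h : ∀ s ≤ 0, ∀ x, ‖P s x‖ ^ 2 + ‖Q s x‖ ^ 2 ≤ 8 / 3 * cJ (P s x) (Q s x) + c * Real.exp (a * s))
    (hg : ∀ S, ∃ s ≤ S, cE P Q s ≤ K) :
    (∀ ε > 0, ∀ S, ∃ s ≤ S, cE P Q s ≤ ε) ∧
    ∃ γ > 0, ∃ Z Z' : ℝ → ℝ, (∀ s, HasDerivAt Z (Z' s) s) ∧ (∀ s ≤ 0, 0 ≤ Z s) ∧
      ∀ s ≤ 0, Real.exp (-γ * s) * cE P Q s ≤ Z' s := by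
  have hpi := Real.pi_pos
  have hE0 : ∀ s, 0 ≤ cE P Q s := fun s =>
    intervalIntegral.integral_nonneg (by positivity) (fun x _ => by positivity)
  set X := fun s => 4 / 3 * cPhi (fun _ => 1) W Q s + 2 * Real.pi * c / a * Real.exp (a * s) with hX
  set X' := fun s => 8 / 3 * (∫ x in (0 : ℝ)..(2 * Real.pi), cJ (P s x) (Q s x)) +
    2 * Real.pi * (c * Real.exp (a * s)) with hX'
  have hd : ∀ s, HasDerivAt X (X' s) s := fun s => by
    refine (((phi_one_deriv hW s).const_mul (4 / 3)).add
      ((exp_deriv a s).const_mul (2 * Real.pi * c / a))).congr_deriv ?_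
    simp only [hX']
    field_simp
    ring
  have hEX : ∀ s ≤ 0, cE P Q s ≤ X' s := by
    intro s hs
    have cj : Continuous fun x => cJ (P s x) (Q s x) :=
      (((cyl_re hW).kA s).mul ((cyl_im hW).kB s)).sub (((cyl_im hW).kA s).mul ((cyl_re hW).kB s))
    calc cE P Q s ≤ ∫ x in (0 : ℝ)..(2 * Real.pi),
          (8 / 3 * cJ (P s x) (Q s x) + c * Real.exp (a * s)) := by
          refine intervalIntegral.integral_mono_on (by positivity)
            (Continuous.intervalIntegrable (((hW.kA s).norm.pow 2).add ((hW.kB s).norm.pow 2)) _ _)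
            (Continuous.intervalIntegrable (by fun_prop) _ _) (fun x _ => h s hs x)
      _ = X' s := by
          rw [intervalIntegral.integral_add (Continuous.intervalIntegrable (by fun_prop) _ _)
            (continuous_const.intervalIntegrable _ _), intervalIntegral.integral_const_mul,
            intervalIntegral.integral_const]
          simp [hX']
  have hXE : ∀ s, |X s| ≤ 8 / 3 * Real.pi * cE P Q s + 2 * Real.pi * c / a * Real.exp (a * s) := by
    intro s
    have h1 := phi_one_bd hW s
    have h2 : 0 ≤ 2 * Real.pi * c / a * Real.exp (a * s) := by positivity
    calc |X s| ≤ |4 / 3 * cPhi (fun _ => 1) W Q s| + |2 * Real.pi * c / a * Real.exp (a * s)| :=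
          abs_add_le _ _
      _ ≤ _ := by
          rw [abs_of_nonneg h2, abs_mul, abs_of_nonneg (by norm_num : (0:ℝ) ≤ 4 / 3)]
          linarith
  obtain ⟨h1, γ, hγ, Z, Z', h2, h3, h4⟩ := decay hd (fun s hs => (hE0 s).trans (hEX s hs))
    (C := 8 / 3 * Real.pi) (c1 := 2 * Real.pi * c / a) (a := a)
    (m := -(8 / 3 * Real.pi * K + 2 * Real.pi * c / a)) (by positivity) (by positivity) ha
    (fun s hs => (hXE s).trans (by
      have := mul_le_mul_of_nonneg_left (hEX s hs) (by positivity : 0 ≤ 8 / 3 * Real.pi)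
      linarith))
    (by
      intro S
      obtain ⟨s, hs, hK⟩ := hg (min S 0)
      refine ⟨s, hs.trans (min_le_left _ _), ?_⟩
      have h1 := hXE s
      have h2 := neg_abs_le (X s)
      have h3 := mul_le_mul_of_nonneg_left hK (by positivity : 0 ≤ 8 / 3 * Real.pi)
      have h4 : Real.exp (a * s) ≤ 1 := by
        rw [Real.exp_le_one_iff]
        exact mul_nonpos_of_nonneg_of_nonpos ha.le (hs.trans (min_le_right _ _))
      have h5 := mul_le_mul_of_nonneg_left h4 (by positivity : 0 ≤ 2 * Real.pi * c / a)
      linarith)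
  refine ⟨?_, γ, hγ, Z, Z', h2, h3, ?_⟩
  · intro ε hε S
    obtain ⟨s, hs, h⟩ := h1 ε hε (min S 0)
    exact ⟨s, hs.trans (min_le_left _ _), (hEX s (hs.trans (min_le_right _ _))).trans h⟩
  · intro s hs
    exact le_trans (mul_le_mul_of_nonneg_left (hEX s hs) (Real.exp_pos _).le) (h4 s hs)

lemma Cyl.limit (hW : Cyl W P Q) {a c K : ℝ} (ha : 0 < a) (hc : 0 ≤ c)
    (h : ∀ s ≤ 0, ∀ x, ‖P s x‖ ^ 2 + ‖Q s x‖ ^ 2 ≤ 8 / 3 * cJ (P s x) (Q s x) + c * Real.exp (a * s))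
    (hg : ∀ S, ∃ s ≤ S, cE P Q s ≤ K) :
    ∃ w, ∀ᵐ x ∂(volume.restrict (Ioc 0 (2 * Real.pi))),
      Filter.Tendsto (fun s => W s x) Filter.atBot (𝓝 w) := by
  have hpi := Real.pi_pos
  obtain ⟨h1, γ, hγ, Z, Z', hZ, hZ0, hZE⟩ := hW.energy ha hc h hg
  set g := fun s => ∫ x in (0 : ℝ)..(2 * Real.pi), ‖P s x‖ with hgd
  have cP : Continuous fun p : ℝ × ℝ => ‖P p.1 p.2‖ := hW.cA.norm
  have cg : Continuous g := cyl_cont_int (F := fun s x => ‖P s x‖) cP _ _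
  have g0 : ∀ s, 0 ≤ g s := fun s =>
    intervalIntegral.integral_nonneg (by positivity) (fun x _ => norm_nonneg _)
  have hgZ : ∀ s ≤ 0, g s ≤ Real.pi * Real.exp (γ * s) + Z' s / 2 := by
    intro s hs
    have h2 := hZE s hs
    calc g s ≤ ∫ x in (0 : ℝ)..(2 * Real.pi), (Real.exp (γ * s) / 2 +
          Real.exp (-γ * s) / 2 * (‖P s x‖ ^ 2 + ‖Q s x‖ ^ 2)) := by
          refine intervalIntegral.integral_mono_on (by positivity)
            ((hW.kA s).norm.intervalIntegrable _ _)
            (Continuous.intervalIntegrable (continuous_const.add (continuous_const.mul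
              (((hW.kA s).norm.pow 2).add ((hW.kB s).norm.pow 2)))) _ _) ?_
          intro x _
          have e1 : Real.exp (γ * s) * Real.exp (-γ * s) = 1 := by
            rw [← Real.exp_add]; simp
          have e2 := Real.exp_pos (γ * s)
          have e3 := Real.exp_pos (-γ * s)
          set y := Real.exp (-γ * s)
          set z := Real.exp (γ * s)
          have : 0 ≤ z * (1 - y * ‖P s x‖) ^ 2 := by positivity
          have e4 : z * (1 - y * ‖P s x‖) ^ 2 = z - 2 * (z * y) * ‖P s x‖ + (z * y) * y * ‖P s x‖ ^ 2 := by
            ring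
          rw [e4, e1] at this
          have e5 : 0 ≤ y * ‖Q s x‖ ^ 2 := by positivity
          linarith
      _ = Real.pi * Real.exp (γ * s) + Real.exp (-γ * s) / 2 * cE P Q s := by
          rw [intervalIntegral.integral_add (continuous_const.intervalIntegrable _ _)
            ((by exact continuous_const.mul (((hW.kA s).norm.pow 2).add ((hW.kB s).norm.pow 2)) :
              Continuous fun x => Real.exp (-γ * s) / 2 *
                (‖P s x‖ ^ 2 + ‖Q s x‖ ^ 2)).intervalIntegrable _ _),
            intervalIntegral.integral_const, intervalIntegral.integral_const_mul]
          simp [cE]; ring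
      _ ≤ _ := by linarith
  set Y := fun s => Real.pi / γ * Real.exp (γ * s) + Z s / 2 with hY
  have hYd : ∀ s, HasDerivAt (fun s => Y s - ∫ r in (0:ℝ)..s, g r)
      (Real.pi / γ * (γ * Real.exp (γ * s)) + Z' s / 2 - g s) s := fun s =>
    (((exp_deriv γ s).const_mul _).add ((hZ s).div_const 2)).sub
      (intervalIntegral.integral_hasDerivAt_right (cg.intervalIntegrable _ _)
      (cg.stronglyMeasurableAtFilter _ _) cg.continuousAt)
  have hYm := monoOn_of hYd (by
    intro s hs
    have := hgZ s hs
    have e : Real.pi / γ * (γ * Real.exp (γ * s)) = Real.pi * Real.exp (γ * s) := by field_simp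
    rw [e]; linarith)
  have hgI : IntegrableOn g (Iic 0) := by
    refine integrableOn_Iic_of_intervalIntegral_norm_bounded (l := Filter.atBot) (a := fun i : ℝ => i)
      (Y 0) 0 (fun i => cg.integrableOn_Ioc) Filter.tendsto_id ?_
    filter_upwards [Filter.eventually_le_atBot 0] with S hS
    have h2 := hYm (show S ∈ Iic (0:ℝ) from hS) (show (0:ℝ) ∈ Iic (0:ℝ) by simp) hS
    simp only [intervalIntegral.integral_same, sub_zero] at h2
    rw [intervalIntegral.integral_symm] at h2
    have h3 : 0 ≤ Y S := by
      have := hZ0 S hS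
      positivity
    simp only [Real.norm_eq_abs, abs_of_nonneg (g0 _)]
    linarith
  have hprod : Integrable (fun p : ℝ × ℝ => P p.1 p.2)
      ((volume.restrict (Iic 0)).prod (volume.restrict (Ioc 0 (2 * Real.pi)))) := by
    rw [integrable_prod_iff hW.cA.aestronglyMeasurable]
    refine ⟨Filter.Eventually.of_forall fun s => (hW.kA s).integrableOn_Ioc, ?_⟩
    refine hgI.congr (Filter.Eventually.of_forall fun s => ?_)
    simp only [hgd]
    rw [intervalIntegral.integral_of_le (by positivity)]
  have hae := hprod.prod_left_ae
  have hlim : ∀ᵐ x ∂(volume.restrict (Ioc 0 (2 * Real.pi))), x ∈ Ioc 0 (2 * Real.pi) ∧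
      ∃ w, Filter.Tendsto (fun s => W s x) Filter.atBot (𝓝 w) := by
    filter_upwards [hae, ae_restrict_mem measurableSet_Ioc] with x hx hx2
    exact ⟨hx2, _, tendsto_limUnder_of_hasDerivAt_of_integrableOn_Iic (a := 0)
      (fun s _ => hW.ds s x) hx⟩
  have hne : (ae (volume.restrict (Ioc 0 (2 * Real.pi)))).NeBot := by
    rw [ae_neBot]
    intro h0
    have := congrArg (fun μ => μ univ) h0
    simp at this
    linarith
  obtain ⟨x0, hx0, w, hw⟩ := hlim.exists
  refine ⟨w, ?_⟩
  filter_upwards [hlim] with x hx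
  obtain ⟨hx, w', hw'⟩ := hx
  suffices w' = w by rwa [this] at hw'
  have h2 : Filter.Tendsto (fun s => ‖W s x - W s x0‖) Filter.atBot (𝓝 ‖w' - w‖) := (hw'.sub hw).norm
  rw [← sub_eq_zero, ← norm_eq_zero]
  by_contra hcon
  have hp : 0 < ‖w' - w‖ := lt_of_le_of_ne (norm_nonneg _) (Ne.symm hcon)
  set ε := ‖w' - w‖ / 2 with hε
  have h3 := h2.eventually (lt_mem_nhds (show ε < ‖w' - w‖ by linarith))
  obtain ⟨S, hS⟩ := Filter.eventually_atBot.1 h3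
  obtain ⟨s, hs, he⟩ := h1 (ε ^ 2 / (2 * Real.pi)) (by positivity) S
  have h4 := hS s hs
  have h5 := circ_osc (hW.dx s) (hW.kB s) (Ioc_subset_Icc_self hx) (Ioc_subset_Icc_self hx0)
  have h6 := circ_Q hW s
  have h7 : 2 * Real.pi * cE P Q s ≤ ε ^ 2 := by
    calc _ ≤ 2 * Real.pi * (ε ^ 2 / (2 * Real.pi)) := by gcongr
      _ = ε ^ 2 := by field_simp
  have h8 := (abs_le_of_sq_le_sq' (h6.trans h7) (by positivity)).2
  linarith

end
end

section
open MeasureTheory Set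
open scoped Topology NNReal

noncomputable section

variable {F A B : ℝ → ℝ → ℂ}

lemma pq_id (P Q : ℂ) : ‖P‖ ^ 2 + ‖Q‖ ^ 2 = 2 * cJ P Q + ‖P + Complex.I * Q‖ ^ 2 := by
  simp only [← Complex.normSq_eq_norm_sq, Complex.normSq_apply, cJ]
  simp; ring

lemma pq_le (P Q : ℂ) : ‖P - Complex.I * Q‖ ^ 2 ≤ 2 * (‖P‖ ^ 2 + ‖Q‖ ^ 2) := by
  have h1 := norm_sub_le P (Complex.I * Q)
  rw [norm_mul, Complex.norm_I, one_mul] at h1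
  nlinarith [sq_nonneg (‖P‖ - ‖Q‖), norm_nonneg (P - Complex.I * Q), norm_nonneg P, norm_nonneg Q]

lemma pq_elem {A B : ℂ} (h : ‖A + Complex.I * B‖ ≤ 1 / 4 * ‖A - Complex.I * B‖) :
    ‖A‖ ^ 2 ≤ 2 * cJ A B ∧ ‖B‖ ^ 2 ≤ 2 * cJ A B := by
  have h1 := pq_id A B
  set p := A - Complex.I * B with hp
  set q := A + Complex.I * B with hq
  have eA : A = (p + q) / 2 := by rw [hp, hq]; ring
  have eB : B = Complex.I * (p - q) / 2 := by
    rw [hp, hq]; ring_nf; rw [Complex.I_sq]; ring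
  have hA : ‖A‖ ≤ 5 / 8 * ‖p‖ := by
    rw [eA, norm_div, Complex.norm_two]
    have := norm_add_le p q
    linarith
  have hB : ‖B‖ ≤ 5 / 8 * ‖p‖ := by
    rw [eB, norm_div, Complex.norm_two, norm_mul, Complex.norm_I, one_mul]
    have := norm_sub_le p q
    linarith
  have hJ : 2 * cJ A B = (‖p‖ ^ 2 - ‖q‖ ^ 2) / 2 := by
    simp only [hp, hq, ← Complex.normSq_eq_norm_sq, Complex.normSq_apply, cJ]
    simp; ring
  rw [hJ]
  have h3 := norm_nonneg q
  have h4 := norm_nonneg A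
  have h5 := norm_nonneg B
  constructor <;> nlinarith

lemma QR.expand (hF : QR F A B) (h0 : ∀ s x, F s x ≠ 0) {α : ℝ} (hα : 0 < α)
    (hq : ∀ s ≤ 0, ∀ x, ‖A s x + Complex.I * B s x‖ ≤
      1 / 4 * Real.exp (α * s) * ‖A s x - Complex.I * B s x‖) :
    ∃ (n : ℤ) (w : ℂ), ∀ᵐ x ∂(volume.restrict (Ioc 0 (2 * Real.pi))),
      Filter.Tendsto (fun s : ℝ => F s x * Complex.exp (-(n * (s + x * Complex.I)))) Filter.atBot
        (𝓝 (Complex.exp w)) := by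
  have hpi := Real.pi_pos
  obtain ⟨n, W, hW, hFW⟩ := hF.cyl.lift h0
  obtain ⟨K, hK⟩ := hF.good h0
  obtain ⟨w, hw⟩ := hW.limit (a := 2 * α) (c := 2 / 3 * n ^ 2)
    (K := 4 * K + 8 * Real.pi * n ^ 2) (by positivity) (by positivity) (by
    intro s hs x
    set P := A s x / F s x - n with hP
    set Q := B s x / F s x - n * Complex.I with hQ
    have h1 := pq_id P Q
    have h2 := pq_le P Q
    have e1 : P + Complex.I * Q = (A s x + Complex.I * B s x) / F s x := by
      rw [hP, hQ]; ring_nf; rw [Complex.I_sq]; ring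
    have e2 : (A s x - Complex.I * B s x) / F s x = P - Complex.I * Q + 2 * n := by
      rw [hP, hQ]; ring_nf; rw [Complex.I_sq]; ring
    have hE : 0 < Real.exp (α * s) := Real.exp_pos _
    have hE1 : Real.exp (α * s) ≤ 1 := by
      rw [Real.exp_le_one_iff]; exact mul_nonpos_of_nonneg_of_nonpos hα.le hs
    have h3 : ‖P + Complex.I * Q‖ ≤ 1 / 4 * Real.exp (α * s) * (‖P - Complex.I * Q‖ + 2 * |(n:ℝ)|) := by
      rw [e1, norm_div, div_le_iff₀ (norm_pos_iff.2 (h0 s x))]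
      refine (hq s hs x).trans ?_
      rw [mul_assoc (1 / 4 * Real.exp (α * s))]
      refine mul_le_mul_of_nonneg_left ?_ (by positivity)
      rw [← div_le_iff₀ (norm_pos_iff.2 (h0 s x)), ← norm_div, e2]
      refine (norm_add_le _ _).trans ?_
      simp
    have h4 : Real.exp (2 * α * s) = Real.exp (α * s) ^ 2 := by
      rw [sq, ← Real.exp_add]; congr 1; ring
    rw [h4]
    set E := Real.exp (α * s) with hEd
    set p := ‖P - Complex.I * Q‖ with hp
    have hp0 : 0 ≤ p := norm_nonneg _
    have h5 : ‖P + Complex.I * Q‖ ^ 2 ≤ 1 / 8 * p ^ 2 + 1 / 2 * (n:ℝ) ^ 2 * E ^ 2 := by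
      have h6 : ‖P + Complex.I * Q‖ ^ 2 ≤ (1 / 4 * E * (p + 2 * |(n:ℝ)|)) ^ 2 :=
        pow_le_pow_left₀ (norm_nonneg _) h3 2
      have h7 : (1 / 4 * E * (p + 2 * |(n:ℝ)|)) ^ 2 ≤ 1 / 8 * E ^ 2 * (p ^ 2 + 4 * (n:ℝ) ^ 2) := by
        rw [← sq_abs (n:ℝ)]
        have : 0 ≤ E ^ 2 * (p - 2 * |(n:ℝ)|) ^ 2 := by positivity
        nlinarith
      have h8 : E ^ 2 * p ^ 2 ≤ 1 * p ^ 2 :=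
        mul_le_mul_of_nonneg_right (pow_le_one₀ hE.le hE1) (sq_nonneg p)
      linarith
    linarith) (by
    intro S
    obtain ⟨s, hs, hA, hB⟩ := hK (max 1 (-S)) (le_max_left _ _)
    refine ⟨s, by linarith [hs.2, le_max_right 1 (-S)], ?_⟩
    have cA := (hF.cyl.kA s).div (hF.cyl.kF s) (h0 s)
    have cB := (hF.cyl.kB s).div (hF.cyl.kF s) (h0 s)
    have c1 : Continuous fun x => 2 * ‖A s x / F s x‖ ^ 2 := continuous_const.mul (cA.norm.pow 2)
    have c2 : Continuous fun x => 2 * ‖B s x / F s x‖ ^ 2 := continuous_const.mul (cB.norm.pow 2)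
    calc cE (fun s x => A s x / F s x - n) (fun s x => B s x / F s x - n * Complex.I) s
        ≤ ∫ x in (0 : ℝ)..(2 * Real.pi), (2 * ‖A s x / F s x‖ ^ 2 + 2 * ‖B s x / F s x‖ ^ 2 +
          4 * (n:ℝ) ^ 2) := by
          refine intervalIntegral.integral_mono_on (by positivity)
            (Continuous.intervalIntegrable (((hW.kA s).norm.pow 2).add ((hW.kB s).norm.pow 2)) _ _)
            (Continuous.intervalIntegrable ((c1.add c2).add continuous_const) _ _) ?_
          intro x _
          have hh : ∀ z c : ℂ, ‖c‖ = |(n:ℝ)| → ‖z - c‖ ^ 2 ≤ 2 * ‖z‖ ^ 2 + 2 * (n:ℝ) ^ 2 := by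
            intro z c hc
            have h1 := norm_sub_le z c
            have h2 : ‖z - c‖ ^ 2 ≤ (‖z‖ + ‖c‖) ^ 2 := pow_le_pow_left₀ (norm_nonneg _) h1 2
            rw [hc] at h2
            rw [← sq_abs (n:ℝ)]
            nlinarith [sq_nonneg (‖z‖ - |(n:ℝ)|)]
          have h1 := hh (A s x / F s x) n (by simp)
          have h2 := hh (B s x / F s x) (n * Complex.I) (by simp)
          linarith
      _ = 2 * (∫ x in (0 : ℝ)..(2 * Real.pi), ‖A s x / F s x‖ ^ 2) +
          2 * (∫ x in (0 : ℝ)..(2 * Real.pi), ‖B s x / F s x‖ ^ 2) + 8 * Real.pi * (n:ℝ) ^ 2 := by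
          rw [intervalIntegral.integral_add ((by exact c1.add c2 : Continuous fun x =>
              2 * ‖A s x / F s x‖ ^ 2 + 2 * ‖B s x / F s x‖ ^ 2).intervalIntegrable _ _)
            (continuous_const.intervalIntegrable _ _),
            intervalIntegral.integral_add (c1.intervalIntegrable _ _) (c2.intervalIntegrable _ _),
            intervalIntegral.integral_const_mul, intervalIntegral.integral_const_mul,
            intervalIntegral.integral_const, smul_eq_mul]
          ring
      _ ≤ _ := by linarith)
  refine ⟨n, w, ?_⟩
  filter_upwards [hw] with x hx
  have h1 := (Complex.continuous_exp.tendsto w).comp hx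
  refine h1.congr fun s => ?_
  simp only [Function.comp]
  rw [hFW s x, ← Complex.exp_add]
  congr 1; ring

end
end

section
open MeasureTheory Set
open scoped Topology NNReal

noncomputable section

def cRho (R T s : ℝ) : ℝ := R / (1 + Real.exp (T - s))

def cKap (T s : ℝ) : ℝ := 1 / (1 + Real.exp (s - T))

lemma cRho_pos {R : ℝ} (hR : 0 < R) (T s : ℝ) : 0 < cRho R T s := by
  have := Real.exp_pos (T - s); unfold cRho; positivity

lemma cRho_lt {R : ℝ} (hR : 0 < R) (T s : ℝ) : cRho R T s < R := by
  have := Real.exp_pos (T - s)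
  unfold cRho
  rw [div_lt_iff₀ (by positivity)]
  nlinarith

lemma cRho_le {R : ℝ} (hR : 0 < R) (T s : ℝ) : cRho R T s ≤ R * Real.exp (s - T) := by
  have := Real.exp_pos (T - s)
  have h2 : Real.exp (s - T) * Real.exp (T - s) = 1 := by rw [← Real.exp_add]; simp
  unfold cRho
  rw [div_le_iff₀ (by positivity), mul_assoc, mul_add, h2]
  have := Real.exp_pos (s - T)
  nlinarith

lemma cRho_deriv (R T s : ℝ) : HasDerivAt (cRho R T) (cRho R T s * cKap T s) s := by
  have h1 : HasDerivAt (fun s => T - s) (-1) s := by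
    simpa using (hasDerivAt_id s).const_sub T
  have h2 : HasDerivAt (fun s => 1 + Real.exp (T - s)) _ s := (h1.exp).const_add 1
  have h3 := Real.exp_pos (T - s)
  refine ((hasDerivAt_const s R).div h2 (by positivity)).congr_deriv ?_
  unfold cRho cKap
  have e : Real.exp (s - T) = (Real.exp (T - s))⁻¹ := by rw [← Real.exp_neg]; congr 1; ring
  rw [e]
  field_simp
  ring

lemma cRho_surj {R r : ℝ} (hr : 0 < r) (hrR : r < R) (T : ℝ) :
    cRho R T (T - Real.log (R / r - 1)) = r := by
  have : 0 < R / r - 1 := by rw [sub_pos, lt_div_iff₀ hr]; linarith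
  unfold cRho
  rw [sub_sub_cancel, Real.exp_log this]
  have h0 : R ≠ 0 := by linarith
  have h1 : 1 + (R / r - 1) = R / r := by ring
  rw [h1, div_div_cancel₀ h0]

lemma cRho_mono {R : ℝ} (hR : 0 < R) (T : ℝ) {s t : ℝ} (h : s ≤ t) : cRho R T s ≤ cRho R T t := by
  unfold cRho
  have := Real.exp_pos (T - s)
  have := Real.exp_pos (T - t)
  gcongr

def cZ (R T s x : ℝ) : ℂ := cRho R T s * Complex.exp (x * Complex.I)

lemma cZ_norm {R : ℝ} (hR : 0 < R) (T s x : ℝ) : ‖cZ R T s x‖ = cRho R T s := by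
  unfold cZ
  rw [norm_mul, Complex.norm_exp_ofReal_mul_I, mul_one, Complex.norm_real, Real.norm_eq_abs,
    abs_of_pos (cRho_pos hR T s)]

structure LocQC (f : ℂ → ℂ) (f' : ℂ → ℂ →L[ℝ] ℂ) (C α R : ℝ) : Prop where
  hR : 0 < R
  hα : 0 < α
  hα1 : α ≤ 1
  hC : 0 ≤ C
  hd : ∀ z ∈ Metric.ball (0:ℂ) R, HasFDerivAt f (f' z) z
  hc : ContinuousOn f' (Metric.ball (0:ℂ) R)
  hb : ∀ z ∈ Metric.ball (0:ℂ) R, ‖f' z 1 + Complex.I * f' z Complex.I‖ ≤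
    C * ‖z‖ ^ α * ‖f' z 1 - Complex.I * f' z Complex.I‖
  h0 : f 0 = 0
  hf : ∀ z ∈ Metric.ball (0:ℂ) R, ‖f z‖ ≤ 1 / 2
  hf' : ∀ z ∈ Metric.ball (0:ℂ) R, ‖f' z‖ ≤ 1

lemma rlin (L : ℂ →L[ℝ] ℂ) (v : ℂ) : L v = (L 1 - Complex.I * L Complex.I) / 2 * v +
    (L 1 + Complex.I * L Complex.I) / 2 * (starRingEnd ℂ) v := by
  have h1 : L v = v.re * L 1 + v.im * L Complex.I := by
    conv_lhs => rw [← Complex.re_add_im v]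
    rw [map_add]
    have e1 : ((v.re : ℝ) : ℂ) = v.re • (1:ℂ) := by simp
    have e2 : ((v.im : ℝ) : ℂ) * Complex.I = v.im • Complex.I := by simp
    rw [e2, map_smul]
    conv_lhs => rw [e1]
    rw [map_smul]
    simp
  rw [h1]
  have h2 : (starRingEnd ℂ) v = v.re - v.im * Complex.I := by
    apply Complex.ext <;> simp
  rw [h2]
  conv_rhs => rw [← Complex.re_add_im v]
  simp only [Complex.add_re, Complex.ofReal_re, Complex.mul_re, Complex.I_re, Complex.ofReal_im,
    Complex.I_im, Complex.add_im, Complex.mul_im]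
  push_cast
  ring_nf
  rw [Complex.I_sq]
  ring

lemma cylQR {f : ℂ → ℂ} {f' : ℂ → ℂ →L[ℝ] ℂ} {C α R : ℝ} (h : LocQC f f' C α R) :
    ∃ T A B, QR (fun s x => f (cZ R T s x)) A B ∧
      ∀ s ≤ 0, ∀ x, ‖A s x + Complex.I * B s x‖ ≤
      1 / 4 * Real.exp (α * s) * ‖A s x - Complex.I * B s x‖ := by
  have hR := h.hR
  have hα := h.hα
  obtain ⟨T, hT⟩ : ∃ T : ℝ, Real.exp (-T) + 2 * (C * R ^ α * Real.exp (-(α * T))) ≤ 1 / 8 := by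
    have h1 : Filter.Tendsto (fun T : ℝ => Real.exp (-T) + 2 * (C * R ^ α * Real.exp (-(α * T))))
        Filter.atTop (𝓝 (0 + 2 * (C * R ^ α * 0))) := by
      refine Real.tendsto_exp_neg_atTop_nhds_zero.add (((Filter.Tendsto.comp
        Real.tendsto_exp_neg_atTop_nhds_zero (Filter.tendsto_id.const_mul_atTop hα)).const_mul _).const_mul 2)
    have h2 := h1.eventually (gt_mem_nhds (show (0 + 2 * (C * R ^ α * 0)) < (1:ℝ) / 8 by norm_num))
    obtain ⟨T, hT⟩ := h2.exists
    exact ⟨T, hT.le⟩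
  have hmem : ∀ s x, cZ R T s x ∈ Metric.ball (0:ℂ) R := fun s x => by
    rw [mem_ball_zero_iff, cZ_norm hR]; exact cRho_lt hR T s
  set A : ℝ → ℝ → ℂ := fun s x => f' (cZ R T s x) (cKap T s * cZ R T s x) with hA
  set B : ℝ → ℝ → ℂ := fun s x => f' (cZ R T s x) (Complex.I * cZ R T s x) with hB
  have cκ : Continuous (cKap T) := by
    unfold cKap
    refine continuous_const.div (by fun_prop) (fun s => ?_)
    have := Real.exp_pos (s - T); positivity
  have cρ : Continuous (cRho R T) := continuous_iff_continuousAt.2 fun s => (cRho_deriv R T s).continuousAt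
  have cz : Continuous fun p : ℝ × ℝ => cZ R T p.1 p.2 := by
    unfold cZ
    exact (Complex.continuous_ofReal.comp (cρ.comp continuous_fst)).mul (by fun_prop)
  have cf' : Continuous fun p : ℝ × ℝ => f' (cZ R T p.1 p.2) :=
    h.hc.comp_continuous cz (fun p => hmem _ _)
  have hq : ∀ s ≤ 0, ∀ x, ‖A s x + Complex.I * B s x‖ ≤
      1 / 4 * Real.exp (α * s) * ‖A s x - Complex.I * B s x‖ := by
    intro s hs x
    have hz := hmem s x
    have hzn := cZ_norm hR T s x
    set z := cZ R T s x with hzd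
    set κ := cKap T s with hκ
    have hEs := Real.exp_pos (s - T)
    have hκ0 : 0 ≤ κ := by rw [hκ]; unfold cKap; positivity
    have hκ1 : κ ≤ 1 := by rw [hκ]; unfold cKap; rw [div_le_one (by positivity)]; linarith
    have hκ2 : 1 - κ ≤ Real.exp (s - T) := by
      rw [hκ]; unfold cKap
      rw [one_sub_div (by positivity), div_le_iff₀ (by positivity)]; nlinarith
    set a := (f' z 1 - Complex.I * f' z Complex.I) / 2 * z with ha
    set b := (f' z 1 + Complex.I * f' z Complex.I) / 2 * (starRingEnd ℂ) z with hb
    set η := C * ‖z‖ ^ α with hη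
    have hη0 : 0 ≤ η := by have := h.hC; positivity
    have hba : ‖b‖ ≤ η * ‖a‖ := by
      have h1 := h.hb z hz
      rw [ha, hb, norm_mul, norm_mul, norm_div, norm_div, RCLike.norm_conj]
      rw [← hη] at h1
      calc _ ≤ (η * ‖f' z 1 - Complex.I * f' z Complex.I‖) / ‖(2:ℂ)‖ * ‖z‖ := by gcongr
        _ = _ := by ring
    have eA : A s x = κ * (a + b) := by
      simp only [hA]
      rw [rlin, map_mul, Complex.conj_ofReal, ha, hb]
      ring
    have eB : B s x = Complex.I * (a - b) := by
      simp only [hB]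
      rw [rlin, map_mul, Complex.conj_I, ha, hb]
      ring
    have e1 : A s x + Complex.I * B s x = ((κ - 1 : ℝ) : ℂ) * a + ((κ + 1 : ℝ) : ℂ) * b := by
      rw [eA, eB]; push_cast; ring_nf; rw [Complex.I_sq]; ring
    have e2 : A s x - Complex.I * B s x = ((κ + 1 : ℝ) : ℂ) * a + ((κ - 1 : ℝ) : ℂ) * b := by
      rw [eA, eB]; push_cast; ring_nf; rw [Complex.I_sq]; ring
    clear_value a b
    have n1 : ‖A s x + Complex.I * B s x‖ ≤ (1 - κ) * ‖a‖ + 2 * ‖b‖ := by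
      rw [e1]
      refine (norm_add_le _ _).trans ?_
      rw [norm_mul, norm_mul, Complex.norm_real, Complex.norm_real, Real.norm_eq_abs, Real.norm_eq_abs,
        abs_of_nonpos (by linarith), abs_of_nonneg (by linarith)]
      nlinarith [norm_nonneg b]
    have n2 : (κ + 1) * ‖a‖ - (1 - κ) * ‖b‖ ≤ ‖A s x - Complex.I * B s x‖ := by
      rw [e2]
      refine le_trans ?_ (norm_sub_le_norm_add _ _)
      rw [norm_mul, norm_mul, Complex.norm_real, Complex.norm_real, Real.norm_eq_abs, Real.norm_eq_abs,
        abs_of_nonneg (by linarith), abs_of_nonpos (by linarith)]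
      linarith
    have hE : 0 < Real.exp (α * s) := Real.exp_pos _
    have hE1 : Real.exp (α * s) ≤ 1 := by
      rw [Real.exp_le_one_iff]; exact mul_nonpos_of_nonneg_of_nonpos hα.le hs
    have hη1 : η ≤ C * R ^ α * Real.exp (-(α * T)) * Real.exp (α * s) := by
      rw [hη, hzn]
      have h1 : cRho R T s ^ α ≤ (R * Real.exp (s - T)) ^ α :=
        Real.rpow_le_rpow (cRho_pos hR T s).le (cRho_le hR T s) hα.le
      rw [Real.mul_rpow hR.le hEs.le, ← Real.exp_mul] at h1
      have h2 : Real.exp ((s - T) * α) = Real.exp (-(α * T)) * Real.exp (α * s) := by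
        rw [← Real.exp_add]; congr 1; ring
      rw [h2] at h1
      calc _ ≤ C * (R ^ α * (Real.exp (-(α * T)) * Real.exp (α * s))) :=
            mul_le_mul_of_nonneg_left h1 h.hC
        _ = _ := by ring
    have hκ3 : 1 - κ ≤ Real.exp (-T) * Real.exp (α * s) := by
      refine hκ2.trans ?_
      rw [← Real.exp_add]
      apply Real.exp_le_exp.2
      nlinarith [h.hα1]
    have hX := Real.exp_pos (-T)
    set X := C * R ^ α * Real.exp (-(α * T)) with hXd
    have hX0 : 0 ≤ X := by have := h.hC; positivity
    set E := Real.exp (α * s) with hEd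
    have h5 : η ≤ 1 / 2 := by
      have : X * E ≤ X * 1 := mul_le_mul_of_nonneg_left hE1 hX0
      linarith
    have h6 : (1 - κ) + 2 * η ≤ 1 / 8 * E := by
      have := mul_le_mul_of_nonneg_right hT hE.le
      linarith
    have hna := norm_nonneg a
    have hnb := norm_nonneg b
    have n3 : 1 / 2 * ‖a‖ ≤ ‖A s x - Complex.I * B s x‖ := by
      refine le_trans ?_ n2
      have h7 : (1 - κ) * ‖b‖ ≤ 1 * ‖b‖ := mul_le_mul_of_nonneg_right (by linarith) hnb
      have h8 : η * ‖a‖ ≤ 1 / 2 * ‖a‖ := mul_le_mul_of_nonneg_right h5 hna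
      have h9 : 0 ≤ κ * ‖a‖ := by positivity
      linarith
    calc _ ≤ (1 - κ) * ‖a‖ + 2 * ‖b‖ := n1
      _ ≤ ((1 - κ) + 2 * η) * ‖a‖ := by linarith
      _ ≤ (1 / 8 * E) * ‖a‖ := mul_le_mul_of_nonneg_right h6 hna
      _ = 1 / 4 * E * (1 / 2 * ‖a‖) := by ring
      _ ≤ _ := mul_le_mul_of_nonneg_left n3 (by positivity)
  have hq2 : ∀ s ≤ 0, ∀ x, ‖A s x + Complex.I * B s x‖ ≤ 1 / 4 * ‖A s x - Complex.I * B s x‖ := by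
    intro s hs x
    refine (hq s hs x).trans (mul_le_mul_of_nonneg_right ?_ (norm_nonneg _))
    have : Real.exp (α * s) ≤ 1 := by
      rw [Real.exp_le_one_iff]; exact mul_nonpos_of_nonneg_of_nonpos hα.le hs
    linarith
  refine ⟨T, A, B, ⟨⟨?_, ?_, ?_, ?_, ?_, ?_⟩, ?_, fun s hs x => (pq_elem (hq2 s hs x)).1,
    fun s hs x => (pq_elem (hq2 s hs x)).2, ?_⟩, hq⟩
  · intro s x
    have h1 : HasDerivAt (fun s => cZ R T s x) (cKap T s * cZ R T s x) s := by
      have := ((cRho_deriv R T s).ofReal_comp).mul_const (Complex.exp (x * Complex.I))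
      refine this.congr_deriv ?_
      unfold cZ; push_cast; ring
    exact (h.hd _ (hmem s x)).comp_hasDerivAt s h1
  · intro s x
    have h1 : HasDerivAt (fun x => cZ R T s x) (Complex.I * cZ R T s x) x := by
      have h2 : HasDerivAt (fun x : ℝ => (x : ℂ) * Complex.I) Complex.I x := by
        exact ((Complex.ofRealCLM.hasDerivAt (x := x)).mul_const Complex.I).congr_deriv (by simp)
      refine (h2.cexp.const_mul (cRho R T s : ℂ)).congr_deriv ?_
      unfold cZ; ring
    exact (h.hd _ (hmem s x)).comp_hasDerivAt x h1
  · refine ContinuousOn.comp_continuous (s := Metric.ball (0:ℂ) R)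
      (fun z hz => (h.hd z hz).continuousAt.continuousWithinAt) cz (fun p => hmem _ _)
  · exact cf'.clm_apply ((Complex.continuous_ofReal.comp (cκ.comp continuous_fst)).mul cz)
  · exact cf'.clm_apply (continuous_const.mul cz)
  · intro s x
    have : cZ R T s (x + 2 * Real.pi) = cZ R T s x := by
      unfold cZ
      congr 1
      push_cast
      rw [add_mul, Complex.exp_add, Complex.exp_two_pi_mul_I, mul_one]
    simp only [this]
  · intro s x
    have := h.hf _ (hmem s x)
    rw [Complex.normSq_eq_norm_sq]
    nlinarith [norm_nonneg (f (cZ R T s x))]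
  · intro ε hε
    have h1 : Filter.Tendsto (fun s => R * Real.exp (s - T)) Filter.atBot (𝓝 (R * 0)) :=
      (Real.tendsto_exp_atBot.comp (Filter.tendsto_atBot_add_const_right _ (-T) Filter.tendsto_id)).const_mul R
    rw [mul_zero] at h1
    obtain ⟨S, hS⟩ := Filter.eventually_atBot.1 (h1.eventually (gt_mem_nhds hε))
    refine ⟨S, fun s hs x => ?_⟩
    have h2 := hS s hs
    have h3 := h.hf' _ (hmem s x)
    calc ‖B s x‖ ≤ ‖f' (cZ R T s x)‖ * ‖Complex.I * cZ R T s x‖ := ContinuousLinearMap.le_opNorm _ _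
      _ ≤ 1 * ‖Complex.I * cZ R T s x‖ := by gcongr
      _ = cRho R T s := by rw [norm_mul, Complex.norm_I, cZ_norm hR]; ring
      _ ≤ R * Real.exp (s - T) := cRho_le hR T s
      _ ≤ ε := h2.le

end
end

section
open MeasureTheory Set
open scoped Topology NNReal

noncomputable section

lemma LocQC.mono {f : ℂ → ℂ} {f' : ℂ → ℂ →L[ℝ] ℂ} {C α R R' : ℝ} (h : LocQC f f' C α R)
    (h0 : 0 < R') (hR : R' ≤ R) : LocQC f f' C α R' := by
  have hs := Metric.ball_subset_ball (x := (0:ℂ)) hR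
  exact ⟨h0, h.hα, h.hα1, h.hC, fun z hz => h.hd z (hs hz), h.hc.mono hs, fun z hz => h.hb z (hs hz),
    h.h0, fun z hz => h.hf z (hs hz), fun z hz => h.hf' z (hs hz)⟩

def cS (R T r : ℝ) : ℝ := T - Real.log (R / r - 1)

lemma cZ_cS {R T r : ℝ} (hr : 0 < r) (hrR : r < R) (x : ℝ) :
    cZ R T (cS R T r) x = r * Complex.exp (x * Complex.I) := by
  unfold cZ cS
  rw [cRho_surj hr hrR]

lemma cS_tendsto {R : ℝ} (hR : 0 < R) (T : ℝ) :
    Filter.Tendsto (cS R T) (𝓝[>] 0) Filter.atBot := by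
  unfold cS
  have h1 : Filter.Tendsto (fun r : ℝ => R / r - 1) (𝓝[>] 0) Filter.atTop := by
    have : Filter.Tendsto (fun r : ℝ => R * r⁻¹) (𝓝[>] 0) Filter.atTop :=
      tendsto_inv_nhdsGT_zero.const_mul_atTop hR
    simpa [div_eq_mul_inv, sub_eq_add_neg] using Filter.tendsto_atTop_add_const_right _ (-1) this
  have h2 := Real.tendsto_log_atTop.comp h1
  have h3 := Filter.tendsto_neg_atTop_atBot.comp h2
  simpa [sub_eq_add_neg, Function.comp_def] using Filter.tendsto_atBot_add_const_left _ T h3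

lemma LocQC.zero_free {f : ℂ → ℂ} {f' : ℂ → ℂ →L[ℝ] ℂ} {C α R : ℝ} (h : LocQC f f' C α R)
    (hne : ∃ᶠ z in 𝓝 (0:ℂ), f z ≠ 0) :
    ∃ R' > 0, R' ≤ R ∧ ∀ z ∈ Metric.ball (0:ℂ) R', z ≠ 0 → f z ≠ 0 := by
  have hR := h.hR
  obtain ⟨T, A, B, hF, -⟩ := cylQR h
  have h1 : ∀ S, ∃ s < S, ∃ x, f (cZ R T s x) ≠ 0 := by
    intro S
    have h2 : ∀ᶠ r in 𝓝[>] (0:ℝ), cS R T r < S ∧ r < R :=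
      ((cS_tendsto hR T).eventually (Filter.eventually_lt_atBot S)).and
        (nhdsWithin_le_nhds (gt_mem_nhds hR))
    rw [eventually_nhdsWithin_iff, Metric.eventually_nhds_iff] at h2
    obtain ⟨ε, hε, h2⟩ := h2
    obtain ⟨z, hz, hzε⟩ := (hne.and_eventually (Metric.ball_mem_nhds 0 hε)).exists
    replace hzε : ‖z‖ < ε := by simpa using hzε
    have hz0 : z ≠ 0 := fun e => hz (by rw [e, h.h0])
    have hzn : 0 < ‖z‖ := norm_pos_iff.2 hz0
    obtain ⟨h3, h4⟩ := h2 (y := ‖z‖) (by simpa using hzε) hzn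
    refine ⟨_, h3, Complex.arg z, ?_⟩
    rw [cZ_cS hzn h4, Complex.norm_mul_exp_arg_mul_I]
    exact hz
  obtain ⟨S, hS⟩ := hF.zero_free_end h1
  have h2 : ∀ᶠ r in 𝓝[>] (0:ℝ), cS R T r < S ∧ r < R :=
      ((cS_tendsto hR T).eventually (Filter.eventually_lt_atBot S)).and
        (nhdsWithin_le_nhds (gt_mem_nhds hR))
  rw [eventually_nhdsWithin_iff, Metric.eventually_nhds_iff] at h2
  obtain ⟨ε, hε, h2⟩ := h2
  refine ⟨min ε R, lt_min hε hR, min_le_right _ _, fun z hz hz0 => ?_⟩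
  rw [mem_ball_zero_iff, lt_min_iff] at hz
  have hzn : 0 < ‖z‖ := norm_pos_iff.2 hz0
  obtain ⟨h3, h4⟩ := h2 (y := ‖z‖) (by simpa using hz.1) hzn
  have := hS _ h3 (Complex.arg z)
  rwa [cZ_cS hzn h4, Complex.norm_mul_exp_arg_mul_I] at this

lemma LocQC.expand {f : ℂ → ℂ} {f' : ℂ → ℂ →L[ℝ] ℂ} {C α R : ℝ} (h : LocQC f f' C α R)
    (hne : ∃ᶠ z in 𝓝 (0:ℂ), f z ≠ 0) (hf0 : f' 0 = 0) :
    ∃ (n : ℕ) (φ : ℝ), 2 ≤ n ∧ ∀ᵐ x : ℝ, x ∈ Ioc 0 (2 * Real.pi) →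
      (0 < Real.cos (n * x + φ) → ∀ᶠ r : ℝ in 𝓝[>] (0:ℝ), 0 < (f ((r:ℂ) * Complex.exp (x * Complex.I))).re) ∧
      (Real.cos (n * x + φ) < 0 →
        ∀ᶠ r : ℝ in 𝓝[>] (0:ℝ), (f ((r:ℂ) * Complex.exp (x * Complex.I))).re < 0) := by
  have hpi := Real.pi_pos
  obtain ⟨R', hR', hRR, hnz⟩ := h.zero_free hne
  replace h := h.mono hR' hRR
  clear hRR
  obtain ⟨T, A, B, hF, hq⟩ := cylQR h
  have hz0 : ∀ s x, cZ R' T s x ≠ 0 := fun s x => by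
    rw [← norm_pos_iff, cZ_norm hR']; exact cRho_pos hR' T s
  have hzb : ∀ s x, cZ R' T s x ∈ Metric.ball (0:ℂ) R' := fun s x => by
    rw [mem_ball_zero_iff, cZ_norm hR']; exact cRho_lt hR' T s
  obtain ⟨n, w, hlim⟩ := hF.expand (fun s x => hnz _ (hzb s x) (hz0 s x)) h.hα hq
  rw [ae_restrict_iff' measurableSet_Ioc] at hlim
  -- degree at least two
  have hn : 2 ≤ n := by
    by_contra hcon
    have hn1 : (n : ℝ) ≤ 1 := by exact_mod_cast (by omega : n ≤ 1)
    obtain ⟨x, hx, hxP⟩ := (Measure.dense_of_ae hlim).exists_mem_open (isOpen_Ioo (a := (0:ℝ))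
      (b := 2 * Real.pi)) ⟨Real.pi, by constructor <;> linarith⟩
    have hl := hx ⟨hxP.1, hxP.2.le⟩
    have hl2 := hl.norm
    have hfo : (fun z => f z) =o[𝓝 (0:ℂ)] fun z => z := by
      have := (h.hd 0 (Metric.mem_ball_self hR')).isLittleO
      simpa [hf0, h.h0] using this
    have hcz : Filter.Tendsto (fun s => cZ R' T s x) Filter.atBot (𝓝 0) := by
      rw [tendsto_zero_iff_norm_tendsto_zero]
      have h1 : Filter.Tendsto (fun s => R' * Real.exp (s - T)) Filter.atBot (𝓝 (R' * 0)) :=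
        (Real.tendsto_exp_atBot.comp
          (Filter.tendsto_atBot_add_const_right _ (-T) Filter.tendsto_id)).const_mul R'
      rw [mul_zero] at h1
      refine squeeze_zero (fun s => norm_nonneg _) (fun s => ?_) h1
      rw [cZ_norm hR']; exact cRho_le hR' T s
    have hpos : 0 < ‖Complex.exp w‖ := norm_pos_iff.2 (Complex.exp_ne_zero w)
    set M := R' * Real.exp (-T) with hM
    have hM0 : 0 < M := mul_pos hR' (Real.exp_pos _)
    have h1 := hcz.eventually (hfo.def (show 0 < ‖Complex.exp w‖ / (2 * M) by positivity))
    have h2 := hl2.eventually (lt_mem_nhds (show ‖Complex.exp w‖ / 2 < ‖Complex.exp w‖ by linarith))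
    obtain ⟨s, ⟨h1, h2⟩, hs⟩ := ((h1.and h2).and (Filter.eventually_le_atBot 0)).exists
    rw [norm_mul, Complex.norm_exp (-((n:ℂ) * (s + x * Complex.I)))] at h2
    have e : (-((n:ℂ) * (s + x * Complex.I))).re = -(n * s) := by simp
    rw [e] at h2
    rw [cZ_norm hR'] at h1
    have h3 := cRho_le hR' T s
    have h4 : R' * Real.exp (s - T) * Real.exp (-(n * s)) ≤ M := by
      rw [hM, mul_assoc, ← Real.exp_add]
      refine mul_le_mul_of_nonneg_left (Real.exp_le_exp.2 ?_) hR'.le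
      nlinarith
    have h5 : ‖f (cZ R' T s x)‖ * Real.exp (-(n * s)) ≤ ‖Complex.exp w‖ / (2 * M) * M := by
      calc _ ≤ ‖Complex.exp w‖ / (2 * M) * (R' * Real.exp (s - T)) * Real.exp (-(n * s)) := by
            gcongr; exact h1.trans (by gcongr)
        _ = ‖Complex.exp w‖ / (2 * M) * (R' * Real.exp (s - T) * Real.exp (-(n * s))) := by ring
        _ ≤ _ := by gcongr
    have h6 : ‖Complex.exp w‖ / (2 * M) * M = ‖Complex.exp w‖ / 2 := by field_simp
    linarith
  refine ⟨n.toNat, w.im, by omega, ?_⟩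
  have hcast : ((n.toNat : ℕ) : ℝ) = (n : ℝ) := by
    have : ((n.toNat : ℕ) : ℤ) = n := Int.toNat_of_nonneg (by omega)
    exact_mod_cast congrArg (fun k : ℤ => (k : ℝ)) this
  rw [hcast]
  filter_upwards [hlim] with x hx hxm
  have hl := (hx hxm).comp (cS_tendsto hR' T)
  have hl2 := (Complex.continuous_re.tendsto _).comp
    (hl.mul_const (Complex.exp (n * (x * Complex.I))))
  have e0 : (Complex.exp w * Complex.exp (n * (x * Complex.I))).re =
      Real.exp w.re * Real.cos (n * x + w.im) := by
    rw [← Complex.exp_add, Complex.exp_re]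
    simp [add_comm]
  rw [e0] at hl2
  have hev : ∀ᶠ r in 𝓝[>] (0:ℝ), 0 < r ∧ r < R' :=
    (eventually_mem_nhdsWithin (a := (0:ℝ)) (s := Ioi 0)).and (nhdsWithin_le_nhds (gt_mem_nhds hR'))
  have key : ∀ r : ℝ, 0 < r → r < R' →
      (f (cZ R' T (cS R' T r) x) * Complex.exp (-(n * ((cS R' T r : ℝ) + x * Complex.I))) *
        Complex.exp (n * (x * Complex.I))).re =
      (f (r * Complex.exp (x * Complex.I))).re * Real.exp (-(n * cS R' T r)) := by
    intro r h1 h2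
    rw [cZ_cS h1 h2, mul_assoc, ← Complex.exp_add]
    have : (-((n:ℂ) * ((cS R' T r : ℝ) + x * Complex.I)) + n * (x * Complex.I)) =
        ((-(n * cS R' T r) : ℝ) : ℂ) := by push_cast; ring
    rw [this, ← Complex.ofReal_exp, Complex.re_mul_ofReal]
  have hew := Real.exp_pos w.re
  constructor
  · intro hc
    have := hl2.eventually (lt_mem_nhds (mul_pos hew hc))
    filter_upwards [this, hev] with r h1 h2
    simp only [Function.comp_apply] at h1
    rw [key r h2.1 h2.2] at h1
    exact pos_of_mul_pos_left h1 (Real.exp_pos _).le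
  · intro hc
    have := hl2.eventually (gt_mem_nhds (mul_neg_of_pos_of_neg hew hc))
    filter_upwards [this, hev] with r h1 h2
    simp only [Function.comp_apply] at h1
    rw [key r h2.1 h2.2] at h1
    by_contra hcon
    exact absurd h1 (not_lt.2 (mul_nonneg (not_lt.1 hcon) (Real.exp_pos _).le))

lemma cos_ne_ae (n : ℕ) (hn : 2 ≤ n) (φ : ℝ) : ∀ᵐ x : ℝ, Real.cos (n * x + φ) ≠ 0 := by
  have hn0 : (n : ℝ) ≠ 0 := by positivity
  have : {x : ℝ | ¬ Real.cos (n * x + φ) ≠ 0} ⊆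
      Set.range fun k : ℤ => ((2 * k + 1) * Real.pi / 2 - φ) / n := by
    intro x hx
    simp only [not_not, Set.mem_ofPred_eq, Real.cos_eq_zero_iff] at hx
    obtain ⟨k, hk⟩ := hx
    refine ⟨k, ?_⟩
    simp only [← hk]
    field_simp
    ring
  exact measure_mono_null this ((Set.countable_range _).measure_zero _)

/-- positive real part on the ray at angle `x` -/
def RayP (f : ℂ → ℂ) (x : ℝ) : Prop := ∀ᶠ r : ℝ in 𝓝[>] (0:ℝ), 0 < (f ((r:ℂ) * Complex.exp (x * Complex.I))).re

def RayN (f : ℂ → ℂ) (x : ℝ) : Prop := ∀ᶠ r : ℝ in 𝓝[>] (0:ℝ), (f ((r:ℂ) * Complex.exp (x * Complex.I))).re < 0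

lemma LocQC.dense {f : ℂ → ℂ} {f' : ℂ → ℂ →L[ℝ] ℂ} {C α R : ℝ} (h : LocQC f f' C α R)
    (hne : ∃ᶠ z in 𝓝 (0:ℂ), f z ≠ 0) (hf0 : f' 0 = 0) {U : Set ℝ} (hU : IsOpen U)
    (hUne : (U ∩ Ioo 0 (2 * Real.pi)).Nonempty) : ∃ x ∈ U, RayP f x ∨ RayN f x := by
  obtain ⟨n, φ, hn, hae⟩ := h.expand hne hf0
  obtain ⟨x, ⟨h1, h2⟩, hxU, hx⟩ := (Measure.dense_of_ae (hae.and (cos_ne_ae n hn φ))).exists_mem_open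
    (hU.inter isOpen_Ioo) hUne
  refine ⟨x, hxU, ?_⟩
  have := h1 ⟨hx.1, hx.2.le⟩
  rcases lt_or_gt_of_ne h2 with h3 | h3
  · exact Or.inr (this.2 h3)
  · exact Or.inl (this.1 h3)

lemma RayP.per {f : ℂ → ℂ} {x : ℝ} (h : RayP f x) : RayP f (x + 2 * Real.pi) := by
  unfold RayP at *
  have : Complex.exp (((x + 2 * Real.pi : ℝ) : ℂ) * Complex.I) = Complex.exp (x * Complex.I) := by
    push_cast
    rw [add_mul, Complex.exp_add, Complex.exp_two_pi_mul_I, mul_one]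
  rwa [this]

lemma LocQC.four {f : ℂ → ℂ} {f' : ℂ → ℂ →L[ℝ] ℂ} {C α R : ℝ} (h : LocQC f f' C α R)
    (hne : ∃ᶠ z in 𝓝 (0:ℂ), f z ≠ 0) (hf0 : f' 0 = 0) :
    ∃ a1 a2 a3 a4 : ℝ, a1 < a2 ∧ a2 < a3 ∧ a3 < a4 ∧ a4 < a1 + 2 * Real.pi ∧
      RayP f a1 ∧ RayN f a2 ∧ RayP f a3 ∧ RayN f a4 := by
  have hpi := Real.pi_pos
  obtain ⟨n, φ, hn, hae⟩ := h.expand hne hf0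
  have hn2 : (2 : ℝ) ≤ n := by exact_mod_cast hn
  have hn0 : (0 : ℝ) < n := by linarith
  set d := Real.pi / n with hd
  have hd0 : 0 < d := by positivity
  have hd2 : d ≤ Real.pi / 2 := by rw [hd]; gcongr
  have hnd : n * d = Real.pi := by rw [hd]; field_simp
  have tr : ∀ c : ℝ, ∀ᵐ x : ℝ, x + c ∈ Ioc 0 (2 * Real.pi) →
      (0 < Real.cos (n * (x + c) + φ) → RayP f (x + c)) ∧
      (Real.cos (n * (x + c) + φ) < 0 → RayN f (x + c)) := fun c =>
    (measurePreserving_add_right volume c).quasiMeasurePreserving.ae hae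
  obtain ⟨x, ⟨⟨⟨⟨hc, h0⟩, h1⟩, h2⟩, h3⟩, hx⟩ := (Measure.dense_of_ae (((((cos_ne_ae n hn φ).and (tr 0)).and
    (tr d)).and (tr (2 * d))).and (tr (3 * d)))).exists_mem_open (isOpen_Ioo (a := (0:ℝ))
      (b := Real.pi / 2)) ⟨Real.pi / 4, by constructor <;> linarith⟩
  replace h0 := h0 ⟨by linarith [hx.1], by linarith [hx.2]⟩
  replace h1 := h1 ⟨by linarith [hx.1], by linarith [hx.2]⟩
  replace h2 := h2 ⟨by linarith [hx.1], by linarith [hx.2]⟩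
  replace h3 := h3 ⟨by linarith [hx.1], by linarith [hx.2]⟩
  have c0 : Real.cos (n * (x + 0) + φ) = Real.cos (n * x + φ) := by rw [add_zero]
  have c1 : Real.cos (n * (x + d) + φ) = - Real.cos (n * x + φ) := by
    rw [← Real.cos_add_pi]; congr 1; linear_combination hnd
  have c2 : Real.cos (n * (x + 2 * d) + φ) = Real.cos (n * x + φ) := by
    rw [← Real.cos_add_two_pi (n * x + φ)]; congr 1; linear_combination 2 * hnd
  have c3 : Real.cos (n * (x + 3 * d) + φ) = - Real.cos (n * x + φ) := by
    rw [← Real.cos_add_pi, ← Real.cos_add_two_pi (n * x + φ + Real.pi)]; congr 1; linear_combination 3 * hnd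
  rw [c0] at h0
  rw [c1] at h1
  rw [c2] at h2
  rw [c3] at h3
  rcases lt_or_gt_of_ne hc with hc | hc
  · refine ⟨x + d, x + 2 * d, x + 3 * d, x + 0 + 2 * Real.pi, by linarith, by linarith, by linarith,
      by linarith, h1.1 (by linarith), h2.2 hc, h3.1 (by linarith), ?_⟩
    have h4 := h0.2 hc
    have : Complex.exp (((x + 0 + 2 * Real.pi : ℝ) : ℂ) * Complex.I) =
        Complex.exp ((x + 0 : ℝ) * Complex.I) := by
      push_cast
      rw [add_mul _ (2 * (Real.pi : ℂ)), Complex.exp_add, Complex.exp_two_pi_mul_I, mul_one]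
    unfold RayN
    rw [this]
    exact h4
  · exact ⟨x + 0, x + d, x + 2 * d, x + 3 * d, by linarith, by linarith, by linarith, by linarith,
      h0.1 hc, h1.2 (by linarith), h2.1 hc, h3.2 (by linarith)⟩

end
end

section
open MeasureTheory Set
open scoped Topology NNReal

noncomputable section

lemma conv_fd {ρ : E2 → ℝ} {η : E2 → E2 →L[ℝ] ℝ} (hρc : HasCompactSupport ρ)
    (hρ1 : ContDiff ℝ 1 ρ) (hη : LocallyIntegrable η volume) :
    (∀ x, ∀ v w : E2, fderiv ℝ (convolution ρ η (ContinuousLinearMap.lsmul ℝ ℝ (E := E2 →L[ℝ] ℝ)) volume)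
      x v w = ∫ t, fderiv ℝ ρ t v * η (x - t) w) ∧
    ∀ x, ∀ v w : E2, Integrable (fun t => fderiv ℝ ρ t v * η (x - t) w) := by
  let L := ContinuousLinearMap.lsmul ℝ ℝ (E := E2 →L[ℝ] ℝ)
  have hex : ∀ x, Integrable (fun t => (L.precompL E2 (fderiv ℝ ρ t) (η (x - t)))) volume := fun x =>
    (hρc.fderiv (𝕜 := ℝ)).convolutionExists_left (𝕜 := ℝ) (F := E2 →L[ℝ] E2 →L[ℝ] ℝ) _
      (hρ1.continuous_fderiv one_ne_zero) hη x
  have hex2 : ∀ x v, Integrable (fun t => (L.precompL E2 (fderiv ℝ ρ t) (η (x - t))) v) volume :=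
    fun x v => (hex x).apply_continuousLinearMap v
  have hex3 : ∀ x v w, Integrable (fun t => (L.precompL E2 (fderiv ℝ ρ t) (η (x - t))) v w) volume :=
    fun x v w => (hex2 x v).apply_continuousLinearMap w
  refine ⟨fun x v w => ?_, fun x v w => hex3 x v w⟩
  rw [(hρc.hasFDerivAt_convolution_left L hρ1 hη x).fderiv, convolution_def,
    ContinuousLinearMap.integral_apply (hex x), ContinuousLinearMap.integral_apply (hex2 x v)]
  rfl

lemma mollify_step {G : Set E2} {ω : E2 → E2 →L[ℝ] ℝ} (hω : ContinuousOn ω G)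
    (hw : ∀ φ : E2 → ℝ, IsTestOn G φ → ∀ v w : E2,
      ∫ y in G, (fderiv ℝ φ y v * ω y w - fderiv ℝ φ y w * ω y v) = 0)
    {x0 : E2} {r : ℝ} (hr : 0 < r) (hb : Metric.closedBall x0 (2 * r) ⊆ G) {ε : ℝ} (hε : 0 < ε)
    (hεr : ε < r) :
    ∃ (V : E2 → ℝ) (ω' : E2 → E2 →L[ℝ] ℝ), V x0 = 0 ∧
      (∀ x ∈ Metric.ball x0 r, HasFDerivAt V (ω' x) x) ∧
      ∀ x ∈ Metric.ball x0 r, ∀ δ, (∀ y ∈ Metric.ball x ε, dist (ω y) (ω x) ≤ δ) →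
        dist (ω' x) (ω x) ≤ δ := by
  classical
  set D := Metric.closedBall x0 (2 * r) with hD
  have hDc : IsCompact D := isCompact_closedBall _ _
  set η : E2 → E2 →L[ℝ] ℝ := D.indicator ω with hη
  have hηi : Integrable η volume := 
    (integrable_indicator_iff hDc.measurableSet).2 ((hω.mono hb).integrableOn_compact hDc)
  let b : ContDiffBump (0 : E2) := ⟨ε / 2, ε, by positivity, by linarith⟩
  set ρ : E2 → ℝ := b.normed volume with hρ
  have hρs : ContDiff ℝ (⊤ : ℕ∞) ρ := b.contDiff_normed
  have hρ1 : ContDiff ℝ 1 ρ := hρs.of_le (by exact_mod_cast le_top)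
  have hρc : HasCompactSupport ρ := b.hasCompactSupport_normed
  have hρt : tsupport ρ = Metric.closedBall 0 ε := b.tsupport_normed_eq
  let L := ContinuousLinearMap.lsmul ℝ ℝ (E := E2 →L[ℝ] ℝ)
  have hder := fun x => hρc.hasFDerivAt_convolution_left L hρ1 hηi.locallyIntegrable x
  set ω' : E2 → E2 →L[ℝ] ℝ := convolution ρ η L volume with hω'
  have hball : ∀ x ∈ Metric.ball x0 r, ∀ y, dist y x ≤ ε → y ∈ D := by
    intro x hx y hy
    rw [Metric.mem_ball] at hx
    rw [hD, Metric.mem_closedBall]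
    linarith [dist_triangle y x x0]
  obtain ⟨hfd, hint⟩ := conv_fd hρc hρ1 hηi.locallyIntegrable
  have hsym : ∀ x ∈ Metric.ball x0 r, ∀ v w : E2, fderiv ℝ ω' x v w = fderiv ℝ ω' x w v := by
    intro x hx v w
    rw [hfd, hfd, ← sub_eq_zero, ← integral_sub (hint x v w) (hint x w v)]
    set φ : E2 → ℝ := fun y => ρ (x - y) with hφ
    have hts : tsupport φ ⊆ Metric.closedBall x ε := by
      apply closure_minimal _ Metric.isClosed_closedBall
      intro y hy
      have h1 : x - y ∈ tsupport ρ := subset_tsupport _ hy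
      rw [hρt, mem_closedBall_zero_iff] at h1
      rw [Metric.mem_closedBall, dist_comm, dist_eq_norm]; exact h1
    have hDφ : ∀ y, fderiv ℝ φ y = - fderiv ℝ ρ (x - y) := by
      intro y
      have h1 : HasFDerivAt (fun y => x - y) (-(ContinuousLinearMap.id ℝ E2)) y :=
        (hasFDerivAt_id y).const_sub x
      have h2 : HasFDerivAt φ _ y := ((hρ1.differentiable one_ne_zero (x - y)).hasFDerivAt).comp y h1
      rw [h2.fderiv]
      ext v
      simp
    have htest : IsTestOn G φ := by
      refine ⟨hρs.comp (contDiff_const.sub contDiff_id), ?_, fun y hy => hb (hball x hx y ?_)⟩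
      · exact HasCompactSupport.of_support_subset_isCompact (isCompact_closedBall x ε)
          ((subset_tsupport _).trans hts)
      · exact Metric.mem_closedBall.1 (hts hy)
    have h0 := hw φ htest v w
    have hz : ∀ y, y ∉ D → fderiv ℝ φ y = 0 := by
      intro y hy
      by_contra hne
      exact hy (hball x hx y (hts (support_fderiv_subset ℝ hne)))
    rw [setIntegral_eq_integral_of_forall_compl_eq_zero
      (fun y hy => by rw [hz y (fun h => hy (hb h))]; simp)] at h0
    rw [← integral_sub_left_eq_self _ volume x]
    rw [← neg_eq_zero, ← integral_neg]
    rw [← h0]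
    congr 1
    ext y
    rw [sub_sub_cancel, hDφ]
    by_cases hy : y ∈ D
    · simp only [hη, indicator_of_mem hy, neg_sub, neg_apply]; ring
    · have := hz y hy
      rw [hDφ, neg_eq_zero] at this
      simp [this]
  obtain ⟨V, hV⟩ := (convex_ball x0 r).exists_forall_hasFDerivAt_of_fderiv_symmetric
    Metric.isOpen_ball (fun x _ => (hder x).differentiableAt.differentiableWithinAt) hsym
  refine ⟨fun x => V x - V x0, ω', sub_self _, fun x hx => (hV x hx).sub_const _, ?_⟩
  intro x hx δ hδ
  have hηe : ∀ y, dist y x ≤ ε → η y = ω y := fun y hy => indicator_of_mem (hball x hx y hy) _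
  have := b.dist_normed_convolution_le (μ := volume) (x₀ := x) (ε := δ) hηi.aestronglyMeasurable
    (fun y hy => by
      rw [hηe y (Metric.mem_ball.1 hy).le, hηe x (by simp [hε.le])]; exact hδ y hy)
  rwa [hηe x (by simp [hε.le])] at this

lemma stream_exists {G : Set E2} {ω : E2 → E2 →L[ℝ] ℝ} (hω : ContinuousOn ω G)
    (hw : ∀ φ : E2 → ℝ, IsTestOn G φ → ∀ v w : E2,
      ∫ y in G, (fderiv ℝ φ y v * ω y w - fderiv ℝ φ y w * ω y v) = 0)
    {x0 : E2} {r : ℝ} (hr : 0 < r) (hb : Metric.closedBall x0 (2 * r) ⊆ G) :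
    ∃ V : E2 → ℝ, ∀ x ∈ Metric.ball x0 r, HasFDerivAt V (ω x) x := by
  have hm := fun n : ℕ => mollify_step hω hw hr hb (ε := r / (n + 2)) (by positivity)
    (div_lt_self hr (by linarith [(Nat.cast_nonneg n : (0:ℝ) ≤ n)]))
  choose V ω' hV0 hV hd using hm
  have huc := (isCompact_closedBall x0 (2 * r)).uniformContinuousOn_of_continuous (hω.mono hb)
  have hlim : TendstoUniformlyOn ω' ω Filter.atTop (Metric.ball x0 r) := by
    rw [Metric.tendstoUniformlyOn_iff]
    intro δ hδ
    rw [Metric.uniformContinuousOn_iff] at huc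
    obtain ⟨τ, hτ, huc⟩ := huc (δ / 2) (by positivity)
    have h1 : Filter.Tendsto (fun n : ℕ => r / ((n:ℝ) + 2)) Filter.atTop (𝓝 0) :=
      (Filter.tendsto_atTop_add_const_right _ 2 tendsto_natCast_atTop_atTop).const_div_atTop r
    filter_upwards [h1.eventually (gt_mem_nhds hτ)] with n hn x hx
    rw [dist_comm]
    refine lt_of_le_of_lt (hd n x hx (δ / 2) (fun y hy => (huc y ?_ x ?_ ?_).le)) (by linarith)
    · rw [Metric.mem_ball] at hx hy
      rw [Metric.mem_closedBall]
      have : r / ((n:ℝ) + 2) ≤ r := div_le_self hr.le (by linarith [(Nat.cast_nonneg n : (0:ℝ) ≤ n)])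
      linarith [dist_triangle y x x0]
    · exact Metric.ball_subset_closedBall (Metric.ball_subset_ball (by linarith) hx)
    · exact (Metric.mem_ball.1 hy).trans hn
  have hc := uniformCauchySeqOn_ball_of_fderiv (𝕜 := ℝ) hlim.uniformCauchySeqOn hV (by
    simp only [hV0]
    exact (tendsto_const_nhds (x := (0:ℝ)) (f := (Filter.atTop : Filter ℕ))).cauchy_map)
  have hex : ∀ x, ∃ y, x ∈ Metric.ball x0 r → Filter.Tendsto (fun n => V n x) Filter.atTop (𝓝 y) := by
    intro x
    by_cases hx : x ∈ Metric.ball x0 r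
    · obtain ⟨y, hy⟩ := CompleteSpace.complete (hc.cauchy_map hx)
      exact ⟨y, fun _ => hy⟩
    · exact ⟨0, fun h => absurd h hx⟩
  choose W hW using hex
  exact ⟨W, fun x hx => hasFDerivAt_of_tendstoUniformlyOn Metric.isOpen_ball hlim hV hW hx⟩

end
end

section
open MeasureTheory Set
open scoped Topology NNReal

noncomputable section

lemma coord_alg {s11 s12 s21 s22 m a D : ℝ} (hm : m = (s12 + s21) / 2) (ha : a = (s12 - s21) / 2)
    (hD : 0 < D) (hD2 : D ^ 2 = s11 * s22 - m ^ 2) (h22 : 0 < s22) :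
    ∃ c > 0, ∀ p q e0 e1 τ : ℝ, 0 ≤ τ → c * τ ≤ 1 → |e0| + |e1| ≤ τ * (|p| + |q|) →
      ∀ f1 f2 : ℂ, f1 = (p : ℂ) + Complex.I * (((-(s21 * p + s22 * q + e1) - a * p) / D : ℝ) : ℂ) →
      f2 = ((m / D * p + s22 / D * q : ℝ) : ℂ) + Complex.I *
        (((m / D * -(s21 * p + s22 * q + e1) + s22 / D * (s11 * p + s12 * q + e0) -
          a * (m / D * p + s22 / D * q)) / D : ℝ) : ℂ) →
      ‖f1 + Complex.I * f2‖ ≤ c * τ * ‖f1 - Complex.I * f2‖ := by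
  set c1 := 1 / D + (|m| + s22) / D ^ 2 with hc1
  set c2 := 1 + (D + |m|) / s22 with hc2
  have hc1p : 0 < c1 := by have := abs_nonneg m; positivity
  have hc2p : 0 < c2 := by have := abs_nonneg m; positivity
  refine ⟨c1 * c2, by positivity, ?_⟩
  intro p q e0 e1 τ hτ hcτ he f1 f2 hf1 hf2
  set Y := (m * p + s22 * q) / D with hY
  have hD0 : D ≠ 0 := hD.ne'
  set N : ℂ := (p : ℂ) - Complex.I * (Y : ℝ) with hN
  set Ep : ℂ := (((m * e1 - s22 * e0) / D ^ 2 : ℝ) : ℂ) - Complex.I * ((e1 / D : ℝ) : ℂ) with hEp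
  set Em : ℂ := (((s22 * e0 - m * e1) / D ^ 2 : ℝ) : ℂ) - Complex.I * ((e1 / D : ℝ) : ℂ) with hEm
  have hDC : (D : ℂ) ≠ 0 := by exact_mod_cast hD0
  have r1 : (m / D * -(s21 * p + s22 * q + e1) + s22 / D * (s11 * p + s12 * q + e0) -
          a * (m / D * p + s22 / D * q)) / D = p + (s22 * e0 - m * e1) / D ^ 2 := by
    have : p = p * (s11 * s22 - m ^ 2) / D ^ 2 := by rw [← hD2]; field_simp
    conv_rhs => rw [this]
    rw [ha, hm]
    field_simp
    ring
  have r2 : (-(s21 * p + s22 * q + e1) - a * p) / D = - Y - e1 / D := by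
    rw [hY, ha, hm]; field_simp; ring
  have r3 : m / D * p + s22 / D * q = Y := by rw [hY]; field_simp
  rw [r2] at hf1
  rw [r3, ← r3, r1, r3] at hf2
  have E1 : f1 + Complex.I * f2 = Ep := by
    rw [hf1, hf2, hEp]
    push_cast
    linear_combination ((p : ℂ) + (s22 * e0 - m * e1) / D ^ 2) * Complex.I_sq
  have E2 : f1 - Complex.I * f2 = 2 * N + Em := by
    rw [hf1, hf2, hEm, hN]
    push_cast
    linear_combination (-((p : ℂ) + (s22 * e0 - m * e1) / D ^ 2)) * Complex.I_sq
  have key : ∀ x y : ℝ, ‖(x : ℂ) - Complex.I * (y : ℂ)‖ ≤ |x| + |y| := by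
    intro x y
    refine (norm_sub_le _ _).trans ?_
    simp
  have b1 : ∀ e0 e1 : ℝ, |e1| / D + (s22 * |e0| + |m| * |e1|) / D ^ 2 ≤ c1 * (|e0| + |e1|) := by
    intro e0 e1
    have h1 : 0 ≤ |e0| / D + |m| * |e0| / D ^ 2 + s22 * |e1| / D ^ 2 := by positivity
    have h2 : c1 * (|e0| + |e1|) = |e1| / D + (s22 * |e0| + |m| * |e1|) / D ^ 2 +
        (|e0| / D + |m| * |e0| / D ^ 2 + s22 * |e1| / D ^ 2) := by rw [hc1]; ring
    linarith
  have b0 : ∀ e0 e1 : ℝ, |s22 * e0 - m * e1| ≤ s22 * |e0| + |m| * |e1| := by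
    intro e0 e1
    refine (abs_sub _ _).trans ?_
    rw [abs_mul, abs_mul, abs_of_pos h22]
  have bp : ‖Ep‖ ≤ c1 * (|e0| + |e1|) := by
    refine (key _ _).trans (le_trans ?_ (b1 e0 e1))
    rw [abs_div, abs_div, abs_of_pos hD, abs_of_pos (by positivity : 0 < D ^ 2), add_comm, abs_sub_comm]
    gcongr
    exact b0 e0 e1
  have bm : ‖Em‖ ≤ c1 * (|e0| + |e1|) := by
    refine (key _ _).trans (le_trans ?_ (b1 e0 e1))
    rw [abs_div, abs_div, abs_of_pos hD, abs_of_pos (by positivity : 0 < D ^ 2), add_comm]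
    gcongr
    exact b0 e0 e1
  have bN : |p| + |q| ≤ c2 * ‖N‖ := by
    have hp : |p| ≤ ‖N‖ := by
      have := Complex.abs_re_le_norm N
      simpa [hN] using this
    have hy : |Y| ≤ ‖N‖ := by
      have := Complex.abs_im_le_norm N
      simpa [hN] using this
    have hq : q = (D * Y - m * p) / s22 := by rw [hY]; field_simp; ring
    have hq2 : |q| ≤ (D + |m|) / s22 * ‖N‖ := by
      rw [hq, abs_div, abs_of_pos h22, div_mul_eq_mul_div]
      gcongr
      refine (abs_sub _ _).trans ?_
      rw [abs_mul, abs_mul, abs_of_pos hD, add_mul]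
      gcongr
    rw [hc2]; linarith
  have hpq : 0 ≤ |p| + |q| := by positivity
  have hE : c1 * (|e0| + |e1|) ≤ c1 * c2 * τ * ‖N‖ := by
    calc _ ≤ c1 * (τ * (c2 * ‖N‖)) := by gcongr; exact he.trans (by gcongr)
      _ = _ := by ring
  have hN1 : ‖N‖ ≤ ‖f1 - Complex.I * f2‖ := by
    rw [E2]
    have h1 := norm_sub_le_norm_add (2 * N) Em
    have h2 : ‖2 * N‖ = 2 * ‖N‖ := by simp
    have h3 : c1 * c2 * τ * ‖N‖ ≤ 1 * ‖N‖ := by gcongr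
    linarith
  rw [E1]
  calc _ ≤ c1 * c2 * τ * ‖N‖ := bp.trans hE
    _ ≤ _ := by gcongr

end
end

section
open MeasureTheory Set
open scoped Topology NNReal

noncomputable section

lemma e2_expand (v : E2) : v = v 0 • e2 0 + v 1 • e2 1 := by
  ext i
  fin_cases i <;> simp [e2]

lemma clm_expand (l : E2 →L[ℝ] ℝ) (v : E2) : l v = v 0 * l (e2 0) + v 1 * l (e2 1) := by
  conv_lhs => rw [e2_expand v]
  simp

/-- flux components -/
def flux (σ : E2 → Matrix (Fin 2) (Fin 2) ℝ) (u : E2 → ℝ) (k : Fin 2) (x : E2) : ℝ :=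
  ∑ j, σ x k j * fderiv ℝ u x (e2 j)

/-- rotated flux form -/
def fluxForm (σ : E2 → Matrix (Fin 2) (Fin 2) ℝ) (u : E2 → ℝ) (x : E2) : E2 →L[ℝ] ℝ :=
  flux σ u 0 x • (EuclideanSpace.proj (1 : Fin 2) : E2 →L[ℝ] ℝ) -
    flux σ u 1 x • (EuclideanSpace.proj (0 : Fin 2) : E2 →L[ℝ] ℝ)

lemma fluxForm_apply (σ : E2 → Matrix (Fin 2) (Fin 2) ℝ) (u : E2 → ℝ) (x w : E2) :
    fluxForm σ u x w = flux σ u 0 x * w 1 - flux σ u 1 x * w 0 := by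
  simp [fluxForm]

lemma fluxForm_weak {G : Set E2} {σ : E2 → Matrix (Fin 2) (Fin 2) ℝ} {u : E2 → ℝ}
    (hsol : ∀ φ : E2 → ℝ, IsTestOn G φ →
      ∫ x in G, ∑ k, (∑ j, σ x k j * fderiv ℝ u x (e2 j)) * fderiv ℝ φ x (e2 k) = 0) :
    ∀ φ : E2 → ℝ, IsTestOn G φ → ∀ v w : E2,
      ∫ y in G, (fderiv ℝ φ y v * fluxForm σ u y w - fderiv ℝ φ y w * fluxForm σ u y v) = 0 := by
  intro φ hφ v w
  have h := hsol φ hφ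
  have e : ∀ y, fderiv ℝ φ y v * fluxForm σ u y w - fderiv ℝ φ y w * fluxForm σ u y v =
      (v 0 * w 1 - v 1 * w 0) * ∑ k, (∑ j, σ y k j * fderiv ℝ u y (e2 j)) * fderiv ℝ φ y (e2 k) := by
    intro y
    rw [fluxForm_apply, fluxForm_apply, clm_expand _ v, clm_expand _ w, Fin.sum_univ_two]
    unfold flux
    ring
  simp_rw [e]
  rw [integral_const_mul, h, mul_zero]

lemma holder_cont {G : Set E2} {s : E2 → ℝ} {α : ℝ≥0} (hα0 : 0 < α)
    (h : ∀ x ∈ G, ∃ t ∈ 𝓝[G] x, ∃ C : ℝ≥0, HolderOnWith C α s t) : ContinuousOn s G := by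
  intro x hx
  obtain ⟨t, ht, C, hC⟩ := h x hx
  exact (hC.continuousOn hα0 x (mem_of_mem_nhdsWithin hx ht)).mono_of_mem_nhdsWithin ht

lemma fluxForm_cont {G : Set E2} (hG : IsOpen G) {σ : E2 → Matrix (Fin 2) (Fin 2) ℝ} {u : E2 → ℝ}
    (hσ : ∀ i j, ContinuousOn (fun y => σ y i j) G) (hu : ContDiffOn ℝ 1 u G) :
    ContinuousOn (fluxForm σ u) G := by
  have hdu := hu.continuousOn_fderiv_of_isOpen hG le_rfl
  have hf : ∀ k, ContinuousOn (flux σ u k) G := by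
    intro k
    unfold flux
    exact continuousOn_finsetSum _ fun j _ => (hσ k j).mul (hdu.clm_apply continuousOn_const)
  unfold fluxForm
  exact ((hf 0).smul continuousOn_const).sub ((hf 1).smul continuousOn_const)

/-- shear coordinates -/
def shear (b c : ℝ) (hc : c ≠ 0) : ℂ ≃L[ℝ] E2 :=
  LinearEquiv.toContinuousLinearEquiv
    { toFun := fun z => !₂[z.re + b * z.im, c * z.im]
      invFun := fun w => ⟨w 0 - b / c * w 1, w 1 / c⟩
      map_add' := fun z w => by ext i; fin_cases i <;> simp <;> ring
      map_smul' := fun r z => by ext i; fin_cases i <;> simp <;> ring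
      left_inv := fun z => by
        apply Complex.ext
        · simp; field_simp; ring
        · simp; field_simp
      right_inv := fun w => by
        ext i
        fin_cases i
        · simp; field_simp; ring
        · simp; field_simp }

lemma shear_apply (b c : ℝ) (hc : c ≠ 0) (z : ℂ) :
    shear b c hc z = !₂[z.re + b * z.im, c * z.im] := rfl

/-- pairing of two real forms into a complex valued one -/
def cmk (p q : ℂ →L[ℝ] ℝ) : ℂ →L[ℝ] ℂ :=
  Complex.ofRealCLM.comp p + Complex.I • (Complex.ofRealCLM.comp q)

lemma cmk_apply (p q : ℂ →L[ℝ] ℝ) (v : ℂ) : cmk p q v = (p v : ℂ) + Complex.I * (q v : ℂ) := by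
  simp [cmk]

lemma cmk_deriv {U W : ℂ → ℝ} {p q : ℂ →L[ℝ] ℝ} {z : ℂ} (hU : HasFDerivAt U p z)
    (hW : HasFDerivAt W q z) :
    HasFDerivAt (fun z => (U z : ℂ) + Complex.I * (W z : ℂ)) (cmk p q) z := by
  have h1 : HasFDerivAt (fun z => (U z : ℂ)) (Complex.ofRealCLM.comp p) z :=
    Complex.ofRealCLM.hasFDerivAt.comp z hU
  have h2 : HasFDerivAt (fun z => (W z : ℂ)) (Complex.ofRealCLM.comp q) z :=
    Complex.ofRealCLM.hasFDerivAt.comp z hW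
  exact h1.add (h2.const_smul Complex.I)

lemma cmk_cont {X : Type} [TopologicalSpace X] {s : Set X} {p q : X → ℂ →L[ℝ] ℝ}
    (hp : ContinuousOn p s) (hq : ContinuousOn q s) : ContinuousOn (fun x => cmk (p x) (q x)) s := by
  unfold cmk
  have h1 : ContinuousOn (fun x => Complex.ofRealCLM.comp (p x)) s := continuousOn_const.clm_comp hp
  have h2 : ContinuousOn (fun x => Complex.ofRealCLM.comp (q x)) s := continuousOn_const.clm_comp hq
  have h3 : ContinuousOn (fun x => Complex.I • Complex.ofRealCLM.comp (q x)) s :=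
    h2.const_smul Complex.I
  exact h1.add h3

end
end

section
open MeasureTheory Set
open scoped Topology NNReal

noncomputable section

lemma coords {G : Set E2} (hG : IsOpen G) {K : ℝ} (hK : 1 ≤ K)
    {σ : E2 → Matrix (Fin 2) (Fin 2) ℝ}
    (hell : ∀ x ∈ G, ∀ ξ : Fin 2 → ℝ, K⁻¹ * (ξ 0 ^ 2 + ξ 1 ^ 2) ≤ ∑ i, (σ x).mulVec ξ i * ξ i)
    {α : ℝ≥0} (hα0 : 0 < α) (hα1 : α < 1)
    (hHolder : ∀ i j : Fin 2, ∀ x ∈ G, ∃ s ∈ 𝓝[G] x, ∃ C : ℝ≥0,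
      HolderOnWith C α (fun y => σ y i j) s)
    {u : E2 → ℝ} (hureg : ContDiffOn ℝ 1 u G)
    (hsol : ∀ φ : E2 → ℝ, IsTestOn G φ →
      ∫ x in G, ∑ k, (∑ j, σ x k j * fderiv ℝ u x (e2 j)) * fderiv ℝ φ x (e2 k) = 0)
    {x0 : E2} (hx0 : x0 ∈ G) (hcrit : fderiv ℝ u x0 = 0) :
    ∃ (L : ℂ ≃L[ℝ] E2) (f : ℂ → ℂ) (f' : ℂ → ℂ →L[ℝ] ℂ) (C R : ℝ),
      LocQC f f' C α R ∧ f' 0 = 0 ∧ (∀ z, (f z).re = u (x0 + L z) - u x0) := by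
  -- coefficients at the base point
  set s11 := σ x0 0 0 with h11
  set s12 := σ x0 0 1 with h12
  set s21 := σ x0 1 0 with h21
  set s22 := σ x0 1 1 with h22
  obtain ⟨m, hm⟩ : ∃ m, m = (s12 + s21) / 2 := ⟨_, rfl⟩
  obtain ⟨a, ha⟩ : ∃ a, a = (s12 - s21) / 2 := ⟨_, rfl⟩
  have hquad : ∀ b c : ℝ, K⁻¹ * (b ^ 2 + c ^ 2) ≤ s11 * b ^ 2 + 2 * m * b * c + s22 * c ^ 2 := by
    intro b c
    have := hell x0 hx0 ![b, c]
    simp only [Matrix.mulVec, dotProduct, Fin.sum_univ_two, Matrix.cons_val_zero,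
      Matrix.cons_val_one] at this
    refine this.trans (le_of_eq ?_)
    rw [hm]; ring
  have hKi : 0 < K⁻¹ := inv_pos.2 (by linarith)
  have p22 : 0 < s22 := by
    have := hquad 0 1
    norm_num at this
    linarith
  have pD : 0 < s11 * s22 - m ^ 2 := by
    have h1 := hquad s22 (-m)
    have h2 : 0 < K⁻¹ * (s22 ^ 2 + (-m) ^ 2) := by positivity
    have h3 : 0 < s22 * (s11 * s22 - m ^ 2) := by nlinarith
    exact pos_of_mul_pos_right h3 p22.le
  obtain ⟨D, hD, hD2⟩ : ∃ D : ℝ, 0 < D ∧ D ^ 2 = s11 * s22 - m ^ 2 :=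
    ⟨Real.sqrt (s11 * s22 - m ^ 2), Real.sqrt_pos.2 pD, Real.sq_sqrt pD.le⟩
  obtain ⟨c, hc, halg⟩ := coord_alg hm ha hD hD2 p22
  set L := shear (m / D) (s22 / D) (by positivity) with hL
  have hLI : L Complex.I = !₂[m / D, s22 / D] := by rw [hL, shear_apply]; simp
  have hL1 : L 1 = !₂[1, 0] := by rw [hL, shear_apply]; simp
  -- stream function
  obtain ⟨r2, hr2, hrG⟩ := Metric.nhds_basis_closedBall.mem_iff.1 (hG.mem_nhds hx0)
  have hσc : ∀ i j, ContinuousOn (fun y => σ y i j) G := fun i j => holder_cont hα0 (hHolder i j)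
  have hωc := fluxForm_cont hG hσc hureg
  obtain ⟨V, hV⟩ := stream_exists hωc (fluxForm_weak hsol) (x0 := x0) (r := r2 / 2) (by positivity)
    (by convert hrG using 2; ring)
  have hdu : ContinuousOn (fderiv ℝ u) G := hureg.continuousOn_fderiv_of_isOpen hG le_rfl
  have hu' : ∀ x ∈ G, HasFDerivAt u (fderiv ℝ u x) x := fun x hx =>
    ((hureg.differentiableOn one_ne_zero).differentiableAt (hG.mem_nhds hx)).hasFDerivAt
  set Ψ : ℂ → E2 := fun z => x0 + L z with hΨ
  have hΨc : Continuous Ψ := continuous_const.add L.continuous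
  have hΨ0 : Ψ 0 = x0 := by simp [hΨ]
  have hΨd : ∀ z, HasFDerivAt Ψ (L : ℂ →L[ℝ] E2) z := fun z => (L.hasFDerivAt).const_add x0
  set p : ℂ → ℂ →L[ℝ] ℝ := fun z => (fderiv ℝ u (Ψ z)).comp (L : ℂ →L[ℝ] E2) with hp
  set q : ℂ → ℂ →L[ℝ] ℝ := fun z => D⁻¹ • ((fluxForm σ u (Ψ z)).comp (L : ℂ →L[ℝ] E2) - a • p z) with hq
  set f : ℂ → ℂ := fun z => ((u (Ψ z) - u x0 : ℝ) : ℂ) + Complex.I *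
    ((D⁻¹ * ((V (Ψ z) - a * u (Ψ z)) - (V x0 - a * u x0)) : ℝ) : ℂ) with hf
  set f' : ℂ → ℂ →L[ℝ] ℂ := fun z => cmk (p z) (q z) with hf'
  have hH : ∃ M : ℝ, 0 ≤ M ∧ ∀ᶠ x in 𝓝 x0, ∀ i j, |σ x i j - σ x0 i j| ≤ M * dist x x0 ^ (α:ℝ) := by
    have h1 : ∀ i j, ∃ M : ℝ, 0 ≤ M ∧ ∀ᶠ x in 𝓝 x0, |σ x i j - σ x0 i j| ≤ M * dist x x0 ^ (α:ℝ) := by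
      intro i j
      obtain ⟨t, ht, C, hC⟩ := hHolder i j x0 hx0
      refine ⟨C, C.2, ?_⟩
      have ht' : t ∈ 𝓝 x0 := by rwa [hG.nhdsWithin_eq hx0] at ht
      filter_upwards [ht'] with x hx
      exact hC.dist_le hx (mem_of_mem_nhds ht')
    choose M hM0 hM using h1
    refine ⟨∑ i, ∑ j, M i j, Finset.sum_nonneg fun i _ => Finset.sum_nonneg fun j _ => hM0 i j, ?_⟩
    have h2 : ∀ᶠ x in 𝓝 x0, ∀ i j, |σ x i j - σ x0 i j| ≤ M i j * dist x x0 ^ (α:ℝ) :=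
      Filter.eventually_all.2 fun i => Filter.eventually_all.2 fun j => hM i j
    filter_upwards [h2] with x hx i j
    refine (hx i j).trans (mul_le_mul_of_nonneg_right ?_ (by positivity))
    refine (Finset.single_le_sum (f := fun j => M i j) (fun j _ => hM0 i j) (Finset.mem_univ j)).trans ?_
    exact Finset.single_le_sum (f := fun i => ∑ j, M i j)
      (fun i _ => Finset.sum_nonneg fun j _ => hM0 i j) (Finset.mem_univ i)
  obtain ⟨M, hM0, hM⟩ := hH
  set l := ‖(L : ℂ →L[ℝ] E2)‖ with hl
  set C0 := 2 * M * l ^ (α:ℝ) with hC0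
  have hC00 : 0 ≤ C0 := by positivity
  have hα0' : (0:ℝ) < α := hα0
  -- choose the radius
  have hΨt : Filter.Tendsto Ψ (𝓝 0) (𝓝 x0) := by
    have := hΨc.tendsto 0; rwa [hΨ0] at this
  have hball : ∀ᶠ z in 𝓝 (0:ℂ), Ψ z ∈ Metric.ball x0 (r2 / 2) :=
    hΨt (Metric.ball_mem_nhds x0 (by positivity))
  have hsmall : ∀ᶠ z in 𝓝 (0:ℂ), c * (C0 * ‖z‖ ^ (α:ℝ)) ≤ 1 := by
    have h1 : Filter.Tendsto (fun z : ℂ => c * (C0 * ‖z‖ ^ (α:ℝ))) (𝓝 0)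
        (𝓝 (c * (C0 * ‖(0:ℂ)‖ ^ (α:ℝ)))) :=
      (((continuous_norm.tendsto (0:ℂ)).rpow_const (Or.inr hα0'.le)).const_mul C0).const_mul c
    rw [norm_zero, Real.zero_rpow hα0'.ne', mul_zero, mul_zero] at h1
    filter_upwards [h1.eventually (gt_mem_nhds (zero_lt_one))] with z hz using hz.le
  have hsubG : Metric.ball x0 (r2 / 2) ⊆ G := fun x hx =>
    hrG (Metric.ball_subset_closedBall (Metric.ball_subset_ball (by linarith) hx))
  have hpc : ∀ s : Set ℂ, MapsTo Ψ s G → ContinuousOn p s := fun s hs =>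
    (hdu.comp hΨc.continuousOn hs).clm_comp continuousOn_const
  have hqc : ∀ s : Set ℂ, MapsTo Ψ s G → ContinuousOn q s := fun s hs => by
    have h1 : ContinuousOn (fun z => (fluxForm σ u (Ψ z)).comp (L : ℂ →L[ℝ] E2)) s :=
      (hωc.comp hΨc.continuousOn hs).clm_comp continuousOn_const
    have h2 : ContinuousOn (fun z => a • p z) s := (hpc s hs).const_smul a
    exact (h1.sub h2).const_smul D⁻¹
  have hfd : ∀ z, Ψ z ∈ Metric.ball x0 (r2 / 2) → HasFDerivAt f (f' z) z := by
    intro z hz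
    have h1 : HasFDerivAt (fun z => u (Ψ z)) (p z) z := (hu' _ (hsubG hz)).comp z (hΨd z)
    have h2 : HasFDerivAt (fun z => V (Ψ z)) ((fluxForm σ u (Ψ z)).comp (L : ℂ →L[ℝ] E2)) z :=
      (hV _ hz).comp z (hΨd z)
    exact cmk_deriv (h1.sub_const _) (((h2.sub (h1.const_mul a)).sub_const _).const_mul D⁻¹)
  have hflux0 : fluxForm σ u x0 = 0 := by
    ext w; rw [fluxForm_apply]; simp [flux, hcrit]
  have hf'0 : f' 0 = 0 := by
    ext v <;> simp [hf', cmk_apply, hp, hq, hΨ0, hcrit, hflux0]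
  have hf0 : f 0 = 0 := by simp [hf, hΨ0]
  have hΨU : IsOpen (Ψ ⁻¹' G) := hG.preimage hΨc
  have hf'c : ContinuousOn f' (Ψ ⁻¹' G) :=
    cmk_cont (hpc _ (mapsTo_preimage _ _)) (hqc _ (mapsTo_preimage _ _))
  have h0U : (0:ℂ) ∈ Ψ ⁻¹' G := by rw [mem_preimage, hΨ0]; exact hx0
  have hf'1 : ∀ᶠ z in 𝓝 (0:ℂ), ‖f' z‖ < 1 := by
    have h1 := ((hf'c.continuousAt (hΨU.mem_nhds h0U)).norm).tendsto
    rw [hf'0, norm_zero] at h1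
    exact h1.eventually (gt_mem_nhds zero_lt_one)
  have hf1 : ∀ᶠ z in 𝓝 (0:ℂ), ‖f z‖ < 1 / 2 := by
    have h1 := ((hfd 0 hball.self_of_nhds).continuousAt.norm).tendsto
    rw [hf0, norm_zero] at h1
    exact h1.eventually (gt_mem_nhds (by norm_num))
  obtain ⟨R, hR, hRb⟩ := Metric.eventually_nhds_iff_ball.1
    (((hball.and hsmall).and (hf'1.and hf1)).and (hΨt.eventually hM))
  refine ⟨L, f, f', c * C0, R, ⟨hR, hα0', (by exact_mod_cast hα1.le), by positivity,
    fun z hz => hfd z (hRb z hz).1.1.1, hf'c.mono fun z hz => hsubG (hRb z hz).1.1.1, ?_, hf0,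
    fun z hz => (hRb z hz).1.2.2.le, fun z hz => (hRb z hz).1.2.1.le⟩, hf'0, ?_⟩
  · intro z hz
    obtain ⟨⟨⟨hz1, hz2⟩, -⟩, hz3⟩ := hRb z hz
    set x := Ψ z with hx
    set P := fderiv ℝ u x (e2 0) with hP
    set Q := fderiv ℝ u x (e2 1) with hQ
    set τ := C0 * ‖z‖ ^ (α:ℝ) with hτ
    have hdist : dist x x0 ^ (α:ℝ) ≤ l ^ (α:ℝ) * ‖z‖ ^ (α:ℝ) := by
      rw [← Real.mul_rpow (by positivity) (by positivity)]
      refine Real.rpow_le_rpow dist_nonneg ?_ hα0'.le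
      rw [dist_eq_norm, hx, hΨ, add_sub_cancel_left]
      exact (L : ℂ →L[ℝ] E2).le_opNorm z
    have hb : ∀ i j, |σ x i j - σ x0 i j| ≤ τ / 2 := by
      intro i j
      refine (hz3 i j).trans ((mul_le_mul_of_nonneg_left hdist hM0).trans (le_of_eq ?_))
      rw [hτ, hC0]; ring
    set E0 := (σ x 0 0 - s11) * P + (σ x 0 1 - s12) * Q with hE0
    set E1 := (σ x 1 0 - s21) * P + (σ x 1 1 - s22) * Q with hE1
    have hbE : |E0| + |E1| ≤ τ * (|P| + |Q|) := by
      have h1 : ∀ i, |(σ x i 0 - σ x0 i 0) * P + (σ x i 1 - σ x0 i 1) * Q| ≤ τ / 2 * (|P| + |Q|) := by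
        intro i
        refine (abs_add_le _ _).trans ?_
        rw [abs_mul, abs_mul, mul_add]
        gcongr
        · exact hb i 0
        · exact hb i 1
      have := h1 0
      have := h1 1
      linarith
    have hF0 : flux σ u 0 x = s11 * P + s12 * Q + E0 := by
      unfold flux; rw [Fin.sum_univ_two, hE0]; ring
    have hF1 : flux σ u 1 x = s21 * P + s22 * Q + E1 := by
      unfold flux; rw [Fin.sum_univ_two, hE1]; ring
    have := halg P Q E0 E1 τ (by positivity) hz2 hbE (f' z 1) (f' z Complex.I) ?_ ?_
    · calc _ ≤ _ := this
        _ = _ := by rw [hτ]; ring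
    · have e1 : p z 1 = P := by
        simp only [hp, ContinuousLinearMap.comp_apply, ContinuousLinearEquiv.coe_coe, hL1]
        rw [clm_expand]; simp [← hx, hP]
      have e2 : fluxForm σ u x (L 1) = -(s21 * P + s22 * Q + E1) := by
        rw [fluxForm_apply, hL1, hF1]; simp
      rw [hf']
      simp only [cmk_apply, e1]
      congr 3
      simp only [hq, smul_apply, sub_apply, ContinuousLinearMap.comp_apply,
        ContinuousLinearEquiv.coe_coe, smul_eq_mul, e1, ← hx, e2]
      ring
    · have e1 : p z Complex.I = m / D * P + s22 / D * Q := by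
        simp only [hp, ContinuousLinearMap.comp_apply, ContinuousLinearEquiv.coe_coe, hLI]
        rw [clm_expand]; simp [← hx, hP, hQ]
      have e2 : fluxForm σ u x (L Complex.I) =
          m / D * -(s21 * P + s22 * Q + E1) + s22 / D * (s11 * P + s12 * Q + E0) := by
        rw [fluxForm_apply, hLI, hF1, hF0]; simp; ring
      rw [hf']
      simp only [cmk_apply, e1]
      congr 3
      simp only [hq, smul_apply, sub_apply, ContinuousLinearMap.comp_apply,
        ContinuousLinearEquiv.coe_coe, smul_eq_mul, e1, ← hx, e2]
      ring
  · intro z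
    simp [hf, hΨ]

end
end

section
open MeasureTheory Set
open scoped Topology NNReal

noncomputable section

/-- Ray positivity of `u - u x0` in the linear coordinate `L` at `x0`. -/
def URay (u : E2 → ℝ) (x0 : E2) (L : ℂ ≃L[ℝ] E2) (s x : ℝ) : Prop :=
  ∀ᶠ r : ℝ in 𝓝[>] (0:ℝ), 0 < s * (u (x0 + L ((r:ℂ) * Complex.exp (x * Complex.I))) - u x0)

/-- Local structure at a critical point. -/
def CritStr (u : E2 → ℝ) (x0 : E2) : Prop :=
  ∃ L : ℂ ≃L[ℝ] E2,
    (∀ U : Set ℝ, IsOpen U → (U ∩ Ioo 0 (2 * Real.pi)).Nonempty →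
      ∃ x ∈ U, URay u x0 L 1 x ∨ URay u x0 L (-1) x) ∧
    ∃ a1 a2 a3 a4 : ℝ, a1 < a2 ∧ a2 < a3 ∧ a3 < a4 ∧ a4 < a1 + 2 * Real.pi ∧
      URay u x0 L 1 a1 ∧ URay u x0 L (-1) a2 ∧ URay u x0 L 1 a3 ∧ URay u x0 L (-1) a4

lemma critStr_of_coords {u : E2 → ℝ} {x0 : E2} {L : ℂ ≃L[ℝ] E2} {f : ℂ → ℂ}
    {f' : ℂ → ℂ →L[ℝ] ℂ} {C α R : ℝ} (h : LocQC f f' C α R) (hf0 : f' 0 = 0)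
    (hre : ∀ z, (f z).re = u (x0 + L z) - u x0)
    (hnc : ¬ ∀ᶠ x in 𝓝 x0, u x = u x0) : CritStr u x0 := by
  have hne : ∃ᶠ z in 𝓝 (0:ℂ), f z ≠ 0 := by
    by_contra hc
    rw [Filter.not_frequently] at hc
    apply hnc
    have ht : Filter.Tendsto (fun x : E2 => L.symm (x - x0)) (𝓝 x0) (𝓝 0) := by
      have : Continuous (fun x : E2 => L.symm (x - x0)) := by fun_prop
      have h2 := this.tendsto x0
      simpa using h2
    filter_upwards [ht.eventually hc] with x hx
    have h1 := hre (L.symm (x - x0))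
    have h2 : f (L.symm (x - x0)) = 0 := by simpa using hx
    rw [h2] at h1
    simp at h1
    linarith
  have hP : ∀ x, RayP f x → URay u x0 L 1 x := by
    intro x hx
    refine hx.mono fun r hr => ?_
    rw [hre] at hr; linarith
  have hN : ∀ x, RayN f x → URay u x0 L (-1) x := by
    intro x hx
    refine hx.mono fun r hr => ?_
    rw [hre] at hr; linarith
  refine ⟨L, fun U hU hUne => ?_, ?_⟩
  · obtain ⟨x, hx, h1⟩ := h.dense hne hf0 hU hUne
    exact ⟨x, hx, h1.imp (hP x) (hN x)⟩
  · obtain ⟨a1, a2, a3, a4, h12, h23, h34, h41, r1, r2, r3, r4⟩ := h.four hne hf0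
    exact ⟨a1, a2, a3, a4, h12, h23, h34, h41, hP _ r1, hN _ r2, hP _ r3, hN _ r4⟩

lemma ray_tendsto (x0 : E2) (L : ℂ ≃L[ℝ] E2) (x : ℝ) :
    Filter.Tendsto (fun r : ℝ => x0 + L ((r:ℂ) * Complex.exp (x * Complex.I))) (𝓝[>] 0) (𝓝 x0) := by
  have : Continuous (fun r : ℝ => x0 + L ((r:ℂ) * Complex.exp (x * Complex.I))) := by fun_prop
  have h2 := this.tendsto 0
  simp only [Complex.ofReal_zero, zero_mul, map_zero, add_zero] at h2
  exact h2.mono_left nhdsWithin_le_nhds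

lemma CritStr.not_max {u : E2 → ℝ} {x0 : E2} (h : CritStr u x0) : ¬ IsLocalMax u x0 := by
  obtain ⟨L, -, a1, a2, a3, a4, -, -, -, -, h1, -, -, -⟩ := h
  intro hm
  have := (ray_tendsto x0 L a1).eventually hm
  obtain ⟨r, hr1, hr2⟩ := (this.and h1).exists
  linarith

lemma CritStr.not_min {u : E2 → ℝ} {x0 : E2} (h : CritStr u x0) : ¬ IsLocalMin u x0 := by
  obtain ⟨L, -, a1, a2, a3, a4, -, -, -, -, -, h1, -, -⟩ := h
  intro hm
  have := (ray_tendsto x0 L a2).eventually hm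
  obtain ⟨r, hr1, hr2⟩ := (this.and h1).exists
  linarith

/-- Unique continuation. -/
lemma nowhere_const {G : Set E2} (hG : IsOpen G) (hGc : IsConnected G) {u : E2 → ℝ}
    (hureg : ContDiffOn ℝ 1 u G)
    (hcrit : ∀ x0 ∈ G, fderiv ℝ u x0 = 0 → (¬ ∀ᶠ x in 𝓝 x0, u x = u x0) → CritStr u x0)
    (hncst : ¬ ∃ c, ∀ x ∈ G, u x = c) : ∀ x0 ∈ G, ¬ ∀ᶠ x in 𝓝 x0, u x = u x0 := by
  intro y0 hy0 hcy
  have hdiff : ∀ x ∈ G, DifferentiableAt ℝ u x := fun x hx =>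
    (hureg.differentiableOn one_ne_zero).differentiableAt (hG.mem_nhds hx)
  have hcu : ∀ x ∈ G, ContinuousAt u x := fun x hx => (hdiff x hx).continuousAt
  set Z : Set E2 := {x | x ∈ G ∧ ∀ᶠ y in 𝓝 x, u y = u x} with hZ
  have hZo : IsOpen Z := by
    rw [isOpen_iff_mem_nhds]
    rintro x ⟨hx, hx2⟩
    filter_upwards [hG.mem_nhds hx, hx2, hx2.eventually_nhds] with y h1 h2 h3
    exact ⟨h1, h3.mono fun w hw => by rw [hw, h2]⟩
  by_cases hsub : G ⊆ Z
  · -- locally constant on connected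
    apply hncst
    refine ⟨u y0, fun x hx => ?_⟩
    have hpre := hGc.isPreconnected
    have hV : IsOpen {x | x ∈ Z ∧ u x = u y0} := by
      rw [isOpen_iff_mem_nhds]
      rintro x ⟨hx, hx2⟩
      filter_upwards [hZo.mem_nhds hx, hx.2] with y h1 h2
      exact ⟨h1, h2.trans hx2⟩
    have hW : IsOpen {x | x ∈ Z ∧ u x ≠ u y0} := by
      rw [isOpen_iff_mem_nhds]
      rintro x ⟨hx, hx2⟩
      filter_upwards [hZo.mem_nhds hx, hx.2] with y h1 h2
      exact ⟨h1, by rw [h2]; exact hx2⟩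
    by_contra hne
    obtain ⟨w, -, hw1, hw2⟩ := hpre _ _ hV hW (fun w hw => by
      by_cases h : u w = u y0
      · exact Or.inl ⟨hsub hw, h⟩
      · exact Or.inr ⟨hsub hw, h⟩) ⟨y0, hy0, hsub hy0, rfl⟩ ⟨x, hx, hsub hx, hne⟩
    exact hw2.2 hw1.2
  · -- boundary point
    have hZne : Z.Nonempty := ⟨y0, hy0, hcy⟩
    have hfr : ∃ b ∈ G, b ∈ closure Z ∧ b ∉ Z := by
      by_contra hcon
      push Not at hcon
      apply hsub
      obtain ⟨w, hwG, hwZ⟩ := not_subset.1 hsub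
      obtain ⟨v, -, hv1, hv2⟩ := hGc.isPreconnected Z (closure Z)ᶜ hZo isClosed_closure.isOpen_compl
        (fun x hx => by
          by_cases h : x ∈ closure Z
          · exact Or.inl (hcon x hx h)
          · exact Or.inr h) ⟨y0, hy0, hy0, hcy⟩ ⟨w, hwG, fun h => hwZ (hcon w hwG h)⟩
      exact absurd (subset_closure hv1) hv2
    obtain ⟨b, hbG, hbZ, hbnZ⟩ := hfr
    obtain ⟨ρ, hρ, hball⟩ := Metric.isOpen_iff.1 hG b hbG
    obtain ⟨y, hyZ, hyb⟩ := Metric.mem_closure_iff.1 hbZ (ρ / 2) (by linarith)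
    -- distance from y to complement of Z
    set d := Metric.infDist y Zᶜ with hd
    have hZc : IsClosed Zᶜ := hZo.isClosed_compl
    obtain ⟨x0, hx0Z, hx0d⟩ := hZc.exists_infDist_eq_dist ⟨b, hbnZ⟩ y
    have hdle : dist y x0 ≤ dist y b := by
      rw [← hx0d]; exact Metric.infDist_le_dist_of_mem hbnZ
    have hx0G : x0 ∈ G := by
      apply hball
      rw [Metric.mem_ball]
      have h1 := dist_triangle x0 y b
      rw [dist_comm x0 y] at h1
      rw [dist_comm] at hyb
      linarith
    have hdpos : 0 < dist y x0 := by
      rw [dist_pos]; rintro rfl; exact hx0Z hyZ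
    have hsubZ : Metric.ball y (dist y x0) ⊆ Z := by
      intro w hw
      by_contra hwZ
      have := Metric.infDist_le_dist_of_mem (x := y) (s := Zᶜ) hwZ
      rw [Metric.mem_ball, dist_comm] at hw
      linarith
    have hu_ball : ∀ w ∈ Metric.ball y (dist y x0), u w = u y := by
      intro w hw
      have hpre := (convex_ball y (dist y x0)).isPreconnected
      refine hpre.induction₂' (fun a b => u a = u b) ?_ ?_ hw (Metric.mem_ball_self hdpos)
      · intro a ha
        have := (hsubZ ha).2
        exact nhdsWithin_le_nhds (this.mono fun w hw => ⟨hw.symm, hw⟩)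
      · intro a b c _ _ _ h1 h2
        exact h1.trans h2
    have hx0cl : x0 ∈ closure (Metric.ball y (dist y x0)) := by
      rw [closure_ball _ hdpos.ne', Metric.mem_closedBall, dist_comm]
    have hux0 : u x0 = u y := by
      have h1 : (closure (Metric.ball y (dist y x0)) : Set E2) ∩ G ⊆ {x | u x = u y} := by
        rintro x ⟨hx, hxG⟩
        have hm : Filter.NeBot (𝓝[Metric.ball y (dist y x0)] x) := mem_closure_iff_nhdsWithin_neBot.1 hx
        have t1 : Filter.Tendsto u (𝓝[Metric.ball y (dist y x0)] x) (𝓝 (u x)) :=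
          (hcu x hxG).mono_left nhdsWithin_le_nhds
        have t2 : Filter.Tendsto u (𝓝[Metric.ball y (dist y x0)] x) (𝓝 (u y)) :=
          tendsto_const_nhds.congr' (by
            filter_upwards [self_mem_nhdsWithin] with w hw
            exact (hu_ball w hw).symm)
        exact tendsto_nhds_unique t1 t2
      exact h1 ⟨hx0cl, hx0G⟩
    have hdx0 : fderiv ℝ u x0 = 0 := by
      have hm : Filter.NeBot (𝓝[Metric.ball y (dist y x0)] x0) := mem_closure_iff_nhdsWithin_neBot.1 hx0cl
      have hcd : ContinuousAt (fderiv ℝ u) x0 :=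
        (hureg.continuousOn_fderiv_of_isOpen hG le_rfl).continuousAt (hG.mem_nhds hx0G)
      have t1 : Filter.Tendsto (fderiv ℝ u) (𝓝[Metric.ball y (dist y x0)] x0) (𝓝 (fderiv ℝ u x0)) :=
        hcd.mono_left nhdsWithin_le_nhds
      refine tendsto_nhds_unique t1 (tendsto_const_nhds.congr' ?_)
      filter_upwards [self_mem_nhdsWithin] with w hw
      have h1 : u =ᶠ[𝓝 w] fun _ => u w := (hsubZ hw).2
      rw [h1.fderiv_eq]; simp
    have hnc0 : ¬ ∀ᶠ x in 𝓝 x0, u x = u x0 := fun h => hx0Z ⟨hx0G, h⟩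
    obtain ⟨L, hdense, -⟩ := hcrit x0 hx0G hdx0 hnc0
    -- the open set of angles
    set U : Set ℝ := {t | 0 < inner ℝ (y - x0) (L (Complex.exp (t * Complex.I)))} with hU
    have hUo : IsOpen U := by
      apply isOpen_lt continuous_const
      fun_prop
    have hUne : (U ∩ Ioo 0 (2 * Real.pi)).Nonempty := by
      set z := L.symm (y - x0) with hz
      have hz0 : z ≠ 0 := by
        rw [hz]; simp only [ne_eq]
        rw [EmbeddingLike.map_eq_zero_iff, sub_eq_zero]
        rintro rfl; simp at hdpos
      have hLz : L z = y - x0 := by simp [hz]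
      have hU0 : toIocMod Real.two_pi_pos 0 (Complex.arg z) ∈ U := by
        have h1 : ∃ m : ℤ, toIocMod Real.two_pi_pos 0 (Complex.arg z) = Complex.arg z - m * (2 * Real.pi) :=
          ⟨toIocDiv Real.two_pi_pos 0 (Complex.arg z), by
            rw [toIocMod]; simp⟩
        obtain ⟨m, hm⟩ := h1
        have hexp : Complex.exp ((toIocMod Real.two_pi_pos 0 (Complex.arg z) : ℝ) * Complex.I)
            = Complex.exp (Complex.arg z * Complex.I) := by
          rw [hm, Complex.exp_eq_exp_iff_exists_int]
          exact ⟨-m, by push_cast; ring⟩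
        have hz2 : Complex.exp (Complex.arg z * Complex.I) = (‖z‖⁻¹ : ℝ) • z := by
          have this : (‖z‖ : ℂ) ≠ 0 := by simpa using hz0
          rw [Complex.real_smul, Complex.ofReal_inv, eq_inv_mul_iff_mul_eq₀ this]
          exact Complex.norm_mul_exp_arg_mul_I z
        change 0 < inner ℝ (y - x0) (L (Complex.exp (_ * Complex.I)))
        rw [hexp, hz2, map_smul, hLz, real_inner_smul_right, real_inner_self_eq_norm_sq]
        rw [dist_eq_norm] at hdpos
        have : 0 < ‖z‖ := by simpa using hz0
        positivity
      have hI := toIocMod_mem_Ioc Real.two_pi_pos 0 (Complex.arg z)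
      rw [zero_add] at hI
      set t := toIocMod Real.two_pi_pos 0 (Complex.arg z)
      have hcl : t ∈ closure (Ioo 0 (2 * Real.pi)) := by
        rw [closure_Ioo Real.two_pi_pos.ne]; exact Ioc_subset_Icc_self hI
      exact mem_closure_iff.1 hcl U hUo hU0
    obtain ⟨t, htU, htr⟩ := hdense U hUo hUne
    have hin : ∀ᶠ r : ℝ in 𝓝[>] 0, x0 + L ((r:ℂ) * Complex.exp (t * Complex.I)) ∈ Metric.ball y (dist y x0) := by
      set v := L (Complex.exp (t * Complex.I)) with hv
      have hv0 : 0 < inner ℝ (y - x0) v := htU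
      have hsmall : ∀ᶠ r : ℝ in 𝓝[>] 0, r * ‖v‖ ^ 2 < 2 * inner ℝ (y - x0) v := by
        have : Continuous fun r : ℝ => r * ‖v‖ ^ 2 := by fun_prop
        have h2 := this.tendsto 0
        simp only [zero_mul] at h2
        exact (h2.mono_left nhdsWithin_le_nhds).eventually (gt_mem_nhds (by linarith))
      filter_upwards [hsmall, self_mem_nhdsWithin] with r hr hr0
      have hr0 : 0 < r := hr0
      have e1 : L ((r:ℂ) * Complex.exp (t * Complex.I)) = r • v := by
        rw [hv, ← map_smul, Complex.real_smul]
      rw [e1, Metric.mem_ball, dist_comm, dist_eq_norm, dist_eq_norm]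
      apply lt_of_pow_lt_pow_left₀ 2 (norm_nonneg _)
      have : y - (x0 + r • v) = (y - x0) - r • v := by abel
      rw [this, norm_sub_sq_real, real_inner_smul_right, norm_smul, mul_pow, Real.norm_eq_abs, sq_abs]
      nlinarith
    rcases htr with h | h <;>
    · obtain ⟨r, h1, h2⟩ := (hin.and h).exists
      rw [hu_ball _ h1, hux0] at h2
      simp at h2

end
end

section
open MeasureTheory Set
open scoped Topology NNReal

noncomputable section

/-- Components of superlevel sets reach the boundary. -/
lemma comp_meets {G : Set E2} (hG : IsOpen G) (hb : Bornology.IsBounded G) {u : E2 → ℝ}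
    (hucont : ContinuousOn u (closure G)) (hmax : ∀ x ∈ G, ¬ IsLocalMax u x) {c : ℝ} {p : E2}
    (hp : p ∈ G) (hc : c ≤ u p) :
    ∃ A : Set E2, A ⊆ {x | x ∈ closure G ∧ c ≤ u x} ∧ IsCompact A ∧ IsPreconnected A ∧ p ∈ A ∧
      (A ∩ frontier G).Nonempty := by
  have hcomp : IsCompact (closure G) := hb.isCompact_closure
  set S : Set E2 := {x | x ∈ closure G ∧ c ≤ u x} with hS
  have hSc : IsClosed S := hucont.preimage_isClosed_of_isClosed isClosed_closure isClosed_Ici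
  have hSk : IsCompact S := hcomp.of_isClosed_subset hSc fun x hx => hx.1
  have : CompactSpace S := isCompact_iff_compactSpace.1 hSk
  have hpS : p ∈ S := ⟨subset_closure hp, hc⟩
  set q : S := ⟨p, hpS⟩ with hq
  refine ⟨Subtype.val '' connectedComponent q, ?_, ?_, ?_, ?_, ?_⟩
  · rintro _ ⟨x, -, rfl⟩; exact x.2
  · exact isClosed_connectedComponent.isCompact.image continuous_subtype_val
  · exact isPreconnected_connectedComponent.image _ continuous_subtype_val.continuousOn
  · exact ⟨q, mem_connectedComponent, rfl⟩
  · by_contra hemp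
    rw [not_nonempty_iff_eq_empty] at hemp
    set F : Set S := Subtype.val ⁻¹' (frontier G) with hF
    have hFk : IsCompact F := (isClosed_frontier.preimage continuous_subtype_val).isCompact
    have hdis : F ∩ ⋂ s : { s : Set S // IsClopen s ∧ q ∈ s }, (s : Set S) = ∅ := by
      rw [← connectedComponent_eq_iInter_isClopen]
      rw [eq_empty_iff_forall_notMem] at hemp ⊢
      rintro x ⟨hx1, hx2⟩
      exact hemp x ⟨⟨x, hx2, rfl⟩, hx1⟩
    have : Nonempty { s : Set S // IsClopen s ∧ q ∈ s } := ⟨⟨univ, isClopen_univ, mem_univ _⟩⟩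
    obtain ⟨⟨Z, hZ, hqZ⟩, hZF⟩ := hFk.elim_directed_family_closed
      (fun s : { s : Set S // IsClopen s ∧ q ∈ s } => (s : Set S)) (fun s => s.2.1.1)
      hdis (by
        rintro ⟨a, ha1, ha2⟩ ⟨b, hb1, hb2⟩
        exact ⟨⟨a ∩ b, ha1.inter hb1, ha2, hb2⟩, inter_subset_left, inter_subset_right⟩)
    set V : Set E2 := Subtype.val '' Z with hV
    have hVk : IsCompact V := hZ.1.isCompact.image continuous_subtype_val
    have hV'k : IsCompact (Subtype.val '' Zᶜ : Set E2) :=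
      hZ.compl.1.isCompact.image continuous_subtype_val
    have hVS : V ⊆ S := by rintro _ ⟨x, -, rfl⟩; exact x.2
    obtain ⟨x, hxV, hxm⟩ := hVk.exists_isMaxOn ⟨p, q, hqZ, rfl⟩
      (hucont.mono fun x hx => (hVS hx).1)
    have hxG : x ∈ G := by
      have h1 := (hVS hxV).1
      have h2 : x ∉ frontier G := by
        obtain ⟨y, hy, rfl⟩ := hxV
        intro h
        have : y ∈ F ∩ Z := ⟨h, hy⟩
        rw [hZF] at this; exact this
      by_contra h3
      exact h2 ⟨h1, by rwa [hG.interior_eq]⟩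
    apply hmax x hxG
    have hx' : x ∉ (Subtype.val '' Zᶜ : Set E2) := by
      rintro ⟨y, hy, rfl⟩
      obtain ⟨w, hw, hwy⟩ := hxV
      exact hy (Subtype.ext hwy ▸ hw)
    filter_upwards [hG.mem_nhds hxG, hV'k.isClosed.isOpen_compl.mem_nhds hx'] with y hyG hyZ
    by_cases hyS : y ∈ S
    · apply hxm
      by_contra hyV
      apply hyZ
      exact ⟨⟨y, hyS⟩, fun h => hyV ⟨_, h, rfl⟩, rfl⟩
    · have h1 : u y < c := by
        by_contra h
        exact hyS ⟨subset_closure hyG, not_lt.1 h⟩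
      exact h1.le.trans (hVS hxV).2

lemma unimodal_super {g : E2 → ℝ} {Γ : Set E2} (hg : UnimodalOn g Γ) (c : ℝ) :
    IsPreconnected {x | x ∈ Γ ∧ c ≤ g x} := by
  obtain ⟨-, -, φ, m, hm, hφ, -, -, himg, hmono, hanti⟩ := hg
  have hT : OrdConnected {t | t ∈ Icc (0:ℝ) 1 ∧ c ≤ g (φ t)} := by
    refine ⟨?_⟩
    rintro s ⟨hs, hs2⟩ t ⟨ht, ht2⟩ r ⟨hr1, hr2⟩
    refine ⟨⟨hs.1.trans hr1, hr2.trans ht.2⟩, ?_⟩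
    rcases le_total r m with h | h
    · exact hs2.trans (hmono ⟨hs.1, hr1.trans h⟩ ⟨hs.1.trans hr1, h⟩ hr1)
    · exact ht2.trans (hanti ⟨h, hr2.trans ht.2⟩ ⟨h.trans hr2, ht.2⟩ hr2)
  have : {x | x ∈ Γ ∧ c ≤ g x} = φ '' {t | t ∈ Icc (0:ℝ) 1 ∧ c ≤ g (φ t)} := by
    ext x
    rw [← himg]
    constructor
    · rintro ⟨⟨t, ht, rfl⟩, h⟩; exact ⟨t, ⟨ht, h⟩, rfl⟩
    · rintro ⟨t, ⟨ht, h⟩, rfl⟩; exact ⟨⟨t, ht, rfl⟩, h⟩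
  rw [this]
  exact hT.isPreconnected.image _ hφ.continuousOn

lemma unimodal_sub {g : E2 → ℝ} {Γ : Set E2} (hg : UnimodalOn g Γ) (c : ℝ) :
    IsPreconnected {x | x ∈ Γ ∧ g x ≤ c} := by
  obtain ⟨-, -, φ, m, hm, hφ, hper, -, himg, hmono, hanti⟩ := hg
  have h01 : φ 1 = φ 0 := by simpa using hper 0
  have hT1 : OrdConnected {t | t ∈ Icc (0:ℝ) m ∧ g (φ t) ≤ c} := by
    refine ⟨?_⟩
    rintro s ⟨hs, hs2⟩ t ⟨ht, ht2⟩ r ⟨hr1, hr2⟩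
    have hr : r ∈ Icc 0 m := ⟨hs.1.trans hr1, hr2.trans ht.2⟩
    exact ⟨hr, (hmono hr ht hr2).trans ht2⟩
  have hT2 : OrdConnected {t | t ∈ Icc m (1:ℝ) ∧ g (φ t) ≤ c} := by
    refine ⟨?_⟩
    rintro s ⟨hs, hs2⟩ t ⟨ht, ht2⟩ r ⟨hr1, hr2⟩
    have hr : r ∈ Icc m 1 := ⟨hs.1.trans hr1, hr2.trans ht.2⟩
    exact ⟨hr, (hanti hs hr hr1).trans hs2⟩
  have heq : {x | x ∈ Γ ∧ g x ≤ c} = φ '' {t | t ∈ Icc (0:ℝ) m ∧ g (φ t) ≤ c} ∪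
      φ '' {t | t ∈ Icc m (1:ℝ) ∧ g (φ t) ≤ c} := by
    ext x
    rw [← himg]
    constructor
    · rintro ⟨⟨t, ht, rfl⟩, h⟩
      rcases le_total t m with h' | h'
      · exact Or.inl ⟨t, ⟨⟨ht.1, h'⟩, h⟩, rfl⟩
      · exact Or.inr ⟨t, ⟨⟨h', ht.2⟩, h⟩, rfl⟩
    · rintro (⟨t, ⟨ht, h⟩, rfl⟩ | ⟨t, ⟨ht, h⟩, rfl⟩)
      · exact ⟨⟨t, ⟨ht.1, ht.2.trans hm.2⟩, rfl⟩, h⟩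
      · exact ⟨⟨t, ⟨hm.1.trans ht.1, ht.2⟩, rfl⟩, h⟩
  by_cases h0 : g (φ 0) ≤ c
  · rw [heq]
    refine IsPreconnected.union (φ 0) ⟨0, ⟨⟨le_rfl, hm.1⟩, h0⟩, rfl⟩
      ⟨1, ⟨⟨hm.2, le_rfl⟩, by rwa [h01]⟩, h01⟩ (hT1.isPreconnected.image _ hφ.continuousOn)
      (hT2.isPreconnected.image _ hφ.continuousOn)
  · have : {x | x ∈ Γ ∧ g x ≤ c} = ∅ := by
      rw [heq, eq_empty_iff_forall_notMem]
      rintro x (⟨t, ⟨ht, h⟩, rfl⟩ | ⟨t, ⟨ht, h⟩, rfl⟩)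
      · exact h0 ((hmono ⟨le_rfl, hm.1⟩ ht ht.1).trans h)
      · have := hanti ht ⟨hm.2, le_rfl⟩ ht.2
        simp only [Function.comp_apply, h01] at this
        exact h0 (this.trans h)
    rw [this]
    exact isPreconnected_empty

/-- Joining two points of a superlevel set. -/
lemma join_super {G : Set E2} (hG : IsOpen G) (hb : Bornology.IsBounded G) {u : E2 → ℝ}
    (hucont : ContinuousOn u (closure G)) (hmax : ∀ x ∈ G, ¬ IsLocalMax u x) {c : ℝ} {p q : E2}
    (hp : p ∈ G) (hcp : c ≤ u p) (hq : q ∈ G) (hcq : c ≤ u q)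
    (hpre : IsPreconnected {x | x ∈ frontier G ∧ c ≤ u x}) :
    ∃ A : Set E2, A ⊆ {x | x ∈ closure G ∧ c ≤ u x} ∧ IsCompact A ∧ IsPreconnected A ∧ p ∈ A ∧
      q ∈ A := by
  obtain ⟨A, hA1, hA2, hA3, hA4, a, ha1, ha2⟩ := comp_meets hG hb hucont hmax hp hcp
  obtain ⟨B, hB1, hB2, hB3, hB4, b, hb1, hb2⟩ := comp_meets hG hb hucont hmax hq hcq
  set M : Set E2 := {x | x ∈ frontier G ∧ c ≤ u x} with hM
  have hMc : IsClosed M :=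
    (hucont.mono frontier_subset_closure).preimage_isClosed_of_isClosed isClosed_frontier isClosed_Ici
  have hMk : IsCompact M :=
    hb.isCompact_closure.of_isClosed_subset hMc fun x hx => frontier_subset_closure hx.1
  refine ⟨(A ∪ M) ∪ B, ?_, (hA2.union hMk).union hB2, ?_, Or.inl (Or.inl hA4), Or.inr hB4⟩
  · rintro x ((h | h) | h)
    · exact hA1 h
    · exact ⟨frontier_subset_closure h.1, h.2⟩
    · exact hB1 h
  · refine IsPreconnected.union b (Or.inr ⟨hb2, (hB1 hb1).2⟩) hb1 ?_ hB3
    exact IsPreconnected.union a ha1 ⟨ha2, (hA1 ha1).2⟩ hA3 hpre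

end
end

section
open MeasureTheory Set
open scoped Topology NNReal

noncomputable section

lemma no_crit {G : Set E2} (hG : IsOpen G) (hb : Bornology.IsBounded G) {u g : E2 → ℝ}
    (hg : UnimodalOn g (frontier G)) (hbdry : Set.EqOn u g (frontier G))
    (hucont : ContinuousOn u (closure G)) (hmax : ∀ x ∈ G, ¬ IsLocalMax u x)
    (hmin : ∀ x ∈ G, ¬ IsLocalMin u x) {x0 : E2} (hx0 : x0 ∈ G) (hcr : CritStr u x0) : False := by
  obtain ⟨L, -, a1, a2, a3, a4, h12, h23, h34, h41, r1, r2, r3, r4⟩ := hcr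
  have hin : ∀ a : ℝ, ∀ᶠ r : ℝ in 𝓝[>] 0, x0 + L ((r:ℂ) * Complex.exp (a * Complex.I)) ∈ G :=
    fun a => (ray_tendsto x0 L a).eventually (hG.mem_nhds hx0)
  have hall : ∀ᶠ r : ℝ in 𝓝[>] 0, ∀ a ∈ ({(a1, 1), (a2, -1), (a3, 1), (a4, -1)} : Set (ℝ × ℝ)),
      x0 + L ((r:ℂ) * Complex.exp (a.1 * Complex.I)) ∈ G ∧
      0 < a.2 * (u (x0 + L ((r:ℂ) * Complex.exp (a.1 * Complex.I))) - u x0) := by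
    filter_upwards [r1, r2, r3, r4, hin a1, hin a2, hin a3, hin a4] with r b1 b2 b3 b4 c1 c2 c3 c4
    rintro a (rfl | rfl | rfl | rfl)
    · exact ⟨c1, b1⟩
    · exact ⟨c2, b2⟩
    · exact ⟨c3, b3⟩
    · exact ⟨c4, b4⟩
  obtain ⟨r, hr, hr2⟩ := (mem_nhdsGT_iff_exists_Ioc_subset).1 hall
  have hr : 0 < r := hr
  have key : ∀ t ∈ Ioc 0 r, ∀ a ∈ ({(a1, 1), (a2, -1), (a3, 1), (a4, -1)} : Set (ℝ × ℝ)),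
      x0 + L ((t:ℂ) * Complex.exp (a.1 * Complex.I)) ∈ G ∧
      0 < a.2 * (u (x0 + L ((t:ℂ) * Complex.exp (a.1 * Complex.I))) - u x0) := fun t ht => hr2 ht
  set P : ℝ → ℝ → E2 := fun t a => x0 + L ((t:ℂ) * Complex.exp (a * Complex.I)) with hP
  have k1 : ∀ t ∈ Ioc 0 r, P t a1 ∈ G ∧ u x0 < u (P t a1) := fun t ht => by
    have := key t ht (a1, 1) (by simp)
    exact ⟨this.1, by have := this.2; simp only [hP]; linarith⟩
  have k2 : ∀ t ∈ Ioc 0 r, P t a2 ∈ G ∧ u (P t a2) < u x0 := fun t ht => by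
    have := key t ht (a2, -1) (by simp)
    exact ⟨this.1, by have := this.2; simp only [hP]; linarith⟩
  have k3 : ∀ t ∈ Ioc 0 r, P t a3 ∈ G ∧ u x0 < u (P t a3) := fun t ht => by
    have := key t ht (a3, 1) (by simp)
    exact ⟨this.1, by have := this.2; simp only [hP]; linarith⟩
  have k4 : ∀ t ∈ Ioc 0 r, P t a4 ∈ G ∧ u (P t a4) < u x0 := fun t ht => by
    have := key t ht (a4, -1) (by simp)
    exact ⟨this.1, by have := this.2; simp only [hP]; linarith⟩
  have hrr : r ∈ Ioc 0 r := ⟨hr, le_rfl⟩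
  set c := min (u (P r a1)) (u (P r a3)) with hc
  set d := max (u (P r a2)) (u (P r a4)) with hd
  have hcx : u x0 < c := lt_min (k1 r hrr).2 (k3 r hrr).2
  have hdx : d < u x0 := max_lt (k2 r hrr).2 (k4 r hrr).2
  have hs1 : IsPreconnected {x | x ∈ frontier G ∧ c ≤ u x} := by
    have : {x | x ∈ frontier G ∧ c ≤ u x} = {x | x ∈ frontier G ∧ c ≤ g x} := by
      ext x
      exact and_congr_right fun hx => by rw [hbdry hx]
    rw [this]; exact unimodal_super hg c
  have hs2 : IsPreconnected {x | x ∈ frontier G ∧ -d ≤ -u x} := by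
    have : {x | x ∈ frontier G ∧ -d ≤ -u x} = {x | x ∈ frontier G ∧ g x ≤ d} := by
      ext x
      exact and_congr_right fun hx => by rw [hbdry hx, neg_le_neg_iff]
    rw [this]; exact unimodal_sub hg d
  obtain ⟨A, hA1, hA2, hA3, hA4, hA5⟩ := join_super hG hb hucont hmax (k1 r hrr).1 (min_le_left _ _)
    (k3 r hrr).1 (min_le_right _ _) hs1
  obtain ⟨B, hB1, -, hB3, hB4, hB5⟩ := join_super (u := fun x => - u x) (c := -d) hG hb hucont.neg
    (fun x hx h => hmin x hx (by simpa using h.neg)) (k2 r hrr).1 (neg_le_neg (le_max_left _ _))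
    (k4 r hrr).1 (neg_le_neg (le_max_right _ _)) hs2
  have hB1' : ∀ x ∈ B, u x ≤ d := fun x hx => neg_le_neg_iff.1 (hB1 hx).2
  have hA1' : ∀ x ∈ A, c ≤ u x := fun x hx => (hA1 hx).2
  set ψ : E2 → ℂ := fun x => L.symm (x - x0) with hψ
  have hψc : Continuous ψ := by fun_prop
  have hmem : ∀ (S : Set E2) (z : ℂ), z ∈ ψ '' S ↔ x0 + L z ∈ S := by
    intro S z
    constructor
    · rintro ⟨x, hx, rfl⟩
      simpa [hψ] using hx
    · intro h
      exact ⟨_, h, by simp [hψ]⟩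
  refine topo_crossing (A := ψ '' A) (B := ψ '' B) (hA2.image hψc)
    (hA3.image _ hψc.continuousOn) (hB3.image _ hψc.continuousOn) ?_ ?_ ?_ h12 h23 h34 h41 hr
    ((hmem _ _).2 hA4) ((hmem _ _).2 hA5) ((hmem _ _).2 hB4) ((hmem _ _).2 hB5) ?_ ?_ ?_ ?_
  · rw [disjoint_left]
    intro z hz1 hz2
    rw [hmem] at hz1 hz2
    linarith [hA1' _ hz1, hB1' _ hz2]
  · intro h
    rw [hmem] at h
    have := hA1' _ h
    simp at this; linarith
  · intro h
    rw [hmem] at h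
    have := hB1' _ h
    simp at this; linarith
  · intro t ht h
    have := hB1' _ ((hmem _ _).1 h)
    linarith [(k1 t ht).2]
  · intro t ht h
    have := hB1' _ ((hmem _ _).1 h)
    linarith [(k3 t ht).2]
  · intro t ht h
    have := hA1' _ ((hmem _ _).1 h)
    linarith [(k2 t ht).2]
  · intro t ht h
    have := hA1' _ ((hmem _ _).1 h)
    linarith [(k4 t ht).2]

end
end

/-- **Nonvanishing of the gradient for unimodal data (Hölder coefficients).**  Let `G` be a
Jordan domain with boundary `Γ`, `σ` an elliptic matrix field on `G` with locally
`α`-Hölder continuous entries (`α ∈ (0,1)`), `g` a continuous unimodal function on `Γ`,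
and `u ∈ W^{1,2}_loc(G) ∩ C(cl G)` the weak solution of `div(σ∇u) = 0` in `G` with `u = g`
on `Γ` (by elliptic regularity `u` is `C¹` inside `G`, which is assumed so that the
gradient is classical).  Then `|∇u| > 0` everywhere in `G`; more precisely, on every
compact `Q ⊆ G` there is a constant `C > 0` with `|∇u| ≥ C⁻¹` on `Q`. -/
theorem unimodal_gradient_nonvanishing_holder
    (G : Set E2) (hG : IsJordanDomain G)
    (K : ℝ) (hK : 1 ≤ K)
    (σ : E2 → Matrix (Fin 2) (Fin 2) ℝ)
    (hell : ∀ x ∈ G, ∀ ξ : Fin 2 → ℝ,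
      K⁻¹ * (ξ 0 ^ 2 + ξ 1 ^ 2) ≤ ∑ i, (σ x).mulVec ξ i * ξ i ∧
      K⁻¹ * (ξ 0 ^ 2 + ξ 1 ^ 2) ≤ ∑ i, (σ x)⁻¹.mulVec ξ i * ξ i)
    (α : ℝ≥0) (hα0 : 0 < α) (hα1 : α < 1)
    (hHolder : ∀ i j : Fin 2, ∀ x ∈ G, ∃ s ∈ 𝓝[G] x, ∃ C : ℝ≥0,
      HolderOnWith C α (fun y => σ y i j) s)
    (g : E2 → ℝ) (hg : UnimodalOn g (frontier G))
    (u : E2 → ℝ) (hureg : ContDiffOn ℝ 1 u G)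
    (hucont : ContinuousOn u (closure G))
    (hbdry : Set.EqOn u g (frontier G))
    (hsol : ∀ φ : E2 → ℝ, IsTestOn G φ →
      ∫ x in G, ∑ k, (∑ j, σ x k j * fderiv ℝ u x (e2 j)) * fderiv ℝ φ x (e2 k) = 0) :
    (∀ x ∈ G, fderiv ℝ u x ≠ 0) ∧
    ∀ Q : Set E2, IsCompact Q → Q ⊆ G →
      ∃ C : ℝ, 0 < C ∧ ∀ x ∈ Q, C⁻¹ ≤ ‖fderiv ℝ u x‖ := by
  obtain ⟨hGo, hGc, hGb, -⟩ := hG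
  have hcrit : ∀ x0 ∈ G, fderiv ℝ u x0 = 0 → (¬ ∀ᶠ x in 𝓝 x0, u x = u x0) → CritStr u x0 := by
    intro x0 hx0 hd hnc
    obtain ⟨L, f, f', C, R, hL, hf0, hre⟩ :=
      coords hGo hK (fun x hx ξ => (hell x hx ξ).1) hα0 hα1 hHolder hureg hsol hx0 hd
    exact critStr_of_coords hL hf0 hre hnc
  have hncst : ¬ ∃ c, ∀ x ∈ G, u x = c := by
    rintro ⟨c, hc⟩
    apply hg.2.1
    refine ⟨c, fun x hx => ?_⟩
    rw [← hbdry hx]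
    have h1 : Set.EqOn u (fun _ => c) (closure G) :=
      Set.EqOn.of_subset_closure (s := G) (fun x hx => hc x hx) hucont continuousOn_const
        subset_closure subset_rfl
    exact h1 (frontier_subset_closure hx)
  have hnc := nowhere_const hGo hGc hureg hcrit hncst
  have hmax : ∀ x ∈ G, ¬ IsLocalMax u x := fun x hx h =>
    (hcrit x hx h.fderiv_eq_zero (hnc x hx)).not_max h
  have hmin : ∀ x ∈ G, ¬ IsLocalMin u x := fun x hx h =>
    (hcrit x hx h.fderiv_eq_zero (hnc x hx)).not_min h
  have hne : ∀ x ∈ G, fderiv ℝ u x ≠ 0 := fun x hx h =>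
    no_crit hGo hGb hg hbdry hucont hmax hmin hx (hcrit x hx h (hnc x hx))
  refine ⟨hne, fun Q hQ hQG => ?_⟩
  rcases Q.eq_empty_or_nonempty with rfl | hQne
  · exact ⟨1, one_pos, by simp⟩
  · have hcd : ContinuousOn (fun x => ‖fderiv ℝ u x‖) Q :=
      ((hureg.continuousOn_fderiv_of_isOpen hGo le_rfl).mono hQG).norm
    obtain ⟨y, hy, hym⟩ := hQ.exists_isMinOn hQne hcd
    have hpos : 0 < ‖fderiv ℝ u y‖ := norm_pos_iff.2 (hne y (hQG hy))
    refine ⟨‖fderiv ℝ u y‖⁻¹, inv_pos.2 hpos, fun x hx => ?_⟩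
    rw [inv_inv]
    exact hym hx
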